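/- Let p ∈ ℂ[x,y] be an irreducible polynomial whose zero set Z = {(x,y) ∈ ℂ² : p(x,y) = 0} is nonempty, such that at every point of Z at least one of the partial derivatives ∂p/∂x, ∂p/∂y is nonzero, and such that Z, equipped with the subspace topology from ℂ², is homeomorphic to ℂ. Then there exists a ℂ-algebra automorphism φ of ℂ[x,y] such that φ(p) = x. -/

import Mathlib

section
namespace AMS
set_option linter.unusedSectionVars false
set_option linter.unusedVariables false
open Polynomial

/-- degree of difference of monic polynomials of the same degree. -/
lemma degree_sub_lt_of_monic {A : Type*} [CommRing A] {P Q : A[X]} {k : ℕ}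
    (hP : P.Monic) (hQ : Q.Monic) (h1 : P.natDegree = k) (h2 : Q.natDegree = k) :
    (P - Q).degree < k := by
  nontriviality A
  have := degree_sub_lt_left (p := P) (q := Q)
    (by rw [degree_eq_natDegree hP.ne_zero, degree_eq_natDegree hQ.ne_zero, h1, h2])
    hP.ne_zero (by rw [hP.leadingCoeff, hQ.leadingCoeff])
  rwa [degree_eq_natDegree hP.ne_zero, h1] at this

lemma degree_mul_lt' {A : Type*} [CommRing A] {P Q : A[X]} {a b : ℕ}
    (hP : P.degree ≤ a) (hQ : Q.degree < b) : (P * Q).degree < (a + b : ℕ) := by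
  by_cases h : P * Q = 0
  · rw [h, degree_zero]; exact WithBot.bot_lt_coe _
  · have hQ0 : Q ≠ 0 := by rintro rfl; simp at h
    rw [← natDegree_lt_iff_degree_lt h]
    have h1 := natDegree_mul_le (p := P) (q := Q)
    have h2 := natDegree_le_of_degree_le hP
    have h3 := (natDegree_lt_iff_degree_lt hQ0).2 hQ
    omega

lemma monic_add_lt {A : Type*} [CommRing A] [Nontrivial A] {P Q : A[X]} {N : ℕ} (hP : P.Monic)
    (hN : P.natDegree = N) (hQ : Q.degree < N) : (P + Q).Monic ∧ (P + Q).natDegree = N := by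
  have h : Q.degree < P.degree := by rwa [degree_eq_natDegree hP.ne_zero, hN]
  exact ⟨hP.add_of_left h, by rw [natDegree_add_eq_left_of_degree_lt h, hN]⟩

lemma approx_root {A : Type*} [CommRing A] [Nontrivial A] (N d : ℕ) (hd : d ≠ 0) (u : A)
    (hu : (d : A) * u = 1) (F Φ : A[X]) (hF : F.Monic) (hFd : F.natDegree = d * N)
    (hΦ : Φ.Monic) (hΦd : Φ.natDegree = N) (Pr : A[X] → Prop) (h0 : Pr 0)
    (hstep : ∀ Ψ, Pr Ψ → Pr (Ψ + C u * ((F - (Φ + Ψ) ^ d) /ₘ (Φ ^ (d - 1))))) :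
    ∃ Ψ, Pr Ψ ∧ Ψ.degree < N ∧ (F - (Φ + Ψ) ^ d).degree < ((d - 1) * N : ℕ) := by
  obtain ⟨e, rfl⟩ : ∃ e, d = e + 1 := ⟨d - 1, by omega⟩
  simp only [Nat.add_sub_cancel] at *
  suffices H : ∀ s, s ≤ N → ∃ Ψ, Pr Ψ ∧ Ψ.degree < N ∧
      (F - (Φ + Ψ) ^ (e + 1)).degree < (e * N + (N - s) : ℕ) by
    simpa using H N le_rfl
  intro s
  induction s with
  | zero =>
    intro _
    refine ⟨0, h0, by rw [degree_zero]; exact WithBot.bot_lt_coe _, ?_⟩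
    rw [add_zero]
    refine degree_sub_lt_of_monic hF (hΦ.pow _) (by rw [hFd]; simp; ring)
      (by rw [hΦ.natDegree_pow, hΦd]; simp; ring)
  | succ s ih =>
    intro hs
    obtain ⟨Ψ, h1, h2, h3⟩ := ih (by omega)
    set D := F - (Φ + Ψ) ^ (e + 1) with hD
    have hm : (Φ ^ e).Monic := hΦ.pow e
    have hmd : (Φ ^ e).natDegree = e * N := by rw [hΦ.natDegree_pow, hΦd]
    set Q := D /ₘ (Φ ^ e) with hQ
    set h := C u * Q with hh
    have hdR : (D %ₘ Φ ^ e).degree < (e * N : ℕ) := by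
      have := degree_modByMonic_lt D hm
      rwa [degree_eq_natDegree hm.ne_zero, hmd] at this
    have hQd : Q.degree ≤ (N - (s + 1) : ℕ) := by
      have hn : D.natDegree ≤ e * N + (N - (s+1)) := by
        by_cases hD0 : D = 0
        · simp [hD0]
        · have := (natDegree_lt_iff_degree_lt hD0).2 h3
          omega
      refine (degree_le_iff_coeff_zero _ _).2 fun m hm' => ?_
      have h4 : Q.natDegree = D.natDegree - e * N := by
        rw [hQ, natDegree_divByMonic _ hm, hmd]
      apply coeff_eq_zero_of_natDegree_lt
      have : N - (s+1) < m := by exact_mod_cast hm'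
      omega
    have hhd : h.degree ≤ (N - (s + 1) : ℕ) := by
      rw [hh]; exact (degree_mul_le _ _).trans (by simpa using add_le_add (degree_C_le (a := u)) hQd)
    have hhN : h.degree < N := lt_of_le_of_lt hhd (by exact_mod_cast (by omega : N - (s+1) < N))
    have hΨ' : (Ψ + h).degree < N := lt_of_le_of_lt (degree_add_le _ _) (max_lt h2 hhN)
    refine ⟨Ψ + h, hstep Ψ h1, hΨ', ?_⟩
    obtain ⟨hG, hGd⟩ := monic_add_lt hΦ hΦd h2
    obtain ⟨hG', hGd'⟩ := monic_add_lt hΦ hΦd hΨ'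
    set G := Φ + Ψ with hGdef
    set G' := Φ + (Ψ + h) with hG'def
    have hsub : G' - G = h := by rw [hGdef, hG'def]; ring
    have hQh : Q = ∑ i ∈ Finset.range (e + 1), h := by
      rw [Finset.sum_const, Finset.card_range, nsmul_eq_mul, hh, ← mul_assoc]
      have : ((e + 1 : ℕ) : A[X]) * C u = 1 := by
        rw [← C_eq_natCast, ← C_mul, hu, C_1]
      rw [this, one_mul]
    have hgs := geom_sum₂_mul G' G (e+1)
    have key : F - G' ^ (e+1) = D %ₘ Φ ^ e +
        h * ∑ i ∈ Finset.range (e + 1), (Φ ^ e - G' ^ i * G ^ (e + 1 - 1 - i)) := by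
      have h5 : F - G' ^ (e+1) = D - (G' ^ (e+1) - G ^ (e+1)) := by rw [hD]; ring
      rw [h5, ← hgs, hsub, Finset.sum_sub_distrib, mul_sub]
      conv_lhs => rw [← modByMonic_add_div D (Φ ^ e), ← hQ, hQh]
      simp only [Finset.sum_const, Finset.card_range, nsmul_eq_mul]
      ring
    rw [key]
    refine lt_of_le_of_lt (degree_add_le _ _) (max_lt (hdR.trans_le ?_) ?_)
    · exact_mod_cast Nat.le_add_right _ _
    · have hsum : (∑ i ∈ Finset.range (e + 1),
          (Φ ^ e - G' ^ i * G ^ (e + 1 - 1 - i))).degree < (e * N : ℕ) := by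
        refine lt_of_le_of_lt (degree_sum_le _ _) ?_
        rw [Finset.sup_lt_iff (WithBot.bot_lt_coe _)]
        intro i hi
        have hi' : i ≤ e := by have := Finset.mem_range.1 hi; omega
        refine degree_sub_lt_of_monic hm ((hG'.pow i).mul (hG.pow _)) hmd ?_
        rw [(hG'.pow i).natDegree_mul (hG.pow _), hG'.natDegree_pow, hG.natDegree_pow, hGd, hGd',
          ← add_mul]
        congr 1; omega
      rw [add_comm (e * N)]
      exact degree_mul_lt' hhd hsum

lemma approx_root_unique {A : Type*} [CommRing A] [IsDomain A] (N d : ℕ) (hd : d ≠ 0)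
    (hdA : (d : A) ≠ 0) (F G H : A[X])
    (hG : G.Monic) (hGd : G.natDegree = N) (hH : H.Monic) (hHd : H.natDegree = N)
    (h1 : (F - G ^ d).degree < ((d - 1) * N : ℕ)) (h2 : (F - H ^ d).degree < ((d - 1) * N : ℕ)) :
    G = H := by
  have h3 : (G ^ d - H ^ d).degree < ((d - 1) * N : ℕ) := by
    have : G ^ d - H ^ d = (F - H ^ d) - (F - G ^ d) := by ring
    rw [this]
    exact lt_of_le_of_lt (degree_sub_le _ _) (max_lt h2 h1)
  rw [← geom_sum₂_mul G H d] at h3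
  by_contra hne
  have hne' : G - H ≠ 0 := sub_ne_zero.2 hne
  set S := ∑ i ∈ Finset.range d, G ^ i * H ^ (d - 1 - i) with hS
  have hc : S.coeff ((d - 1) * N) = d := by
    rw [hS, finsetSum_coeff]
    rw [Finset.sum_congr rfl (g := fun _ => (1 : A))]
    · simp
    intro i hi
    have hi' := Finset.mem_range.1 hi
    have hm := (hG.pow i).mul (hH.pow (d - 1 - i))
    have hmd : (G ^ i * H ^ (d - 1 - i)).natDegree = (d - 1) * N := by
      rw [(hG.pow i).natDegree_mul (hH.pow _), hG.natDegree_pow, hH.natDegree_pow, hGd, hHd,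
          ← add_mul]
      congr 1; omega
    rw [← hmd]; exact hm.coeff_natDegree
  have hS1 : ((d - 1) * N) ≤ S.natDegree := le_natDegree_of_ne_zero (by rw [hc]; exact hdA)
  have hS0 : S ≠ 0 := by rintro h; rw [h] at hc; simp at hc; exact hdA hc.symm
  rw [← natDegree_lt_iff_degree_lt (mul_ne_zero hS0 hne'), natDegree_mul hS0 hne'] at h3
  omega

section bd
variable {L : Type*} [Field L] (a : AbsoluteValue L ℝ) (hna : IsNonarchimedean a)
  (hnat : ∀ n : ℕ, n ≠ 0 → a n = 1) {ι : Type*} [Fintype ι] [DecidableEq ι] (c : ι → L) (e : ℝ)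

/-- bounded by `β` at distance exactly `e` from the centers -/
def Bd (P : L[X]) (β : ℝ) : Prop := ∀ i z, a (z - c i) = e → a (P.eval z) ≤ β

variable {a c e}
include hna

lemma sum_le' {κ : Type*} (s : Finset κ) (f : κ → L) {β : ℝ} (hβ : 0 ≤ β)
    (h : ∀ i ∈ s, a (f i) ≤ β) : a (∑ i ∈ s, f i) ≤ β := by
  rcases s.eq_empty_or_nonempty with rfl | hs
  · simpa using hβ
  · obtain ⟨b, hb, hb'⟩ := IsNonarchimedean.finset_image_add_of_nonempty hna f hs
    exact hb'.trans (h b hb)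

lemma Bd.add {P Q : L[X]} {β : ℝ} (hP : Bd a c e P β) (hQ : Bd a c e Q β) :
    Bd a c e (P + Q) β := fun i z hz => by
  rw [eval_add]
  exact (hna _ _).trans (max_le (hP i z hz) (hQ i z hz))

lemma Bd.sub {P Q : L[X]} {β : ℝ} (hP : Bd a c e P β) (hQ : Bd a c e Q β) :
    Bd a c e (P - Q) β := fun i z hz => by
  rw [eval_sub, sub_eq_add_neg]
  exact (hna _ _).trans (max_le (hP i z hz) (by rw [a.map_neg]; exact hQ i z hz))

include hnat in
lemma Bd.center {P : L[X]} {β : ℝ} (hβ : 0 ≤ β) {ϖ : L} (hϖ : a ϖ = e)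
    (hP : Bd a c e P β) (i : ι) : a (P.eval (c i)) ≤ β := by
  set M := P.natDegree + 1 with hM
  set Q : L[X] := P.comp (C ϖ * X + C (c i)) with hQ
  have hQd : Q.natDegree < M := by
    have h1 : (C ϖ * X + C (c i)).natDegree ≤ 1 := natDegree_linear_le
    have := natDegree_comp_le (p := P) (q := C ϖ * X + C (c i))
    have : P.natDegree * (C ϖ * X + C (c i)).natDegree ≤ P.natDegree * 1 :=
      Nat.mul_le_mul_left _ h1
    rw [hQ]; omega
  have h := congrFun (Polynomial.fwdDiff_iter_eq_zero_of_degree_lt hQd) 0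
  rw [fwdDiff_iter_eq_sum_shift, Finset.sum_range_succ'] at h
  have h0 : ((-1 : ℤ) ^ (M - 0) * (M.choose 0 : ℤ)) • Q.eval (0 + 0 • (1:L)) =
    (-1) ^ M * P.eval (c i) := by simp [hQ]
  rw [h0] at h
  have h1 : a ((-1) ^ M * P.eval (c i)) = a (P.eval (c i)) := by simp
  rw [← h1, eq_neg_of_add_eq_zero_right h, a.map_neg]
  refine sum_le' hna _ _ hβ fun k hk => ?_
  have hk' : k + 1 ≤ M := by have := Finset.mem_range.1 hk; omega
  rw [zsmul_eq_mul, a.map_mul]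
  have h2 : a (((-1 : ℤ) ^ (M - (k+1)) * (M.choose (k+1) : ℤ) : ℤ) : L) = 1 := by
    push_cast
    rw [a.map_mul, a.map_pow, a.map_neg, a.map_one, one_pow, one_mul]
    exact hnat _ (Nat.choose_pos hk').ne'
  rw [h2, one_mul]
  have h3 : Q.eval (0 + (k + 1) • (1 : L)) = P.eval (ϖ * ((k + 1 : ℕ) : L) + c i) := by
    simp [hQ]
  rw [h3]
  refine hP i _ ?_
  rw [add_sub_cancel_right, a.map_mul, hnat _ (by omega), hϖ, mul_one]

omit hna in
lemma Bd.mul {P Q : L[X]} {β γ : ℝ} (hβ : 0 ≤ β) (hP : Bd a c e P β) (hQ : Bd a c e Q γ) :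
    Bd a c e (P * Q) (β * γ) := fun i z hz => by
  rw [eval_mul, a.map_mul]
  exact mul_le_mul (hP i z hz) (hQ i z hz) (a.nonneg _) hβ

omit hna in
lemma Bd.pow {P : L[X]} {β : ℝ} (hP : Bd a c e P β) (k : ℕ) :
    Bd a c e (P ^ k) (β ^ k) := fun i z hz => by
  rw [eval_pow, a.map_pow]
  exact pow_le_pow_left₀ (a.nonneg _) (hP i z hz) k

lemma dist_eq (hsep : ∀ i j, i ≠ j → e < a (c i - c j)) {i j : ι} (hij : i ≠ j) {z : L}
    (hz : a (z - c i) = e) : a (z - c j) = a (c i - c j) := by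
  have : z - c j = (z - c i) + (c i - c j) := by ring
  rw [this]
  exact IsNonarchimedean.add_eq_right_of_lt hna (by rw [hz]; exact hsep i j hij)

/-- nodal polynomial -/
noncomputable def Phi (c : ι → L) : L[X] := Lagrange.nodal Finset.univ c

lemma Phi_eval (hsep : ∀ i j, i ≠ j → e < a (c i - c j)) {B : ℝ}
    (hB : ∀ i, ∏ j ∈ Finset.univ.erase i, a (c i - c j) = B) {i : ι} {z : L}
    (hz : a (z - c i) = e) : a ((Phi c).eval z) = e * B := by
  rw [Phi, Lagrange.eval_nodal, map_prod, ← Finset.mul_prod_erase _ _ (Finset.mem_univ i), hz,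
    ← hB i]
  congr 1
  refine Finset.prod_congr rfl fun j hj => dist_eq hna hsep (Finset.ne_of_mem_erase hj).symm hz

include hnat in
lemma Bd.mod {P : L[X]} {β : ℝ} (hβ : 0 ≤ β) {ϖ : L} (hϖ : a ϖ = e) (he : 0 < e)
    (hsep : ∀ i j, i ≠ j → e < a (c i - c j)) {B : ℝ} (hBp : 0 < B)
    (hB : ∀ i, ∏ j ∈ Finset.univ.erase i, a (c i - c j) = B)
    (hP : Bd a c e P β) : Bd a c e (P %ₘ Phi c) β := by
  intro i z hz
  have hm : (Phi c).Monic := Lagrange.nodal_monic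
  have hinj : Set.InjOn c (Finset.univ : Finset ι) := by
    intro i _ j _ hij
    by_contra h
    have := hsep i j h
    rw [hij] at this; simp at this; linarith
  have hd : (P %ₘ Phi c).degree < (Finset.univ : Finset ι).card := by
    have := degree_modByMonic_lt P hm
    rwa [degree_eq_natDegree hm.ne_zero, Phi, Lagrange.natDegree_nodal] at this
  rw [Lagrange.eq_interpolate hinj hd, Lagrange.interpolate_apply, eval_finsetSum]
  refine sum_le' hna _ _ hβ fun j _ => ?_
  have h1 : (P %ₘ Phi c).eval (c j) = P.eval (c j) := by
    conv_rhs => rw [← modByMonic_add_div P (Phi c)]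
    rw [eval_add, eval_mul, Phi, Lagrange.eval_nodal_at_node (Finset.mem_univ j)]; simp
  rw [h1, eval_mul, eval_C, a.map_mul]
  have h2 : a ((Lagrange.basis Finset.univ c j).eval z) ≤ 1 := by
    have hprod : a ((Lagrange.basis Finset.univ c j).eval z) * B =
        ∏ l ∈ Finset.univ.erase j, a (z - c l) := by
      rw [Lagrange.basis, eval_prod, map_prod, ← hB j, ← Finset.prod_mul_distrib]
      refine Finset.prod_congr rfl fun l hl => ?_
      have hne : a (c j - c l) ≠ 0 := by
        have := hsep j l (Finset.ne_of_mem_erase hl).symm; linarith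
      simp only [Lagrange.basisDivisor, eval_mul, eval_C, eval_sub, eval_X, a.map_mul, map_inv₀]
      field_simp
    have htot := Phi_eval hna hsep hB hz
    rw [Phi, Lagrange.eval_nodal, map_prod, ← Finset.mul_prod_erase _ _ (Finset.mem_univ j),
      ← hprod] at htot
    have hge : e ≤ a (z - c j) := by
      by_cases hij : i = j
      · rw [← hij, hz]
      · rw [dist_eq hna hsep hij hz]; exact (hsep i j hij).le
    have hx := a.nonneg ((Lagrange.basis Finset.univ c j).eval z)
    by_contra hcon
    push Not at hcon
    have : e * B < a (z - c j) * (a ((Lagrange.basis Finset.univ c j).eval z) * B) := by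
      refine mul_lt_mul' hge ?_ hBp.le (by linarith)
      nlinarith
    linarith
  calc _ ≤ β * 1 := mul_le_mul (hP.center hna hnat hβ hϖ j) h2 (a.nonneg _) hβ
    _ = β := mul_one _

include hnat in
lemma Bd.div {P : L[X]} {β : ℝ} (hβ : 0 ≤ β) {ϖ : L} (hϖ : a ϖ = e) (he : 0 < e)
    (hsep : ∀ i j, i ≠ j → e < a (c i - c j)) {B : ℝ} (hBp : 0 < B)
    (hB : ∀ i, ∏ j ∈ Finset.univ.erase i, a (c i - c j) = B)
    (hP : Bd a c e P β) : Bd a c e (P /ₘ Phi c) (β / (e * B)) := by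
  intro i z hz
  have h1 := (hP.sub hna (hP.mod hna hnat hβ hϖ he hsep hBp hB)) i z hz
  have h2 : P - P %ₘ Phi c = Phi c * (P /ₘ Phi c) := by
    conv_lhs => enter [1]; rw [← modByMonic_add_div P (Phi c)]
    ring
  rw [h2, eval_mul, a.map_mul, Phi_eval hna hsep hB hz] at h1
  rw [le_div_iff₀ (mul_pos he hBp)]; linarith

omit hna in
lemma divByMonic_pow_succ {A : Type*} [CommRing A] [Nontrivial A] {P Q : A[X]} (hQ : Q.Monic)
    (k : ℕ) : P /ₘ Q ^ (k + 1) = (P /ₘ Q) /ₘ Q ^ k := by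
  refine (div_modByMonic_unique _ (P %ₘ Q + Q * ((P /ₘ Q) %ₘ Q ^ k)) (hQ.pow _) ⟨?_, ?_⟩).1
  · have h1 := modByMonic_add_div P Q
    have h2 := modByMonic_add_div (P /ₘ Q) (Q ^ k)
    calc _ = P %ₘ Q + Q * ((P /ₘ Q) %ₘ Q ^ k + Q ^ k * (P /ₘ Q /ₘ Q ^ k)) := by ring
      _ = P := by rw [h2, h1]
  · have h1 := degree_modByMonic_lt P hQ
    have h2 := degree_modByMonic_lt (P /ₘ Q) (hQ.pow k)
    rw [degree_eq_natDegree hQ.ne_zero] at h1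
    rw [degree_eq_natDegree (hQ.pow k).ne_zero] at h2
    rw [degree_eq_natDegree (hQ.pow (k+1)).ne_zero, pow_succ', hQ.natDegree_mul (hQ.pow k)]
    refine lt_of_le_of_lt (degree_add_le _ _) (max_lt (h1.trans_le ?_) ?_)
    · exact_mod_cast Nat.le_add_right _ _
    · exact degree_mul_lt' (degree_le_natDegree) h2

include hnat in
lemma Bd.div_pow {ϖ : L} (hϖ : a ϖ = e) (he : 0 < e)
    (hsep : ∀ i j, i ≠ j → e < a (c i - c j)) {B : ℝ} (hBp : 0 < B)
    (hB : ∀ i, ∏ j ∈ Finset.univ.erase i, a (c i - c j) = B) (k : ℕ) :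
    ∀ {P : L[X]} {β : ℝ}, 0 ≤ β → Bd a c e P β →
      Bd a c e (P /ₘ (Phi c) ^ k) (β / (e * B) ^ k) := by
  induction k with
  | zero => intro P β _ hP; simpa using hP
  | succ k ih =>
    intro P β hβ hP
    rw [divByMonic_pow_succ (Q := Phi c) Lagrange.nodal_monic, pow_succ', ← div_div]
    exact ih (div_nonneg hβ (mul_pos he hBp).le) (hP.div hna hnat hβ hϖ he hsep hBp hB)

include hnat in
theorem key_bound {ϖ : L} (hϖ : a ϖ = e) (he : 0 < e)
    (hsep : ∀ i j, i ≠ j → e < a (c i - c j)) {B : ℝ} (hBp : 0 < B)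
    (hB : ∀ i, ∏ j ∈ Finset.univ.erase i, a (c i - c j) = B) (d : ℕ) (hd : d ≠ 0) (F G : L[X])
    (hF : F.Monic) (hFd : F.natDegree = d * Fintype.card ι) (hFb : Bd a c e F ((e * B) ^ d))
    (hG : G.Monic) (hGd : G.natDegree = Fintype.card ι)
    (hFG : (F - G ^ d).degree < ((d - 1) * Fintype.card ι : ℕ)) :
    Bd a c e G (e * B) := by
  have hd1 : a (d : L) = 1 := hnat d hd
  have hd0 : (d : L) ≠ 0 := by intro h; rw [h] at hd1; simp at hd1
  have hΔ : 0 < e * B := mul_pos he hBp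
  have hΦd : (Phi c).natDegree = Fintype.card ι := by
    rw [Phi, Lagrange.natDegree_nodal]; rfl
  have hΦ : Bd a c e (Phi c) (e * B) := fun i z hz => (Phi_eval hna hsep hB hz).le
  obtain ⟨Ψ, h1, h2, h3⟩ := approx_root (Fintype.card ι) d hd (d : L)⁻¹ (mul_inv_cancel₀ hd0) F
    (Phi c) hF hFd Lagrange.nodal_monic hΦd (fun Ψ => Bd a c e Ψ (e * B))
    (fun i z _ => by simpa using hΔ.le) (fun Ψ hΨ => by
      refine hΨ.add hna ?_
      have h4 : Bd a c e (F - (Phi c + Ψ) ^ d) ((e * B) ^ d) :=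
        hFb.sub hna ((hΦ.add hna hΨ).pow d)
      have h5 := Bd.div_pow hna hnat hϖ he hsep hBp hB (d - 1) (pow_pos hΔ d).le h4
      have h6 : (e * B) ^ d / (e * B) ^ (d - 1) = e * B := by
        obtain ⟨k, rfl⟩ : ∃ k, d = k + 1 := ⟨d - 1, by omega⟩
        rw [Nat.add_sub_cancel, pow_succ]; field_simp
      rw [h6] at h5
      intro i z hz
      rw [eval_mul, eval_C, a.map_mul, map_inv₀, hd1, inv_one, one_mul]
      exact h5 i z hz)
  obtain ⟨h4, h5⟩ := monic_add_lt Lagrange.nodal_monic hΦd h2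
  rw [approx_root_unique (Fintype.card ι) d hd hd0 F G (Phi c + Ψ) hG hGd h4 h5 hFG h3]
  exact hΦ.add hna h1

end bd
end AMS

end

section
namespace AMS
set_option linter.unusedSectionVars false
set_option linter.unusedVariables false
open Polynomial

/-- Laurent series -/
abbrev LS := HahnSeries ℤ ℂ

noncomputable instance instAlgLS : Algebra ℂ LS := HahnSeries.instAlgebra

lemma algLS (c : ℂ) : algebraMap ℂ LS c = HahnSeries.single 0 c := rfl

/-- the absolute value -/
noncomputable def av : AbsoluteValue LS ℝ where
  toFun f := open Classical in if f = 0 then 0 else (2 : ℝ) ^ (-f.order)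
  map_mul' f g := by
    by_cases hf : f = 0
    · simp [hf]
    by_cases hg : g = 0
    · simp [hg]
    simp only [hf, hg, mul_eq_zero, or_self, if_false]
    rw [HahnSeries.order_mul hf hg, neg_add, zpow_add₀ (by norm_num)]
  nonneg' f := by
    split_ifs <;> positivity
  eq_zero' f := by
    split_ifs with h
    · simp [h]
    · simp only [h, iff_false]; positivity
  add_le' f g := by
    by_cases hf : f = 0
    · subst hf; simp only [if_true]; rw [zero_add, zero_add]
    by_cases hg : g = 0
    · subst hg; simp only [if_true]; rw [add_zero, add_zero]
    by_cases hfg : f + g = 0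
    · simp only [hfg, if_true]; split_ifs <;> positivity
    simp only [hf, hg, hfg, if_false]
    have := HahnSeries.min_order_le_order_add hfg
    have h1 : (2 : ℝ) ^ (-(f+g).order) ≤ max ((2 : ℝ) ^ (-f.order)) ((2 : ℝ) ^ (-g.order)) := by
      rcases min_le_iff.1 this with h | h
      · exact le_max_of_le_left (zpow_le_zpow_right₀ (by norm_num) (by omega))
      · exact le_max_of_le_right (zpow_le_zpow_right₀ (by norm_num) (by omega))
    refine h1.trans (max_le ?_ ?_)
    · have : (0:ℝ) ≤ 2 ^ (-g.order) := by positivity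
      linarith
    · have : (0:ℝ) ≤ 2 ^ (-f.order) := by positivity
      linarith

lemma av_of_ne {f : LS} (hf : f ≠ 0) : av f = (2 : ℝ) ^ (-f.order) := by
  classical
  exact if_neg hf

lemma av_ge {f : LS} {k : ℤ} (hk : f.coeff k ≠ 0) : (2 : ℝ) ^ (-k) ≤ av f := by
  have hf : f ≠ 0 := by rintro rfl; simp at hk
  rw [av_of_ne hf]
  have := HahnSeries.order_le_of_coeff_ne_zero hk
  exact zpow_le_zpow_right₀ (by norm_num) (by omega)

lemma av_le {f : LS} {k : ℤ} (hk : ∀ l < k, f.coeff l = 0) : av f ≤ (2 : ℝ) ^ (-k) := by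
  by_cases hf : f = 0
  · rw [hf, map_zero]; positivity
  rw [av_of_ne hf]
  refine zpow_le_zpow_right₀ (by norm_num) ?_
  by_contra h
  have : f.order < k := by omega
  have := hk _ this
  rw [HahnSeries.coeff_order_eq_zero] at this
  exact hf this

lemma av_eq {f : LS} {k : ℤ} (hk : ∀ l < k, f.coeff l = 0) (h : f.coeff k ≠ 0) :
    av f = (2 : ℝ) ^ (-k) := le_antisymm (av_le hk) (av_ge h)

lemma av_na : IsNonarchimedean av := by
  intro f g
  by_cases hfg : f + g = 0
  · rw [hfg, map_zero]; exact le_max_of_le_left (av.nonneg _)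
  rw [av_of_ne hfg]
  have hc : (f + g).coeff (f + g).order ≠ 0 := by
    rwa [Ne, HahnSeries.coeff_order_eq_zero]
  rw [HahnSeries.coeff_add] at hc
  by_cases hf : f.coeff (f + g).order = 0
  · refine le_max_of_le_right (av_ge ?_)
    rw [hf, zero_add] at hc; exact hc
  · exact le_max_of_le_left (av_ge hf)

lemma av_algebraMap {c : ℂ} (hc : c ≠ 0) : av (algebraMap ℂ LS c) = 1 := by
  rw [algLS]
  rw [av_eq (k := 0)]
  · simp
  · intro l hl; rw [HahnSeries.coeff_single_of_ne hl.ne]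
  · simpa using hc

lemma av_nat (n : ℕ) (hn : n ≠ 0) : av (n : LS) = 1 := by
  have : (n : LS) = algebraMap ℂ LS n := by simp
  rw [this]; exact av_algebraMap (by exact_mod_cast hn)

lemma av_single (k : ℤ) : av (HahnSeries.single k (1 : ℂ) : LS) = (2 : ℝ) ^ (-k) := by
  refine av_eq ?_ (by simp)
  intro l hl; rw [HahnSeries.coeff_single_of_ne hl.ne]

/-- rotation as a function -/
noncomputable def rotFun (ζ : ℂˣ) (f : LS) : LS where
  coeff k := ((ζ ^ k : ℂˣ) : ℂ) * f.coeff k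
  isPWO_support' := f.isPWO_support.mono (fun k hk => by
    simp only [Function.mem_support] at hk
    exact right_ne_zero_of_mul hk)

lemma rotFun_support (ζ : ℂˣ) (f : LS) : (rotFun ζ f).support = f.support := by
  ext k; simp only [rotFun, HahnSeries.mem_support, Ne, mul_eq_zero, Units.ne_zero, false_or]

/-- rotation -/
noncomputable def rot (ζ : ℂˣ) : LS →ₐ[ℂ] LS where
  toFun := rotFun ζ
  map_zero' := by ext k; simp [rotFun]
  map_add' f g := by ext k; simp [rotFun, mul_add]
  map_one' := by
    ext k
    simp only [rotFun, HahnSeries.coeff_one]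
    split_ifs with h <;> simp [h]
  map_mul' f g := by
    ext k
    rw [HahnSeries.coeff_mul, show (rotFun ζ (f * g)).coeff k =
      ((ζ ^ k : ℂˣ) : ℂ) * (f * g).coeff k from rfl, HahnSeries.coeff_mul, Finset.mul_sum]
    refine Finset.sum_congr ?_ ?_
    · ext ij; simp only [Finset.mem_antidiagonal, rotFun_support]
    · intro ij hij
      rw [Finset.mem_antidiagonal] at hij
      rw [← hij.2.2, zpow_add]
      simp only [rotFun, Units.val_mul]
      ring
  commutes' c := by
    ext k
    rw [algLS]
    simp only [rotFun]
    by_cases h : k = 0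
    · simp [h]
    · simp [h]

lemma rot_coeff (ζ : ℂˣ) (f : LS) (k : ℤ) : (rot ζ f).coeff k = ((ζ ^ k : ℂˣ) : ℂ) * f.coeff k :=
  rfl

lemma rot_rot (ζ ξ : ℂˣ) (f : LS) : rot ζ (rot ξ f) = rot (ζ * ξ) f := by
  ext k; simp only [rot_coeff, mul_zpow, Units.val_mul]; ring

lemma rot_one (f : LS) : rot 1 f = f := by
  ext k; simp [rot_coeff]

lemma av_rot (ζ : ℂˣ) (f : LS) : av (rot ζ f) = av f := by
  by_cases hf : f = 0
  · simp [hf]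
  rw [av_of_ne hf]
  refine av_eq ?_ ?_
  · intro l hl; rw [rot_coeff, HahnSeries.coeff_eq_zero_of_lt_order hl, mul_zero]
  · rw [rot_coeff]
    refine mul_ne_zero (Units.ne_zero _) ?_
    rwa [Ne, HahnSeries.coeff_order_eq_zero]

lemma rot_single (ζ : ℂˣ) (k : ℤ) (c : ℂ) : rot ζ (HahnSeries.single k c) =
    HahnSeries.single k (((ζ ^ k : ℂˣ) : ℂ) * c) := by
  ext l
  rw [rot_coeff]
  by_cases h : l = k
  · simp [h]
  · rw [HahnSeries.coeff_single_of_ne h, HahnSeries.coeff_single_of_ne h, mul_zero]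

lemma aevalLS (t : LS) (g : ℂ[X]) : aeval t g =
    ∑ i ∈ Finset.range (g.natDegree + 1), algebraMap ℂ LS (g.coeff i) * t ^ i := by
  rw [aeval_eq_sum_range]
  exact Finset.sum_congr rfl fun i _ => Algebra.smul_def _ _

/-- solving `x(t) = q^{-n}` -/
lemma exists_t0 (x : ℂ[X]) (hx : x.Monic) (hn : x.natDegree ≠ 0) :
    ∃ t₀ : LS, t₀.coeff (-1) = 1 ∧ (∀ l < -1, t₀.coeff l = 0) ∧
      aeval t₀ x = HahnSeries.single (-(x.natDegree : ℤ)) 1 := by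
  set n := x.natDegree with hnd
  let Q : PowerSeries ℂ := PowerSeries.X
  let P : (PowerSeries ℂ)[X] := X ^ n + (∑ i ∈ Finset.range n,
    C (PowerSeries.C (x.coeff i) * PowerSeries.X ^ (n - i)) * X ^ i - 1)
  have hdeg : (∑ i ∈ Finset.range n,
    C (PowerSeries.C (x.coeff i) * PowerSeries.X ^ (n - i)) * X ^ i - 1 :
      (PowerSeries ℂ)[X]).degree < n := by
    refine lt_of_le_of_lt (degree_sub_le _ _) (max_lt ?_ ?_)
    · refine lt_of_le_of_lt (degree_sum_le _ _) ?_
      rw [Finset.sup_lt_iff (WithBot.bot_lt_coe _)]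
      intro i hi
      refine lt_of_le_of_lt (degree_C_mul_X_pow_le _ _) ?_
      exact_mod_cast Finset.mem_range.1 hi
    · refine lt_of_le_of_lt degree_one_le ?_
      exact_mod_cast Nat.pos_of_ne_zero hn
  have hPm : P.Monic := monic_X_pow_add hdeg
  let I : Ideal (PowerSeries ℂ) := Ideal.span {PowerSeries.X}
  have hmem : ∀ i < n, PowerSeries.C (x.coeff i) * PowerSeries.X ^ (n - i) ∈ I := by
    intro i hi
    refine Ideal.mul_mem_left _ _ ?_
    exact Ideal.pow_mem_of_mem _ (Ideal.mem_span_singleton_self _) _ (by omega)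
  have h1 : P.eval 1 ∈ I := by
    have : P.eval 1 = ∑ i ∈ Finset.range n,
      PowerSeries.C (x.coeff i) * PowerSeries.X ^ (n - i) := by
      simp [P, eval_finsetSum]
    rw [this]
    exact Ideal.sum_mem _ fun i hi => hmem i (Finset.mem_range.1 hi)
  have h2 : IsUnit (Ideal.Quotient.mk I (P.derivative.eval 1)) := by
    have hu : IsUnit ((n : PowerSeries ℂ)) := by
      have : (n : PowerSeries ℂ) = PowerSeries.C (n : ℂ) := by simp
      rw [this]
      exact IsUnit.map _ (IsUnit.mk0 _ (by exact_mod_cast hn))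
    have h3 : Ideal.Quotient.mk I (P.derivative.eval 1) = Ideal.Quotient.mk I n := by
      rw [Ideal.Quotient.eq]
      have : P.derivative.eval 1 - n = ∑ i ∈ Finset.range n,
          (i : PowerSeries ℂ) * (PowerSeries.C (x.coeff i) * PowerSeries.X ^ (n - i)) := by
        simp only [P, derivative_add, derivative_sub, derivative_sum, eval_add, eval_sub,
          eval_finsetSum, derivative_X_pow, derivative_one, eval_zero, sub_zero,
          derivative_C_mul_X_pow, eval_mul, eval_C, eval_pow, eval_X, one_pow, mul_one]
        rw [add_sub_cancel_left]
        exact Finset.sum_congr rfl fun i _ => by ring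
      rw [this]
      exact Ideal.sum_mem _ fun i hi => Ideal.mul_mem_left _ _ (hmem i (Finset.mem_range.1 hi))
    rw [h3]
    exact hu.map _
  obtain ⟨u, hu, hu1⟩ := HenselianRing.is_henselian (I := I) P hPm 1 h1 h2
  let ι := HahnSeries.ofPowerSeries ℤ ℂ
  have hcoeff : ∀ k : ℕ, (ι u).coeff k = PowerSeries.coeff k u :=
    fun k => HahnSeries.ofPowerSeries_apply_coeff u k
  have hneg : ∀ l : ℤ, l < 0 → (ι u).coeff l = 0 := by
    intro l hl
    show (HahnSeries.ofPowerSeries ℤ ℂ u).coeff l = 0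
    rw [HahnSeries.ofPowerSeries_apply]
    refine HahnSeries.embDomain_of_notMem_range ?_
    rintro ⟨k, hk⟩
    have : (k : ℤ) = l := hk
    omega
  have hu0 : PowerSeries.coeff 0 u = 1 := by
    rw [Ideal.mem_span_singleton, PowerSeries.X_dvd_iff] at hu1
    rw [PowerSeries.coeff_zero_eq_constantCoeff_apply]
    rw [map_sub, map_one, sub_eq_zero] at hu1
    exact hu1
  refine ⟨HahnSeries.single (-1) 1 * ι u, ?_, ?_, ?_⟩
  · have := HahnSeries.coeff_single_mul_add (r := (1:ℂ)) (x := ι u) (a := (0:ℤ)) (b := (-1:ℤ))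
    rw [zero_add, one_mul] at this
    rw [this]
    have := hcoeff 0
    rw [hu0] at this; exact this
  · intro l hl
    have := HahnSeries.coeff_single_mul_add (r := (1:ℂ)) (x := ι u) (a := (l+1:ℤ)) (b := (-1:ℤ))
    rw [add_neg_cancel_right, one_mul] at this
    rw [this]
    exact hneg _ (by omega)
  · have h5 : ι (P.eval u) = 0 := by rw [hu.eq_zero, map_zero]
    have hιX : ∀ k : ℕ, ι (PowerSeries.X ^ k) = HahnSeries.single (k : ℤ) 1 := by
      intro k
      show HahnSeries.ofPowerSeries ℤ ℂ _ = _
      rw [HahnSeries.ofPowerSeries_X_pow]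
    have hιC : ∀ c : ℂ, ι (PowerSeries.C c) = algebraMap ℂ LS c := by
      intro c
      show HahnSeries.ofPowerSeries ℤ ℂ _ = _
      rw [HahnSeries.ofPowerSeries_C]; rfl
    simp only [P, eval_add, eval_sub, eval_finsetSum, eval_mul, eval_C, eval_pow, eval_X, eval_one,
      map_add, map_sub, map_sum, map_mul, map_pow, map_one, hιC] at h5
    have hXX : ι PowerSeries.X = HahnSeries.single 1 1 := by simpa using hιX 1
    rw [hXX] at h5
    rw [aevalLS, ← hnd, Finset.sum_range_succ, hnd, hx.coeff_natDegree, map_one (algebraMap ℂ LS), one_mul (_ ^ _), ← hnd]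
    have h6 : ∀ i ∈ Finset.range n, algebraMap ℂ LS (x.coeff i) * (HahnSeries.single (-1) 1 * ι u) ^ i =
        HahnSeries.single (-(n:ℤ)) 1 * (algebraMap ℂ LS (x.coeff i) *
          HahnSeries.single 1 1 ^ (n - i) * ι u ^ i) := by
      intro i hi
      have hi' := Finset.mem_range.1 hi
      have e1 : (HahnSeries.single (-(n:ℤ)) 1 : LS) * HahnSeries.single 1 1 ^ (n - i) =
        HahnSeries.single (-1) 1 ^ i := by
        rw [HahnSeries.single_pow, HahnSeries.single_pow, HahnSeries.single_mul_single]
        congr 1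
        · congr 1
          simp; omega
        · simp
      rw [mul_pow, ← e1]; ring
    rw [Finset.sum_congr rfl h6, ← Finset.mul_sum]
    have e2 : (HahnSeries.single (-1) 1 * ι u) ^ n = HahnSeries.single (-(n:ℤ)) 1 * ι u ^ n := by
      rw [mul_pow, HahnSeries.single_pow]; simp
    rw [hnd] at *
    rw [e2, ← mul_add]
    have : ∑ i ∈ Finset.range x.natDegree, (algebraMap ℂ LS (x.coeff i) *
          HahnSeries.single 1 1 ^ (x.natDegree - i) * ι u ^ i) + ι u ^ x.natDegree = 1 := by
      linear_combination h5
    rw [this, mul_one]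

lemma av_aeval {t₀ : LS} (h1 : t₀.coeff (-1) = 1) (h2 : ∀ l < -1, t₀.coeff l = 0)
    (g : ℂ[X]) (hg : g ≠ 0) : av (aeval t₀ g) = (2 : ℝ) ^ g.natDegree := by
  have ht : av t₀ = 2 := by
    rw [av_eq h2 (by rw [h1]; simp)]; norm_num
  rw [aevalLS, Finset.sum_range_succ]
  have hl : av (algebraMap ℂ LS (g.coeff g.natDegree) * t₀ ^ g.natDegree) = 2 ^ g.natDegree := by
    rw [map_mul, map_pow, ht, av_algebraMap (by simpa using hg), one_mul]
  rw [IsNonarchimedean.add_eq_right_of_lt av_na, hl]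
  rw [hl]
  rcases Nat.eq_zero_or_pos g.natDegree with h0 | h0
  · rw [h0]; simp
  · obtain ⟨b, hb, hb'⟩ := IsNonarchimedean.finset_image_add_of_nonempty av_na
      (fun i => algebraMap ℂ LS (g.coeff i) * t₀ ^ i) (t := Finset.range g.natDegree) ⟨0, by simpa using h0⟩
    refine lt_of_le_of_lt hb' ?_
    rw [map_mul, map_pow, ht]
    have h3 : av (algebraMap ℂ LS (g.coeff b)) ≤ 1 := by
      by_cases h : g.coeff b = 0
      · simp [h]
      · exact (av_algebraMap h).le
    have h4 : (2:ℝ) ^ b < 2 ^ g.natDegree :=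
      pow_lt_pow_right₀ (by norm_num) (Finset.mem_range.1 hb)
    have : (0:ℝ) < 2 ^ b := by positivity
    nlinarith

end AMS

end

section
namespace AMS
set_option linter.unusedSectionVars false
set_option linter.unusedVariables false
open Polynomial

/-- evaluation of bivariate polynomials -/
noncomputable def ev {R : Type*} [CommRing R] [Algebra ℂ R] (x y : R) : ℂ[X][X] →+* R :=
  eval₂RingHom (aeval x : ℂ[X] →ₐ[ℂ] R).toRingHom y

section
variable {R : Type*} [CommRing R] [Algebra ℂ R] (x y : R)

@[simp] lemma ev_C (p : ℂ[X]) : ev x y (C p) = aeval x p := by simp [ev]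
@[simp] lemma ev_X : ev x y X = y := by simp [ev]
lemma ev_map {S : Type*} [CommRing S] [Algebra ℂ S] (f : R →ₐ[ℂ] S) (P : ℂ[X][X]) :
    f (ev x y P) = ev (f x) (f y) P := by
  simp only [ev, coe_eval₂RingHom, AlgHom.toRingHom_eq_coe]
  rw [← AlgHom.coe_toRingHom, hom_eval₂]
  congr 1
  ext <;> simp
lemma ev_eq_eval (P : ℂ[X][X]) : ev x y P = (P.map (aeval x : ℂ[X] →ₐ[ℂ] R).toRingHom).eval y := by
  simp [ev, eval_map]
lemma ev_aeval (h : ℂ[X]) (g : ℂ[X][X]) : ev x y (aeval g h) = aeval (ev x y g) h := by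
  rw [aeval_def, aeval_def, hom_eval₂]
  congr 1
  ext c; simp [Polynomial.algebraMap_apply]
end

lemma exists_F (x y : ℂ[X]) (hx : x.Monic) (hn : x.natDegree ≠ 0) :
    ∃ F : ℂ[X][X], F.Monic ∧ F.natDegree = x.natDegree ∧ ev x y F = 0 := by
  let h : ℂ[X][X] := x.map C - C X
  have hxm : (x.map C : ℂ[X][X]).Monic := hx.map C
  have hxd : (x.map C : ℂ[X][X]).natDegree = x.natDegree := hx.natDegree_map C
  have hlt : (C X : ℂ[X][X]).degree < (x.map C : ℂ[X][X]).degree := by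
    rw [degree_eq_natDegree hxm.ne_zero, hxd]
    refine lt_of_le_of_lt degree_C_le ?_
    exact_mod_cast Nat.pos_of_ne_zero hn
  have hm : h.Monic := hxm.sub_of_left hlt
  have hd : h.natDegree = x.natDegree := by
    rw [natDegree_sub_eq_left_of_natDegree_lt, hxd]
    rw [hxd]; simpa using Nat.pos_of_ne_zero hn
  have := hm.free_adjoinRoot
  have := hm.finite_adjoinRoot
  let r : AdjoinRoot h := AdjoinRoot.root h
  let yr : AdjoinRoot h := eval₂ ((AdjoinRoot.of h).comp C) r y
  let f := Algebra.lmul ℂ[X] (AdjoinRoot h) yr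
  refine ⟨LinearMap.charpoly f, LinearMap.charpoly_monic f, ?_, ?_⟩
  · rw [LinearMap.charpoly_natDegree, (AdjoinRoot.powerBasis' hm).finrank]
    exact hd
  · have h1 := LinearMap.aeval_self_charpoly f
    have h2 : aeval yr (LinearMap.charpoly f) = 0 := by
      have := congrArg (fun T => T 1) h1
      simp only [f] at this
      rw [Polynomial.aeval_algHom_apply] at this
      rw [← mul_one (aeval yr _)]
      exact this
    let φ : AdjoinRoot h →+* ℂ[X] := AdjoinRoot.lift (aeval x : ℂ[X] →ₐ[ℂ] ℂ[X]).toRingHom X (by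
      simp only [h, eval₂_sub, eval₂_map, eval₂_C]
      have : ((aeval x : ℂ[X] →ₐ[ℂ] ℂ[X]).toRingHom.comp C) = C := by
        ext c; simp
      rw [this]; simp)
    have h3 := congrArg φ h2
    rw [map_zero, aeval_def, hom_eval₂] at h3
    have h4 : φ yr = y := by
      simp only [yr]
      rw [hom_eval₂]
      have : φ.comp ((AdjoinRoot.of h).comp C) = C := by
        ext c; simp [φ]
      rw [this]
      have : φ r = X := by simp [φ, r]
      rw [this]; simp
    rw [h4] at h3
    have h5 : φ.comp (algebraMap ℂ[X] (AdjoinRoot h)) = (aeval x : ℂ[X] →ₐ[ℂ] ℂ[X]).toRingHom := by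
      ext c <;> simp [φ, AdjoinRoot.algebraMap_eq]
    rw [h5] at h3
    simpa [ev] using h3

/-- the common situation -/
structure Setup where
  (x y : ℂ[X])
  hx : x.Monic
  hn : x.natDegree ≠ 0
  g : ℂ[X][X]
  hg : ev x y g = X
  F : ℂ[X][X]
  hF : F.Monic
  hFd : F.natDegree = x.natDegree
  hF0 : ev x y F = 0
  t₀ : LS
  ht1 : t₀.coeff (-1) = 1
  ht2 : ∀ l < -1, t₀.coeff l = 0
  hxt : aeval t₀ x = HahnSeries.single (-(x.natDegree : ℤ)) 1

namespace Setup
variable (S : Setup)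

/-- degree of x -/
noncomputable def n : ℕ := S.x.natDegree
noncomputable instance : NeZero S.n := ⟨S.hn⟩
/-- y as a series -/
noncomputable def y0 : LS := aeval S.t₀ S.y
/-- x as a series -/
noncomputable def xs : LS := aeval S.t₀ S.x
/-- roots of unity -/
noncomputable abbrev G := rootsOfUnity S.n ℂ
noncomputable instance : Fintype S.G := Fintype.ofFinite _

lemma ev_L (P : ℂ[X][X]) : aeval S.t₀ (ev S.x S.y P) = ev S.xs S.y0 P := ev_map _ _ _ _

lemma av_L (g : ℂ[X]) (hg : g ≠ 0) : av (aeval S.t₀ g) = (2 : ℝ) ^ g.natDegree :=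
  av_aeval S.ht1 S.ht2 g hg

lemma L_inj {g : ℂ[X]} (hg : aeval S.t₀ g = 0) : g = 0 := by
  by_contra h
  have := S.av_L g h
  rw [hg, map_zero] at this
  have : (0:ℝ) < 2 ^ g.natDegree := by positivity
  linarith

lemma rot_xs (ζ : S.G) : rot ζ S.xs = S.xs := by
  rw [xs, S.hxt, rot_single]
  have : ((ζ : ℂˣ) ^ (-(S.x.natDegree : ℤ))) = 1 := by
    rw [zpow_neg, zpow_natCast, inv_eq_one]
    exact ζ.2
  rw [this]; simp

lemma rot_inj (ζ : S.G) (h : rot ζ S.y0 = S.y0) : ζ = 1 := by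
  have h1 : aeval S.t₀ (ev S.x S.y S.g) = S.t₀ := by rw [S.hg]; simp
  have h2 : rot ζ S.t₀ = S.t₀ := by
    conv_lhs => rw [← h1, ev_L, ev_map, h, rot_xs, ← ev_L, h1]
  have h3 := congrArg (fun f => HahnSeries.coeff f (-1)) h2
  simp only [rot_coeff, S.ht1, mul_one, zpow_neg, zpow_one] at h3
  have : ((ζ : ℂˣ)⁻¹ : ℂˣ) = 1 := by ext; exact h3
  ext1
  simpa using this

/-- F at xs -/
noncomputable def FL : LS[X] := S.F.map (aeval S.xs : ℂ[X] →ₐ[ℂ] LS).toRingHom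

lemma ev_rot (ζ : S.G) (P : ℂ[X][X]) : ev S.xs (rot ζ S.y0) P = rot ζ (ev S.xs S.y0 P) := by
  rw [ev_map, rot_xs]

lemma conj_inj : Function.Injective (fun ζ : S.G => rot ζ S.y0) := by
  intro ζ ξ h
  simp only at h
  have : rot ((ξ⁻¹ * ζ : S.G) : ℂˣ) S.y0 = S.y0 := by
    have h2 := congrArg (rot ((ξ⁻¹ : S.G) : ℂˣ)) h
    rw [rot_rot, rot_rot] at h2
    simpa [rot_one] using h2
  have := S.rot_inj _ this
  rw [inv_mul_eq_one] at this
  exact this.symm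

lemma card_G : Fintype.card S.G = S.n := by
  rw [← Nat.card_eq_fintype_card]; exact Complex.card_rootsOfUnity S.n

lemma eq_zero_of_deg (P : ℂ[X][X]) (hP : P.degree < S.n) (h : ev S.x S.y P = 0) : P = 0 := by
  have hφ : Function.Injective (aeval S.xs : ℂ[X] →ₐ[ℂ] LS).toRingHom := by
    rw [injective_iff_map_eq_zero]
    intro a ha
    have : aeval S.t₀ (aeval S.x a) = 0 := by
      rw [← Polynomial.aeval_algHom_apply]; exact ha
    have h2 := S.L_inj this
    by_contra ha0
    have h4 : (aeval S.x a : ℂ[X]) = a.comp S.x := by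
      rw [comp, aeval_def]; rfl
    rw [h4, comp_eq_zero_iff] at h2
    rcases h2 with h2 | h2
    · exact ha0 h2
    · have := S.hn
      rw [h2.2] at this
      simp at this
  rw [← Polynomial.map_eq_zero_iff hφ]
  have hc : (P.map (aeval S.xs : ℂ[X] →ₐ[ℂ] LS).toRingHom).degree <
      (Finset.univ : Finset S.G).card := by
    refine lt_of_le_of_lt degree_map_le ?_
    rw [Finset.card_univ, card_G]; exact hP
  refine eq_zero_of_degree_lt_of_eval_index_eq_zero _ S.conj_inj.injOn hc ?_
  intro ζ _
  rw [← ev_eq_eval, ev_rot, ← ev_L, h, map_zero, map_zero]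

lemma dvd_of_ker (P : ℂ[X][X]) (h : ev S.x S.y P = 0) : S.F ∣ P := by
  rw [← modByMonic_eq_zero_iff_dvd S.hF]
  refine S.eq_zero_of_deg _ ?_ ?_
  · have := degree_modByMonic_lt P S.hF
    rwa [degree_eq_natDegree S.hF.ne_zero, S.hFd] at this
  · have := congrArg (ev S.x S.y) (modByMonic_add_div P S.F)
    rw [map_add, map_mul, S.hF0, zero_mul, add_zero, h] at this
    exact this

lemma FL_eq : S.FL = Lagrange.nodal Finset.univ (fun ζ : S.G => rot ζ S.y0) := by
  have hm : S.FL.Monic := S.hF.map _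
  have hd : S.FL.natDegree = S.n := by rw [FL, S.hF.natDegree_map, S.hFd]; rfl
  refine eq_of_degree_sub_lt_of_eval_index_eq (s := Finset.univ) (v := fun ζ : S.G => rot ζ S.y0)
    S.conj_inj.injOn ?_ ?_
  · rw [Finset.card_univ, card_G]
    refine degree_sub_lt_of_monic hm Lagrange.nodal_monic hd ?_
    rw [Lagrange.natDegree_nodal, Finset.card_univ, card_G]
  · intro ζ _
    have h1 := Lagrange.eval_nodal_at_node (v := fun ζ : S.G => rot ζ S.y0) (Finset.mem_univ ζ)
    refine Eq.trans ?_ h1.symm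
    rw [FL, ← ev_eq_eval, ev_rot, ← ev_L, S.hF0,
      map_zero, map_zero]

lemma deriv_dvd : ev S.x S.y S.F.derivative ∣ S.x.derivative := by
  obtain ⟨A, hA⟩ := S.dvd_of_ker (C X - aeval S.g S.x) (by
    rw [map_sub, ev_C, ev_aeval, S.hg]; simp)
  obtain ⟨B, hB⟩ := S.dvd_of_ker (X - aeval S.g S.y) (by
    rw [map_sub, ev_X, ev_aeval, S.hg]; simp)
  have hder : ∀ h : ℂ[X], ev S.x S.y (derivative (aeval S.g h)) =
      h.derivative * ev S.x S.y (derivative S.g) := by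
    intro h
    have : (aeval S.g h : ℂ[X][X]) = (h.map C).comp S.g := by
      rw [comp, eval₂_map, aeval_def]; rfl
    rw [this, derivative_comp, map_mul, derivative_map]
    have h2 : ((derivative h).map C).comp S.g = aeval S.g (derivative h) := by
      rw [comp, eval₂_map, aeval_def]; rfl
    rw [h2, ev_aeval, S.hg]; simp [mul_comm]
  have h1 := congrArg (fun P => ev S.x S.y (derivative P)) hA
  have h2 := congrArg (fun P => ev S.x S.y (derivative P)) hB
  simp only [derivative_sub, map_sub, derivative_C, derivative_X, hder, derivative_mul, map_add,
    map_mul, S.hF0, zero_mul, add_zero, map_zero, map_one] at h1 h2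
  refine ⟨derivative S.x * ev S.x S.y B - derivative S.y * ev S.x S.y A, ?_⟩
  linear_combination (derivative S.x) * h2 - (derivative S.y) * h1

lemma prod_le : ∏ ζ ∈ Finset.univ.erase (1 : S.G), av (S.y0 - rot ζ S.y0) ≤
    (2 : ℝ) ^ (S.n - 1) := by
  have h0 : S.x.derivative ≠ 0 := by
    intro h
    exact S.hn (derivative_eq_zero.1 h)
  have h1 : (ev S.x S.y S.F.derivative) ≠ 0 := by
    intro h
    have := S.deriv_dvd
    rw [h, zero_dvd_iff] at this
    exact h0 this
  have h2 : (ev S.x S.y S.F.derivative).natDegree ≤ S.n - 1 :=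
    (natDegree_le_of_dvd S.deriv_dvd h0).trans (natDegree_derivative_le _)
  have h3 : ev S.xs S.y0 S.F.derivative =
      ∏ ζ ∈ Finset.univ.erase (1 : S.G), (S.y0 - rot ζ S.y0) := by
    rw [ev_eq_eval, ← derivative_map]
    have := Lagrange.eval_nodal_derivative_eval_node_eq (s := Finset.univ)
      (v := fun ζ : S.G => rot ζ S.y0) (Finset.mem_univ (1 : S.G))
    rw [← FL_eq, FL] at this
    rw [Subgroup.coe_one, rot_one] at this
    rw [this, Lagrange.eval_nodal]
  rw [← map_prod, ← h3, ← ev_L, S.av_L _ h1]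
  exact pow_le_pow_right₀ (by norm_num) h2

end Setup
end AMS

end

section
namespace AMS
set_option linter.unusedSectionVars false
set_option linter.unusedVariables false
open Polynomial

lemma fib_prod {G : Type*} [CommGroup G] [Fintype G] (K : Subgroup G) [Fintype (G ⧸ K)]
    (d : ℕ) (hK : Nat.card K = d) (f : G ⧸ K → ℝ) :
    ∏ ζ : G, f (QuotientGroup.mk ζ) = (∏ j, f j) ^ d := by
  classical
  rw [Finset.prod_comp, Finset.image_univ_of_surjective QuotientGroup.mk_surjective,
    ← Finset.prod_pow]
  refine Finset.prod_congr rfl fun j _ => ?_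
  congr 1
  have h := QuotientGroup.card_preimage_mk K {j}
  rw [hK, Nat.card_eq_card_toFinset, Nat.card_eq_card_toFinset] at h
  simp only [Set.toFinset_singleton, Finset.card_singleton, mul_one] at h
  rw [← h]
  congr 1
  ext; simp

namespace Setup
variable (S : Setup)

lemma diff_coeff (ζ : ℂˣ) (f : LS) (k : ℤ) :
    (f - rot ζ f).coeff k = (1 - ((ζ ^ k : ℂˣ) : ℂ)) * f.coeff k := by
  rw [HahnSeries.coeff_sub, rot_coeff]; ring

/-- the kernel of the d-th power -/
noncomputable def K (d : ℕ) : Subgroup S.G := (powMonoidHom d : S.G →* S.G).ker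

lemma mem_K {d : ℕ} {ζ : S.G} : ζ ∈ S.K d ↔ ζ ^ d = 1 := by
  simp [K, MonoidHom.mem_ker]

lemma card_K {d : ℕ} (hd : d ∣ S.n) : Nat.card (S.K d) = d := by
  have hd0 : d ≠ 0 := by rintro rfl; exact (NeZero.ne S.n) (zero_dvd_iff.1 hd)
  haveI : NeZero d := ⟨hd0⟩
  refine Eq.trans ?_ (Complex.card_rootsOfUnity d)
  refine Nat.card_congr ⟨fun ζ => ⟨((ζ : S.G) : ℂˣ), ?_⟩, fun ζ => ⟨⟨(ζ : ℂˣ), ?_⟩, ?_⟩, ?_, ?_⟩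
  · have := S.mem_K.1 ζ.2
    rw [mem_rootsOfUnity]
    exact_mod_cast congrArg (Subtype.val) this
  · rw [mem_rootsOfUnity]
    obtain ⟨e, he⟩ := hd
    rw [he, pow_mul, (mem_rootsOfUnity _ _).1 ζ.2, one_pow]
  · rw [mem_K]
    ext1
    simpa using (mem_rootsOfUnity _ _).1 ζ.2
  · intro ζ; rfl
  · intro ζ; rfl

lemma two_zpow_le {a b : ℤ} : (2 : ℝ) ^ a ≤ 2 ^ b ↔ a ≤ b :=
  zpow_le_zpow_iff_right₀ (by norm_num)

lemma pos (d : ℕ) (hd1 : 1 < d) (hdn : d ∣ S.n) (β κ : ℤ)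
    (hlow : ∀ k < κ, S.y0.coeff k ≠ 0 → (d : ℤ) ∣ k) (hκ : S.y0.coeff κ ≠ 0)
    (hsepG : ∀ ζ : S.G, ζ ^ d ≠ 1 → ∃ k < κ, S.y0.coeff k ≠ 0 ∧ ((ζ : ℂˣ)) ^ k ≠ 1)
    (hprod : ∏ ζ with (ζ : S.G) ^ d ≠ 1, av (S.y0 - rot ζ S.y0) = (2 : ℝ) ^ (d * β)) :
    0 < β - κ := by
  classical
  have hd0 : d ≠ 0 := by omega
  obtain ⟨N, hN⟩ := hdn
  have hN0 : N ≠ 0 := by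
    rintro rfl; exact (NeZero.ne S.n) (by simpa using hN)
  set yt : LS := HahnSeries.truncLT κ S.y0 with hyt
  set e : ℝ := 2 ^ (-κ) with he
  have hep : 0 < e := by positivity
  have hc1 : ∀ k < κ, yt.coeff k = S.y0.coeff k := fun k hk => HahnSeries.coeff_truncLT_of_lt hk _
  have hc2 : ∀ k, κ ≤ k → yt.coeff k = 0 := fun k hk => HahnSeries.coeff_truncLT_of_le hk _
  have hdy : av (S.y0 - yt) = e := by
    refine av_eq ?_ ?_
    · intro l hl; rw [HahnSeries.coeff_sub, hc1 l hl, sub_self]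
    · rw [HahnSeries.coeff_sub, hc2 κ le_rfl, sub_zero]; exact hκ
  have hK1 : ∀ ζ : S.G, ζ ^ d = 1 → rot ζ yt = yt := by
    intro ζ hζ
    ext k
    rw [rot_coeff]
    by_cases hk : yt.coeff k = 0
    · rw [hk, mul_zero]
    · have hk1 : k < κ := by
        by_contra h; exact hk (hc2 k (not_lt.1 h))
      rw [hc1 k hk1] at hk
      obtain ⟨j, rfl⟩ := hlow k hk1 hk
      have : (ζ : ℂˣ) ^ d = 1 := by exact_mod_cast congrArg Subtype.val hζ
      rw [zpow_mul, zpow_natCast, this, one_zpow]; simp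
  have hsep0 : ∀ ζ : S.G, ζ ^ d ≠ 1 → e < av (S.y0 - rot ζ S.y0) := by
    intro ζ hζ
    obtain ⟨k, hk, h1, h2⟩ := hsepG ζ hζ
    refine lt_of_lt_of_le ?_ (av_ge (k := k) ?_)
    · rw [he]; exact zpow_lt_zpow_right₀ (by norm_num) (by omega)
    · rw [diff_coeff]
      refine mul_ne_zero ?_ h1
      rw [sub_ne_zero]
      intro h; apply h2; ext; exact h.symm
  have hsepyt : ∀ ζ : S.G, ζ ^ d ≠ 1 → av (yt - rot ζ yt) = av (S.y0 - rot ζ S.y0) := by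
    intro ζ hζ
    have h1 : yt - rot ζ yt = (S.y0 - rot ζ S.y0) + (rot ζ (S.y0 - yt) - (S.y0 - yt)) := by
      rw [map_sub]; ring
    rw [h1]
    refine IsNonarchimedean.add_eq_left_of_lt av_na ?_
    refine lt_of_le_of_lt ?_ (hsep0 ζ hζ)
    rw [sub_eq_add_neg]
    refine (av_na _ _).trans ?_
    rw [AbsoluteValue.map_neg, av_rot, hdy, max_self]
  haveI : Fintype (S.G ⧸ S.K d) := Fintype.ofFinite _
  set c : S.G ⧸ S.K d → LS := fun q => rot (q.out : S.G) yt with hcdef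
  have hcmk : ∀ ζ : S.G, c (QuotientGroup.mk ζ) = rot ζ yt := by
    intro ζ
    obtain ⟨h, hh⟩ := QuotientGroup.mk_out_eq_mul (S.K d) ζ
    simp only [hcdef]
    rw [hh, Subgroup.coe_mul, ← rot_rot, hK1 _ (S.mem_K.1 h.2)]
  have hcc : ∀ ζ ξ : S.G, av (rot ζ yt - rot ((ζ * ξ : S.G) : ℂˣ) yt) = av (yt - rot ξ yt) := by
    intro ζ ξ
    rw [Subgroup.coe_mul, ← rot_rot, ← map_sub, av_rot]
  have hsep : ∀ i j, i ≠ j → e < av (c i - c j) := by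
    intro i j hij
    induction i using QuotientGroup.induction_on with | H ζ =>
    induction j using QuotientGroup.induction_on with | H ξ =>
    rw [hcmk, hcmk]
    have h1 : ζ⁻¹ * ξ ∉ S.K d := fun h => hij (QuotientGroup.eq.2 h)
    rw [mem_K] at h1
    have h2 := hcc ζ (ζ⁻¹ * ξ)
    rw [mul_inv_cancel_left] at h2
    rw [h2, hsepyt _ h1]
    exact hsep0 _ h1
  set B : ℝ := ∏ j ∈ Finset.univ.erase 1, av (c 1 - c j) with hBdef
  have hB : ∀ i, ∏ j ∈ Finset.univ.erase i, av (c i - c j) = B := by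
    intro i
    symm
    refine Finset.prod_equiv (Equiv.mulLeft i) ?_ ?_
    · intro j; simp
    · intro j _
      induction i using QuotientGroup.induction_on with | H ζ =>
      induction j using QuotientGroup.induction_on with | H ξ =>
      have : (1 : S.G ⧸ S.K d) = QuotientGroup.mk 1 := rfl
      rw [this]
      simp only [Equiv.coe_mulLeft]
      rw [← QuotientGroup.mk_mul, hcmk, hcmk, hcmk, hcmk, hcc, Subgroup.coe_one, rot_one]
  have hBp : 0 < B := by
    refine Finset.prod_pos fun j hj => ?_
    exact hep.trans (hsep _ _ (Finset.ne_of_mem_erase hj).symm)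
  have hcardK : Nat.card (S.K d) = d := S.card_K ⟨N, hN⟩
  have hBval : B = (2 : ℝ) ^ β := by
    have h1 := fib_prod (S.K d) d hcardK (fun j => if j = 1 then 1 else av (c 1 - c j))
    have h2 : ∏ j, (if j = 1 then (1 : ℝ) else av (c 1 - c j)) = B := by
      rw [← Finset.mul_prod_erase Finset.univ _ (Finset.mem_univ 1), if_pos rfl, one_mul]
      exact Finset.prod_congr rfl fun j hj => if_neg (Finset.ne_of_mem_erase hj)
    rw [h2] at h1
    have h3 : ∏ ζ : S.G, (if (QuotientGroup.mk ζ : S.G ⧸ S.K d) = 1 then (1 : ℝ) else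
        av (c 1 - c (QuotientGroup.mk ζ))) = (2 : ℝ) ^ (d * β) := by
      rw [← hprod, Finset.prod_filter]
      refine Finset.prod_congr rfl fun ζ _ => ?_
      have h4 : ((QuotientGroup.mk ζ : S.G ⧸ S.K d) = 1) ↔ ζ ^ d = 1 := by
        rw [QuotientGroup.eq_one_iff, mem_K]
      by_cases h : ζ ^ d = 1
      · rw [if_pos (h4.2 h), if_neg (not_not.2 h)]
      · rw [if_neg (fun h' => h (h4.1 h')), if_pos h]
        have : (1 : S.G ⧸ S.K d) = QuotientGroup.mk 1 := rfl
        rw [this, hcmk, hcmk, ← hsepyt ζ h, Subgroup.coe_one, rot_one]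
    rw [h3, mul_comm, zpow_mul, zpow_natCast] at h1
    exact ((pow_left_inj₀ hBp.le (by positivity) hd0).1 h1.symm)
  have hcardι : Fintype.card (S.G ⧸ S.K d) = N := by
    have h1 := Subgroup.card_eq_card_quotient_mul_card_subgroup (S.K d)
    rw [hcardK, Nat.card_eq_fintype_card, Nat.card_eq_fintype_card, card_G, hN, mul_comm] at h1
    exact (Nat.eq_of_mul_eq_mul_right (by omega) h1).symm
  -- approximate root
  have hFdN : S.F.natDegree = d * N := by rw [S.hFd, ← hN]; rfl
  obtain ⟨Ψ, -, hΨ1, hΨ2⟩ := approx_root N d hd0 (C ((d : ℂ)⁻¹)) (by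
      rw [← C_eq_natCast, ← C_mul, mul_inv_cancel₀ (by exact_mod_cast hd0), C_1]) S.F (X ^ N) S.hF hFdN
      (monic_X_pow N) (natDegree_X_pow N) (fun _ => True) trivial (fun _ _ => trivial)
  set G : ℂ[X][X] := X ^ N + Ψ with hGdef
  have hGm := monic_add_lt (monic_X_pow N) (natDegree_X_pow N) hΨ1
  rw [← hGdef] at hGm
  set φ := (aeval S.xs : ℂ[X] →ₐ[ℂ] LS).toRingHom with hφ
  have hbound := key_bound (a := av) (c := c) (e := e) av_na av_nat
    (ϖ := HahnSeries.single κ 1) (av_single κ) hep hsep hBp hB d hd0 S.FL (G.map φ)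
    (S.hF.map _) (by rw [FL, S.hF.natDegree_map, hFdN, hcardι]) (by
      intro i z hz
      rw [FL_eq, Lagrange.eval_nodal, map_prod]
      have h1 := fib_prod (S.K d) d hcardK (fun j => if j = i then e else av (c i - c j))
      have h2 : ∏ j, (if j = i then e else av (c i - c j)) = e * B := by
        rw [← Finset.mul_prod_erase Finset.univ _ (Finset.mem_univ i), if_pos rfl, ← hB i]
        congr 1
        exact Finset.prod_congr rfl fun j hj => if_neg (Finset.ne_of_mem_erase hj)
      rw [h2] at h1
      rw [← h1]
      refine Finset.prod_le_prod (fun _ _ => av.nonneg _) fun ζ _ => ?_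
      have h3 : av (c (QuotientGroup.mk ζ) - rot ζ S.y0) = e := by
        rw [hcmk, ← map_sub, av_rot, AbsoluteValue.map_sub, hdy]
      split_ifs with h
      · have : z - rot ζ S.y0 = (z - c i) + (c (QuotientGroup.mk ζ) - rot ζ S.y0) := by
          rw [h]; ring
        rw [this]
        refine (av_na _ _).trans ?_
        rw [h3, hz, max_self]
      · have : z - rot ζ S.y0 = (c i - c (QuotientGroup.mk ζ)) + ((z - c i) +
            (c (QuotientGroup.mk ζ) - rot ζ S.y0)) := by ring
        rw [this]
        refine (av_na _ _).trans (max_le le_rfl ?_)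
        refine (av_na _ _).trans ?_
        rw [h3, hz, max_self]
        exact (hsep _ _ (fun h' => h h'.symm)).le) 
    (hGm.1.map _) (by rw [hGm.1.natDegree_map, hGm.2, hcardι]) (by
      rw [hcardι, FL, ← Polynomial.map_pow, ← Polynomial.map_sub]
      exact lt_of_le_of_lt degree_map_le hΨ2)
  have h5 := hbound 1 S.y0 (by
    have : (1 : S.G ⧸ S.K d) = QuotientGroup.mk 1 := rfl
    rw [this, hcmk, Subgroup.coe_one, rot_one, hdy])
  rw [← ev_eq_eval, ← ev_L] at h5
  have h6 : (ev S.x S.y G).natDegree ≠ 0 := by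
    intro h
    obtain ⟨w, hw⟩ := natDegree_eq_zero.1 h
    have h7 : ev S.x S.y (G - C (C w)) = 0 := by
      rw [map_sub, ev_C, ← hw]; simp
    have hdeg : (C (C w) : ℂ[X][X]).degree < G.degree := by
      rw [degree_eq_natDegree hGm.1.ne_zero, hGm.2]
      refine lt_of_le_of_lt degree_C_le ?_
      exact_mod_cast Nat.pos_of_ne_zero hN0
    have h8 := S.eq_zero_of_deg _ (by
      rw [degree_sub_eq_left_of_degree_lt hdeg, degree_eq_natDegree hGm.1.ne_zero, hGm.2, hN]
      have : N < d * N := by nlinarith [Nat.pos_of_ne_zero hN0]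
      exact_mod_cast this) h7
    rw [sub_eq_zero] at h8
    rw [h8] at hdeg
    exact lt_irrefl _ hdeg
  have h9 : ev S.x S.y G ≠ 0 := by intro h; rw [h] at h6; simp at h6
  rw [S.av_L _ h9, he, hBval, ← zpow_add₀ (by norm_num), ← zpow_natCast, two_zpow_le] at h5
  omega

end Setup
end AMS

end

section
namespace AMS
set_option linter.unusedSectionVars false
set_option linter.unusedVariables false
open Polynomial

namespace Setup
variable (S : Setup)

/-- chain invariant -/
def Inv (d : ℕ) : Prop := ∀ ζ : S.G, ζ ^ d ≠ 1 → ∃ k, S.y0.coeff k ≠ 0 ∧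
  (∀ l ≤ k, S.y0.coeff l ≠ 0 → (d : ℤ) ∣ l) ∧ ((ζ : ℂˣ)) ^ k ≠ 1

open Classical in
/-- chain state -/
def State (d : ℕ) (β : ℤ) : Prop := d ∣ S.n ∧ (d : ℤ) ∣ β ∧ S.Inv d ∧
  ∏ ζ with (ζ : S.G) ^ d ≠ 1, av (S.y0 - rot ζ S.y0) = (2 : ℝ) ^ (d * β)

lemma exists_kappa (d : ℕ) (hd1 : 1 < d) (hdn : d ∣ S.n) : ∃ κ, S.y0.coeff κ ≠ 0 ∧
    ¬ (d : ℤ) ∣ κ ∧ ∀ k < κ, S.y0.coeff k ≠ 0 → (d : ℤ) ∣ k := by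
  have hne : ∃ k, S.y0.coeff k ≠ 0 ∧ ¬ (d : ℤ) ∣ k := by
    by_contra hcon
    push Not at hcon
    have hd0 : d ≠ 0 := by omega
    have hprim := Complex.isPrimitiveRoot_exp d hd0
    set z := Complex.exp (2 * Real.pi * Complex.I / d) with hz
    have hu := hprim.isUnit hd0
    obtain ⟨u, hu⟩ := hu
    have hud : u ^ d = 1 := by
      ext; push_cast; rw [hu]; exact hprim.pow_eq_one
    have huG : u ∈ rootsOfUnity S.n ℂ := by
      obtain ⟨e, he⟩ := hdn
      rw [mem_rootsOfUnity, he, pow_mul, hud, one_pow]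
    have h1 := S.rot_inj ⟨u, huG⟩ (by
      ext k
      rw [rot_coeff]
      by_cases hk : S.y0.coeff k = 0
      · rw [hk, mul_zero]
      · obtain ⟨j, rfl⟩ := hcon k hk
        simp only
        rw [zpow_mul, zpow_natCast, hud, one_zpow]; simp)
    have h2 : u = 1 := congrArg Subtype.val h1
    rw [h2] at hu
    have := hprim.pow_ne_one_of_pos_of_lt (l := 1) (by omega) hd1
    rw [← hu] at this
    simp at this
  obtain ⟨κ, h1, h2⟩ := Int.exists_least_of_bdd (P := fun k => S.y0.coeff k ≠ 0 ∧ ¬ (d : ℤ) ∣ k)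
    ⟨S.y0.order, fun k hk => HahnSeries.order_le_of_coeff_ne_zero hk.1⟩ hne
  refine ⟨κ, h1.1, h1.2, fun k hk hk0 => ?_⟩
  by_contra h
  have := h2 k ⟨hk0, h⟩
  omega

lemma card_filter {d : ℕ} (hd : d ∣ S.n) [DecidablePred fun ζ : S.G => ζ ^ d = 1] :
    (Finset.univ.filter fun ζ : S.G => ζ ^ d = 1).card = d := by
  rw [← Fintype.card_subtype, ← Nat.card_eq_fintype_card]
  refine Eq.trans (Nat.card_congr (Equiv.subtypeEquivRight fun ζ => ?_)) (S.card_K hd)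
  exact S.mem_K.symm

lemma step (d : ℕ) (hd1 : 1 < d) (β κ : ℤ) (hS : S.State d β) (hκ : S.y0.coeff κ ≠ 0)
    (hdκ : ¬ (d : ℤ) ∣ κ) (hlow : ∀ k < κ, S.y0.coeff k ≠ 0 → (d : ℤ) ∣ k) :
    ∃ d' r : ℕ, d' = Int.gcd d κ ∧ d = r * d' ∧ d' ≠ 0 ∧ d' < d ∧
      S.State d' (r * β - (r - 1) * κ) ∧ β + d ≤ r * β - (r - 1) * κ + d' := by
  classical
  obtain ⟨hdn, hdβ, hInv, hprod⟩ := hS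
  have hpos := S.pos d hd1 hdn β κ hlow hκ (by
    intro ζ hζ
    obtain ⟨k, h1, h2, h3⟩ := hInv ζ hζ
    refine ⟨k, ?_, h1, h3⟩
    by_contra h
    exact hdκ (h2 κ (not_lt.1 h) hκ)) (by convert hprod)
  set d' := Int.gcd d κ with hd'
  have hd'd : d' ∣ d := by
    have := Int.gcd_dvd_left (d : ℤ) κ
    exact_mod_cast this
  have hd'κ : (d' : ℤ) ∣ κ := Int.gcd_dvd_right (d : ℤ) κ
  obtain ⟨r, hr⟩ := hd'd
  have hd'0 : d' ≠ 0 := by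
    intro h; rw [h] at hr; omega
  have hr1 : r ≠ 1 := by
    rintro rfl
    rw [mul_one] at hr
    exact hdκ (hr ▸ hd'κ)
  have hr0 : r ≠ 0 := by rintro rfl; omega
  have hlt : d' < d := by rw [hr]; have := Nat.pos_of_ne_zero hd'0; nlinarith [(by omega : 2 ≤ r)]
  have hd'β : (d' : ℤ) ∣ β := (Int.natCast_dvd_natCast.2 ⟨r, hr⟩).trans hdβ
  have hgcd : ∀ ζ : S.G, ζ ^ d = 1 → (ζ : ℂˣ) ^ κ = 1 → ζ ^ d' = 1 := by
    intro ζ h1 h2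
    have h1' : (ζ : ℂˣ) ^ (d : ℤ) = 1 := by
      rw [zpow_natCast]; exact_mod_cast congrArg Subtype.val h1
    ext1
    push_cast
    rw [← zpow_natCast, hd', Int.gcd_eq_gcd_ab, zpow_add, zpow_mul, zpow_mul, h1', h2]
    simp
  have hd'n : d' ∣ S.n := (Dvd.intro r hr.symm).trans hdn
  refine ⟨d', r, rfl, by rw [mul_comm]; exact hr, hd'0, hlt, ⟨hd'n, ?_, ?_, ?_⟩, ?_⟩
  · exact dvd_sub (hd'β.mul_left _) (hd'κ.mul_left _)
  · intro ζ hζ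
    by_cases h : ζ ^ d = 1
    · refine ⟨κ, hκ, fun l hl hl0 => ?_, fun h' => hζ (hgcd ζ h h')⟩
      rcases hl.lt_or_eq with hl | rfl
      · exact (Int.natCast_dvd_natCast.2 ⟨r, hr⟩).trans (hlow l hl hl0)
      · exact hd'κ
    · obtain ⟨k, h1, h2, h3⟩ := hInv ζ h
      exact ⟨k, h1, fun l hl hl0 => (Int.natCast_dvd_natCast.2 ⟨r, hr⟩).trans (h2 l hl hl0), h3⟩
  · have hsub : (Finset.univ.filter fun ζ : S.G => ζ ^ d ≠ 1) ⊆
        (Finset.univ.filter fun ζ : S.G => ζ ^ d' ≠ 1) := by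
      intro ζ hζ
      simp only [Finset.mem_filter, Finset.mem_univ, true_and] at hζ ⊢
      intro h; apply hζ; rw [hr, pow_mul, h, one_pow]
    rw [← Finset.prod_sdiff hsub, hprod]
    have hval : ∀ ζ ∈ (Finset.univ.filter fun ζ : S.G => ζ ^ d' ≠ 1) \
        (Finset.univ.filter fun ζ : S.G => ζ ^ d ≠ 1), av (S.y0 - rot ζ S.y0) = (2 : ℝ) ^ (-κ) := by
      intro ζ hζ
      simp only [Finset.mem_sdiff, Finset.mem_filter, Finset.mem_univ, true_and, not_not] at hζ
      have h1' : (ζ : ℂˣ) ^ d = 1 := by exact_mod_cast congrArg Subtype.val hζ.2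
      refine av_eq ?_ ?_
      · intro l hl
        rw [diff_coeff]
        by_cases h : S.y0.coeff l = 0
        · rw [h, mul_zero]
        · obtain ⟨j, rfl⟩ := hlow l hl h
          rw [zpow_mul, zpow_natCast, h1', one_zpow]; simp
      · rw [diff_coeff]
        refine mul_ne_zero ?_ hκ
        rw [sub_ne_zero]
        intro h
        exact hζ.1 (hgcd ζ hζ.2 (by ext; exact h.symm))
    rw [Finset.prod_congr rfl hval, Finset.prod_const, Finset.card_sdiff_of_subset hsub]
    have hc : ∀ e : ℕ, e ∣ S.n → (Finset.univ.filter fun ζ : S.G => ζ ^ e ≠ 1).card = S.n - e := by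
      intro e he
      have h1 := Finset.card_filter_add_card_filter_not (s := Finset.univ) (fun ζ : S.G => ζ ^ e = 1)
      rw [S.card_filter he, Finset.card_univ, card_G] at h1
      simp only [ne_eq]
      omega
    rw [hc d hdn, hc d' hd'n]
    have hdle := Nat.le_of_dvd (Nat.pos_of_ne_zero (NeZero.ne S.n)) hdn
    have : S.n - d' - (S.n - d) = d - d' := by omega
    rw [this, ← zpow_natCast, ← zpow_mul, ← zpow_add₀ (by norm_num)]
    congr 1
    rw [Nat.cast_sub hlt.le, hr]
    push_cast
    ring
  · have h1 : (d' : ℤ) ≤ β - κ := Int.le_of_dvd hpos (dvd_sub hd'β hd'κ)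
    have h2 : (d : ℤ) = d' * r := by exact_mod_cast hr
    have h3 : (1 : ℤ) ≤ r := by exact_mod_cast Nat.pos_of_ne_zero hr0
    rw [h2]
    nlinarith

lemma chain (d : ℕ) : d ≠ 0 → ∀ β, S.State d β → β + d ≤ S.n := by
  induction d using Nat.strong_induction_on with | _ d ih =>
  intro hd0 β hS
  rcases Nat.lt_or_ge 1 d with hd1 | hd1
  · obtain ⟨κ, h1, h2, h3⟩ := S.exists_kappa d hd1 hS.1
    obtain ⟨d', r, -, -, h4, h5, h6, h7⟩ := S.step d hd1 β κ hS h1 h2 h3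
    exact h7.trans (ih d' h5 h4 _ h6)
  · obtain rfl : d = 1 := by omega
    have h1 := hS.2.2.2
    have h2 := S.prod_le
    have h3 : (Finset.univ.filter fun ζ : S.G => ζ ^ 1 ≠ 1) = Finset.univ.erase (1 : S.G) := by
      ext ζ; simp
    have h4 : ∏ ζ ∈ Finset.univ.erase (1 : S.G), av (S.y0 - rot ζ S.y0) = (2:ℝ) ^ (((1:ℕ) : ℤ) * β) := by
      rw [← h1]
      refine Finset.prod_congr ?_ fun _ _ => rfl
      ext ζ; simp
    have hp := NeZero.pos S.n
    rw [h4, ← zpow_natCast, two_zpow_le] at h2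
    push_cast [Nat.cast_sub hp] at h2 ⊢
    omega

lemma dvd_deg (hm : S.y.natDegree ≠ 0) : S.n ∣ S.y.natDegree ∨ S.y.natDegree ∣ S.n := by
  classical
  by_cases hnm : S.n ∣ S.y.natDegree
  · exact Or.inl hnm
  right
  set m := S.y.natDegree with hmdef
  have hy : S.y ≠ 0 := by intro h; rw [hmdef, h] at hm; simp at hm
  have h1 : av S.y0 = 2 ^ m := S.av_L S.y hy
  have hy0 : S.y0 ≠ 0 := by
    intro h; rw [h, map_zero] at h1
    have : (0:ℝ) < 2 ^ m := by positivity
    linarith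
  have hord : S.y0.order = -m := by
    rw [av_of_ne hy0, ← zpow_natCast] at h1
    have := zpow_right_injective₀ (by norm_num : (0:ℝ) < 2) (by norm_num) h1
    omega
  have hn1 : 1 < S.n := by
    have := NeZero.pos S.n
    by_contra h
    have : S.n = 1 := by omega
    exact hnm (this ▸ one_dvd _)
  have hst : S.State S.n 0 := by
    have hall : ∀ ζ : S.G, ζ ^ S.n = 1 := by
      intro ζ; ext1; exact ζ.2
    refine ⟨dvd_rfl, dvd_zero _, fun ζ hζ => absurd (hall ζ) hζ, ?_⟩
    rw [Finset.prod_eq_one]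
    · simp
    · intro ζ hζ
      exact absurd (hall ζ) (Finset.mem_filter.1 hζ).2
  obtain ⟨d', r, h2, h3, h4, h5, h6, h7⟩ := S.step S.n hn1 0 (-m) hst (by
    rw [← hord]; exact fun h => hy0 (HahnSeries.coeff_order_eq_zero.1 h)) (by
    rw [dvd_neg]; exact_mod_cast hnm) (by
    intro k hk hk0
    exact absurd (HahnSeries.coeff_eq_zero_of_lt_order (by rw [hord]; exact hk)) hk0)
  have h8 := S.chain d' h4 _ h6
  have hdm : d' ∣ m := by
    have := Int.gcd_dvd_right (S.n : ℤ) (-m)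
    rw [← h2, dvd_neg] at this
    exact_mod_cast this
  have hr2 : 2 ≤ r := by
    by_contra h
    interval_cases r <;> omega
  have h9 : (m : ℤ) ≤ d' := by
    rw [h3] at h8
    push_cast at h8
    have : ((r:ℤ) - 1) * m ≤ (r - 1) * d' := by linarith
    exact le_of_mul_le_mul_left this (by have : (2:ℤ) ≤ r := by exact_mod_cast hr2
                                         linarith)
  have h10 : m = d' := le_antisymm (by exact_mod_cast h9) (Nat.le_of_dvd (by omega) hdm)
  rw [h10, h3]
  exact dvd_mul_left _ _

end Setup

lemma exists_ev (x y : ℂ[X]) (f : ℂ[X]) (h : f ∈ Algebra.adjoin ℂ {x, y}) : ∃ g, ev x y g = f := by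
  induction h using Algebra.adjoin_induction with
  | mem z hz =>
    rcases hz with rfl | rfl
    · exact ⟨C X, by simp⟩
    · exact ⟨X, by simp⟩
  | algebraMap r => exact ⟨C (C r), by simp⟩
  | add a b _ _ ha hb =>
    obtain ⟨g, rfl⟩ := ha
    obtain ⟨g', rfl⟩ := hb
    exact ⟨g + g', map_add _ _ _⟩
  | mul a b _ _ ha hb =>
    obtain ⟨g, rfl⟩ := ha
    obtain ⟨g', rfl⟩ := hb
    exact ⟨g * g', map_mul _ _ _⟩

theorem deg_dvd (x y : ℂ[X]) (hx : x.natDegree ≠ 0) (hy : y.natDegree ≠ 0)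
    (h : X ∈ Algebra.adjoin ℂ {x, y}) : x.natDegree ∣ y.natDegree ∨ y.natDegree ∣ x.natDegree := by
  have hx0 : x ≠ 0 := by rintro rfl; simp at hx
  have hl : x.leadingCoeff ≠ 0 := leadingCoeff_ne_zero.2 hx0
  set x' := x * C x.leadingCoeff⁻¹ with hx'
  have hm : x'.Monic := monic_mul_leadingCoeff_inv hx0
  have hd : x'.natDegree = x.natDegree := natDegree_mul_leadingCoeff_inv _ hx0
  have hxx : x = x.leadingCoeff • x' := by
    rw [hx', smul_eq_C_mul, mul_comm, mul_assoc, ← C_mul, inv_mul_cancel₀ hl, C_1, mul_one]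
  have hmem : X ∈ Algebra.adjoin ℂ {x', y} := by
    refine Algebra.adjoin_le ?_ h
    rintro z (rfl | rfl)
    · rw [hxx]
      exact Subalgebra.smul_mem _ (Algebra.subset_adjoin (by simp)) _
    · exact Algebra.subset_adjoin (by simp)
  obtain ⟨g, hg⟩ := exists_ev x' y X hmem
  rw [← hd] at hx ⊢
  obtain ⟨F, hF, hFd, hF0⟩ := exists_F x' y hm hx
  obtain ⟨t₀, h1, h2, h3⟩ := exists_t0 x' hm hx
  let S : Setup := ⟨x', y, hm, hx, g, hg, F, hF, hFd, hF0, t₀, h1, h2, h3⟩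
  exact S.dvd_deg hy

end AMS

end

section
namespace AMS
set_option linter.unusedSectionVars false
set_option linter.unusedVariables false
open Polynomial

/-- polynomials in two variables -/
abbrev M2 := MvPolynomial (Fin 2) ℂ

/-- elementary substitution -/
noncomputable def shf (h : ℂ[X]) : M2 →ₐ[ℂ] M2 :=
  MvPolynomial.aeval ![MvPolynomial.X 0, MvPolynomial.X 1 + aeval (MvPolynomial.X 0) h]

lemma shf_shf (h : ℂ[X]) : (shf h).comp (shf (-h)) = AlgHom.id ℂ M2 := by
  refine MvPolynomial.algHom_ext fun i => ?_
  fin_cases i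
  · simp [shf]
  · simp [shf, ← Polynomial.aeval_algHom_apply]

/-- elementary automorphism -/
noncomputable def she (h : ℂ[X]) : M2 ≃ₐ[ℂ] M2 :=
  AlgEquiv.ofAlgHom (shf h) (shf (-h)) (shf_shf h) (by simpa using shf_shf (-h))

/-- the property of a pair -/
def PP (x y : ℂ[X]) : Prop := X ∈ Algebra.adjoin ℂ {x, y} → ∀ p : M2, Irreducible p →
  MvPolynomial.aeval ![x, y] p = 0 → ∃ φ : M2 ≃ₐ[ℂ] M2, φ p = MvPolynomial.X 0

lemma PP.trans {x y x' y' : ℂ[X]} (θ : M2 ≃ₐ[ℂ] M2) (hθ : ∀ p, MvPolynomial.aeval ![x', y'] (θ p) =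
    MvPolynomial.aeval ![x, y] p) (ha : Algebra.adjoin ℂ {x, y} ≤ Algebra.adjoin ℂ {x', y'})
    (h : PP x' y') : PP x y := by
  intro hX p hp hp0
  obtain ⟨φ, hφ⟩ := h (ha hX) (θ p) ((MulEquiv.irreducible_iff θ).2 hp) (by rw [hθ, hp0])
  exact ⟨θ.trans φ, hφ⟩

lemma PP.swap {x y : ℂ[X]} (h : PP y x) : PP x y := by
  refine PP.trans (MvPolynomial.renameEquiv ℂ (Equiv.swap 0 1)) (fun p => ?_) ?_ h
  · rw [MvPolynomial.renameEquiv_apply, MvPolynomial.aeval_rename]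
    congr 2
    ext i; fin_cases i <;> simp
  · rw [Set.pair_comm]

lemma PP.shear {x y : ℂ[X]} (f : ℂ[X]) (h : PP x (y - aeval x f)) : PP x y := by
  refine PP.trans (she f) (fun p => ?_) ?_ h
  · show (MvPolynomial.aeval ![x, y - aeval x f]) (shf f p) = _
    rw [← AlgHom.comp_apply]
    congr 1
    refine MvPolynomial.algHom_ext fun i => ?_
    fin_cases i
    · simp [shf]
    · simp [shf, ← Polynomial.aeval_algHom_apply]
  · refine Algebra.adjoin_le ?_
    have hx : x ∈ Algebra.adjoin ℂ {x, y - aeval x f} := Algebra.subset_adjoin (by simp)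
    rintro z (rfl | rfl)
    · exact hx
    · have : z = (z - aeval x f) + aeval x f := by ring
      rw [this]
      refine add_mem (Algebra.subset_adjoin (by simp)) ?_
      exact Algebra.adjoin_mono (by simp) (aeval_mem_adjoin_singleton ℂ x)

lemma PP.zero (y : ℂ[X]) : PP 0 y := by
  intro hX p hp hp0
  have hy : Function.Injective (aeval y : ℂ[X] →ₐ[ℂ] ℂ[X]) := by
    rw [injective_iff_map_eq_zero]
    intro a ha
    have h4 : (aeval y a : ℂ[X]) = a.comp y := by
      rw [comp, aeval_def]; rfl
    rw [h4, comp_eq_zero_iff] at ha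
    rcases ha with h | h
    · exact h
    · exfalso
      have : Algebra.adjoin ℂ {0, y} ≤ (⊥ : Subalgebra ℂ ℂ[X]) := by
        refine Algebra.adjoin_le ?_
        rintro z (rfl | rfl)
        · exact zero_mem _
        · rw [h.2]; exact algebraMap_mem _ _
      obtain ⟨c, hc⟩ := Algebra.mem_bot.1 (this hX)
      have := congrArg natDegree hc
      simp [Polynomial.algebraMap_apply] at this
  have h1 : (MvPolynomial.X 0 : M2) ∣ p := by
    let σ : M2 →ₐ[ℂ] ℂ[X] := MvPolynomial.aeval ![0, X]
    have h2 : σ p = 0 := by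
      apply hy
      rw [map_zero, ← hp0, ← AlgHom.comp_apply]
      congr 1
      refine MvPolynomial.algHom_ext fun i => ?_
      fin_cases i <;> simp [σ]
    let τ : ℂ[X] →ₐ[ℂ] M2 := aeval (MvPolynomial.X 1)
    have h3 : ∀ q : M2, (MvPolynomial.X 0 : M2) ∣ q - τ (σ q) := by
      intro q
      induction q using MvPolynomial.induction_on with
      | C a => simp [σ, τ, MvPolynomial.algebraMap_eq]
      | add p q hp hq =>
        rw [map_add, map_add]
        have := dvd_add hp hq
        convert this using 1
        ring
      | mul_X p i hp =>
        rw [map_mul, map_mul]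
        fin_cases i
        · simp [σ, τ]
        · simp only [σ, τ, Fin.mk_one, MvPolynomial.aeval_X, Matrix.cons_val_one,
            Matrix.cons_val_fin_one, aeval_X]
          rw [← sub_mul]
          exact hp.mul_right _
    have := h3 p
    rwa [h2, map_zero, sub_zero] at this
  obtain ⟨u, hu⟩ := h1
  have hX0 : ¬ IsUnit (MvPolynomial.X 0 : M2) := by
    intro h
    have := h.map (MvPolynomial.aeval ![(0 : ℂ), 0] : M2 →ₐ[ℂ] ℂ)
    simp at this
  have hu1 : IsUnit u := (hp.isUnit_or_isUnit hu).resolve_left hX0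
  rw [MvPolynomial.isUnit_iff_eq_C_of_isReduced] at hu1
  obtain ⟨c, hc, rfl⟩ := hu1
  have hc0 : c ≠ 0 := hc.ne_zero
  let s : ℂ → (M2 →ₐ[ℂ] M2) := fun c => MvPolynomial.aeval ![MvPolynomial.C c * MvPolynomial.X 0, MvPolynomial.X 1]
  have hs : ∀ a b : ℂ, a * b = 1 → (s a).comp (s b) = AlgHom.id ℂ M2 := by
    intro a b hab
    refine MvPolynomial.algHom_ext fun i => ?_
    fin_cases i
    · simp [s, MvPolynomial.algebraMap_eq]
      rw [← mul_assoc, ← MvPolynomial.C_mul, mul_comm b, hab]; simp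
    · simp [s]
  refine ⟨AlgEquiv.ofAlgHom (s c⁻¹) (s c) (hs _ _ (inv_mul_cancel₀ hc0))
    (hs _ _ (mul_inv_cancel₀ hc0)), ?_⟩
  rw [hu]
  simp [s, MvPolynomial.algebraMap_eq]
  rw [mul_right_comm, ← MvPolynomial.C_mul, inv_mul_cancel₀ hc0]; simp

theorem PP_all (N : ℕ) : ∀ x y : ℂ[X], x.natDegree + y.natDegree ≤ N → PP x y := by
  induction N with
  | zero =>
    intro x y hN
    obtain ⟨a, ha⟩ := natDegree_eq_zero.1 (by omega : y.natDegree = 0)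
    refine PP.shear (C a) ?_
    rw [← ha]
    simp only [aeval_C, Polynomial.algebraMap_apply, Algebra.algebraMap_self, RingHom.id_apply, sub_self]
    exact (PP.zero x).swap
  | succ N ih =>
    have key : ∀ x y : ℂ[X], x.natDegree + y.natDegree ≤ N + 1 → y.natDegree ≠ 0 →
        x.natDegree ∣ y.natDegree → PP x y := by
      intro x y hN hy0 ⟨k, hk⟩
      have hx0 : x.natDegree ≠ 0 := by intro h; rw [h] at hk; omega
      have hy : y ≠ 0 := by rintro rfl; simp at hy0
      have hx : x ≠ 0 := by rintro rfl; simp at hx0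
      refine PP.shear (C (y.leadingCoeff / x.leadingCoeff ^ k) * X ^ k) (ih _ _ ?_)
      have hlx : x.leadingCoeff ≠ 0 := leadingCoeff_ne_zero.2 hx
      have hly : y.leadingCoeff ≠ 0 := leadingCoeff_ne_zero.2 hy
      set w : ℂ[X] := aeval x (C (y.leadingCoeff / x.leadingCoeff ^ k) * X ^ k) with hw
      have hw' : w = C (y.leadingCoeff / x.leadingCoeff ^ k) * x ^ k := by
        rw [hw]; simp [Polynomial.algebraMap_apply]
      have hlt : (y - w).natDegree < y.natDegree := by
        have hwl : w.leadingCoeff = y.leadingCoeff := by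
          rw [hw', leadingCoeff_mul, leadingCoeff_C, leadingCoeff_pow]; field_simp
        have hwd : w.natDegree = y.natDegree := by
          rw [hw', natDegree_C_mul (by positivity), natDegree_pow, hk, mul_comm]
        have hw0 : w ≠ 0 := by rintro h; rw [h] at hwd; simp at hwd; omega
        have := degree_sub_lt_left (p := y) (q := w) (by
          rw [degree_eq_natDegree hy, degree_eq_natDegree hw0, hwd]) hy hwl.symm
        by_cases h0 : y - w = 0
        · rw [h0, natDegree_zero]; omega
        · exact natDegree_lt_natDegree h0 this
      omega
    intro x y hN
    by_cases hy : y.natDegree = 0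
    · obtain ⟨a, ha⟩ := natDegree_eq_zero.1 hy
      refine PP.shear (C a) ?_
      rw [← ha]
      simp only [aeval_C, Polynomial.algebraMap_apply, Algebra.algebraMap_self, RingHom.id_apply, sub_self]
      exact (PP.zero x).swap
    by_cases hx : x.natDegree = 0
    · obtain ⟨a, ha⟩ := natDegree_eq_zero.1 hx
      refine PP.swap (PP.shear (C a) ?_)
      rw [← ha]
      simp only [aeval_C, Polynomial.algebraMap_apply, Algebra.algebraMap_self, RingHom.id_apply, sub_self]
      exact (PP.zero y).swap
    intro hX
    rcases deg_dvd x y hx hy hX with h | h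
    · exact key x y hN hy h hX
    · exact (key y x (by omega) hx h).swap hX

theorem alg_part (x y : ℂ[X]) (hX : X ∈ Algebra.adjoin ℂ {x, y}) (p : MvPolynomial (Fin 2) ℂ)
    (hp : Irreducible p) (hp0 : MvPolynomial.aeval ![x, y] p = 0) :
    ∃ φ : MvPolynomial (Fin 2) ℂ ≃ₐ[ℂ] MvPolynomial (Fin 2) ℂ, φ p = MvPolynomial.X 0 :=
  PP_all _ x y le_rfl hX p hp hp0

end AMS

end

section
namespace AMS
set_option linter.unusedSectionVars false
set_option linter.unusedVariables false
open Topology Filter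

section glue
variable {Pr : (ℂ → ℂ) → ℂ → Prop}
  (hloc : ∀ f g w c, (∀ᶠ w' in 𝓝 w, f w' = g w' + c) → Pr g w → Pr f w)
  (hex : ∀ w, ∃ f, ∀ᶠ w' in 𝓝 w, Pr f w')
  (huniq : ∀ f g w, (∀ᶠ w' in 𝓝 w, Pr f w' ∧ Pr g w') → ∃ c, ∀ᶠ w' in 𝓝 w, f w' = g w' + c)

include huniq in
lemma glue_uniq (s : Set ℂ) (hs : IsOpen s) (hs' : IsPreconnected s) (f g : ℂ → ℂ)
    (h : ∀ w ∈ s, Pr f w ∧ Pr g w) : ∃ c, ∀ w ∈ s, f w = g w + c := by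
  have hd : ∀ w ∈ s, HasDerivAt (fun w => f w - g w) 0 w := by
    intro w hw
    obtain ⟨c, hc⟩ := huniq f g w (Filter.mem_of_superset (hs.mem_nhds hw) fun w' hw' => h w' hw')
    refine (hasDerivAt_const w c).congr_of_eventuallyEq ?_
    filter_upwards [hc] with w' hw'
    rw [hw']; ring
  obtain ⟨a, ha⟩ := hs.exists_is_const_of_deriv_eq_zero hs'
    (fun w hw => (hd w hw).differentiableAt.differentiableWithinAt)
    (fun w hw => (hd w hw).deriv)
  exact ⟨a, fun w hw => by rw [← ha w hw]; ring⟩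

include hloc hex huniq

lemma glue_ball (R : ℝ) : ∃ f, ∀ w ∈ Metric.ball (0 : ℂ) R, Pr f w := by
  choose F hF using hex
  have hF' : ∀ w, ∃ U : Set ℂ, IsOpen U ∧ w ∈ U ∧ ∀ w' ∈ U, Pr (F w) w' := by
    intro w
    obtain ⟨U, h1, h2, h3⟩ := mem_nhds_iff.1 (hF w)
    exact ⟨U, h2, h3, fun w' hw' => h1 hw'⟩
  choose U hU1 hU2 hU3 using hF'
  obtain ⟨δ, hδ, hL⟩ := lebesgue_number_lemma_of_metric (isCompact_closedBall (0:ℂ) R) hU1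
    (fun w _ => Set.mem_iUnion.2 ⟨w, hU2 w⟩)
  have hbig : ∀ w, ∃ g, w ∈ Metric.ball (0 : ℂ) R → ∀ w' ∈ Metric.ball w δ, Pr g w' := by
    intro w
    by_cases hw : w ∈ Metric.ball (0 : ℂ) R
    · obtain ⟨i, hi⟩ := hL w (Metric.ball_subset_closedBall hw)
      exact ⟨F i, fun _ w' hw' => hU3 i w' (hi hw')⟩
    · exact ⟨0, fun h => absurd h hw⟩
  choose G hG using hbig
  have key : ∀ n : ℕ, ∃ f, ∀ w ∈ Metric.ball (0 : ℂ) R, ‖w‖ < (n + 1) * (δ / 2) → Pr f w := by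
    intro n
    induction n with
    | zero =>
      refine ⟨G 0, fun w hw hw' => ?_⟩
      have h0 : (0 : ℂ) ∈ Metric.ball (0 : ℂ) R := by
        rw [mem_ball_zero_iff] at hw ⊢
        rw [norm_zero]; exact lt_of_le_of_lt (norm_nonneg _) hw
      refine hG 0 h0 w ?_
      rw [mem_ball_zero_iff]
      push_cast at hw'; linarith
    | succ n ih =>
      obtain ⟨f, hf⟩ := ih
      set V : Set ℂ := Metric.ball (0 : ℂ) R ∩ Metric.ball 0 ((n + 1) * (δ / 2)) with hV
      have hVo : IsOpen V := Metric.isOpen_ball.inter Metric.isOpen_ball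
      have hVc : Convex ℝ V := (convex_ball _ _).inter (convex_ball _ _)
      have hfV : ∀ w ∈ V, Pr f w := fun w hw => hf w hw.1 (mem_ball_zero_iff.1 hw.2)
      have hc : ∀ w, ∃ c, w ∈ Metric.ball (0 : ℂ) R → ∀ v ∈ Metric.ball w δ ∩ V, f v = G w v + c := by
        intro w
        by_cases hw : w ∈ Metric.ball (0 : ℂ) R
        · obtain ⟨c, hc⟩ := glue_uniq huniq (Metric.ball w δ ∩ V) (Metric.isOpen_ball.inter hVo)
            ((convex_ball _ _).inter hVc).isPreconnected f (G w)
            (fun v hv => ⟨hfV v hv.2, hG w hw v hv.1⟩)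
          exact ⟨c, fun _ => hc⟩
        · exact ⟨0, fun h => absurd h hw⟩
      choose c hc using hc
      refine ⟨fun w => G w w + c w, fun w hw hw' => ?_⟩
      refine hloc _ (G w) w (c w) ?_ (hG w hw w (Metric.mem_ball_self hδ))
      -- a common point
      have hv : ∃ v ∈ V, v ∈ Metric.ball w δ := by
        have hn : (0:ℝ) < n + 2 := by positivity
        refine ⟨(((n + 1) / (n + 2) : ℝ) : ℂ) * w, ⟨?_, ?_⟩, ?_⟩
        · rw [mem_ball_zero_iff] at hw ⊢
          rw [norm_mul, Complex.norm_real, Real.norm_of_nonneg (by positivity)]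
          refine lt_of_le_of_lt ?_ hw
          refine mul_le_of_le_one_left (norm_nonneg _) ?_
          rw [div_le_one hn]; linarith
        · rw [mem_ball_zero_iff, norm_mul, Complex.norm_real, Real.norm_of_nonneg (by positivity)]
          push_cast at hw'
          rw [div_mul_eq_mul_div, div_lt_iff₀ hn]
          have : (0:ℝ) < n + 1 := by positivity
          nlinarith
        · rw [Metric.mem_ball, dist_eq_norm]
          have : (((n + 1) / (n + 2) : ℝ) : ℂ) * w - w = ((-1 / (n + 2) : ℝ) : ℂ) * w := by
            push_cast
            have : ((n : ℂ) + 2) ≠ 0 := by exact_mod_cast hn.ne'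
            field_simp; ring
          rw [this, norm_mul, Complex.norm_real, Real.norm_eq_abs, abs_div, abs_neg, abs_one,
            abs_of_pos hn, div_mul_eq_mul_div, one_mul, div_lt_iff₀ hn]
          push_cast at hw'
          nlinarith
      obtain ⟨v, hvV, hvw⟩ := hv
      have e1 : ∀ᶠ w' in 𝓝 w, w' ∈ Metric.ball (0:ℂ) R := Metric.isOpen_ball.mem_nhds hw
      have e2 : ∀ᶠ w' in 𝓝 w, w' ∈ Metric.ball w δ := Metric.ball_mem_nhds _ hδ
      have e3 : ∀ᶠ w' in 𝓝 w, w' ∈ Metric.ball v δ :=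
        Metric.isOpen_ball.mem_nhds (Metric.mem_ball_comm.1 hvw)
      filter_upwards [e1, e2, e3] with w' h1 h2 h3
      obtain ⟨b, hb⟩ := glue_uniq huniq (Metric.ball w δ ∩ Metric.ball w' δ)
        (Metric.isOpen_ball.inter Metric.isOpen_ball)
        ((convex_ball _ _).inter (convex_ball _ _)).isPreconnected (G w') (G w)
        (fun u hu => ⟨hG w' h1 u hu.2, hG w hw u hu.1⟩)
      have a1 := hb w' ⟨h2, Metric.mem_ball_self hδ⟩
      have a2 := hb v ⟨hvw, Metric.mem_ball_comm.1 h3⟩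
      have a3 := hc w hw v ⟨hvw, hvV⟩
      have a4 := hc w' h1 v ⟨Metric.mem_ball_comm.1 h3, hvV⟩
      rw [a1]
      linear_combination a3 - a4 - a2
  obtain ⟨n, hn⟩ := exists_nat_gt (R / (δ / 2))
  obtain ⟨f, hf⟩ := key n
  refine ⟨f, fun w hw => hf w hw ?_⟩
  rw [mem_ball_zero_iff] at hw
  rw [div_lt_iff₀ (by positivity)] at hn
  nlinarith

theorem glue : ∃ f, ∀ w, Pr f w := by
  choose f hf using fun n : ℕ => glue_ball hloc hex huniq (n + 1 : ℝ)
  have hagree : ∀ (m n : ℕ) (w : ℂ), w ∈ Metric.ball (0:ℂ) (m + 1) → w ∈ Metric.ball (0:ℂ) (n + 1) →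
      f m w - f m 0 = f n w - f n 0 := by
    intro m n w hm hn
    obtain ⟨c, hc⟩ := glue_uniq huniq (Metric.ball (0:ℂ) (m + 1) ∩ Metric.ball (0:ℂ) (n + 1))
      (Metric.isOpen_ball.inter Metric.isOpen_ball)
      ((convex_ball _ _).inter (convex_ball _ _)).isPreconnected (f m) (f n)
      (fun u hu => ⟨hf m u hu.1, hf n u hu.2⟩)
    rw [hc w ⟨hm, hn⟩, hc 0 ⟨Metric.mem_ball_self (by positivity), Metric.mem_ball_self (by positivity)⟩]
    ring
  have hmem : ∀ w : ℂ, w ∈ Metric.ball (0:ℂ) (⌈‖w‖⌉₊ + 1) := by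
    intro w
    rw [mem_ball_zero_iff]
    have := Nat.le_ceil ‖w‖
    linarith
  refine ⟨fun w => f ⌈‖w‖⌉₊ w - f ⌈‖w‖⌉₊ 0, fun w => ?_⟩
  refine hloc _ (f ⌈‖w‖⌉₊) w (- f ⌈‖w‖⌉₊ 0) ?_ (hf _ _ (hmem w))
  filter_upwards [Metric.isOpen_ball.mem_nhds (hmem w)] with w' hw'
  rw [hagree _ ⌈‖w‖⌉₊ w' (hmem w') hw']; ring
end glue
end AMS

end

section
namespace AMS
set_option linter.unusedSectionVars false
set_option linter.unusedVariables false
open Topology Filter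

lemma implicit_graph (pf px py : ℂ × ℂ → ℂ)
    (hd : ∀ v, HasStrictFDerivAt pf (px v • ContinuousLinearMap.fst ℂ ℂ ℂ +
      py v • ContinuousLinearMap.snd ℂ ℂ ℂ) v) (hpy : Continuous py)
    (v : ℂ × ℂ) (hv : pf v = 0) (hv' : py v ≠ 0) :
    ∃ η : ℂ → ℂ, η v.1 = v.2 ∧ (∀ᶠ x in 𝓝 v.1, HasDerivAt η (-px (x, η x) / py (x, η x)) x ∧
      pf (x, η x) = 0 ∧ py (x, η x) ≠ 0) ∧ ∀ᶠ w in 𝓝 v, (pf w = 0 ↔ η w.1 = w.2) := by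
  have key : ∀ v : ℂ × ℂ, pf v = 0 → py v ≠ 0 → ∃ η : ℂ → ℂ, ContinuousAt η v.1 ∧ η v.1 = v.2 ∧
      HasDerivAt η (-px v / py v) v.1 ∧ (∀ᶠ x in 𝓝 v.1, pf (x, η x) = 0) ∧
      ∀ᶠ w in 𝓝 v, (pf w = 0 ↔ η w.1 = w.2) := by
    intro v hv hv'
    have hinv : ((px v • ContinuousLinearMap.fst ℂ ℂ ℂ +
      py v • ContinuousLinearMap.snd ℂ ℂ ℂ) ∘L .inr ℂ ℂ ℂ).IsInvertible := by
      refine ⟨ContinuousLinearEquiv.unitsEquivAut ℂ (Units.mk0 _ hv'), ?_⟩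
      ext
      simp
    have h1 := (hd v).eventually_apply_eq_iff_implicitFunctionOfProdDomain hinv
    have h2 := (hd v).hasStrictFDerivAt_implicitFunctionOfProdDomain hinv
    have h3 := (hd v).eventually_apply_implicitFunctionOfProdDomain hinv
    set η := (hd v).implicitFunctionOfProdDomain hinv
    have h4 : η v.1 = v.2 := h1.self_of_nhds.1 rfl
    rw [hv] at h1 h3
    have h5 := h2.hasFDerivAt.hasDerivAt
    set e := (-((px v • ContinuousLinearMap.fst ℂ ℂ ℂ + py v • ContinuousLinearMap.snd ℂ ℂ ℂ) ∘L .inr ℂ ℂ ℂ).inverse ∘L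
      ((px v • ContinuousLinearMap.fst ℂ ℂ ℂ + py v • ContinuousLinearMap.snd ℂ ℂ ℂ) ∘L .inl ℂ ℂ ℂ)) 1
    have h6 : HasDerivAt (fun x => (x, η x)) ((1 : ℂ), e) v.1 := (hasDerivAt_id _).prodMk h5
    have h7 : HasDerivAt (fun x => pf (x, η x)) (px v + py v * e) v.1 := by
      have := ((hd v).hasFDerivAt.comp_hasDerivAt_of_eq v.1 h6 (by simp [h4]))
      simpa using! this
    have h8 : HasDerivAt (fun x => pf (x, η x)) 0 v.1 :=
      (hasDerivAt_const v.1 (0:ℂ)).congr_of_eventuallyEq h3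
    have h9 := h7.unique h8
    refine ⟨η, h5.continuousAt, h4, ?_, h3, h1⟩
    refine h5.congr_deriv ?_
    rw [eq_div_iff hv']
    linear_combination h9
  obtain ⟨η, h1, h2, h3, h4, h5⟩ := key v hv hv'
  have hct : Tendsto (fun x => (x, η x)) (𝓝 v.1) (𝓝 v) := by
    have : ContinuousAt (fun x => (x, η x)) v.1 := continuousAt_id.prodMk h1
    unfold ContinuousAt at this
    simpa only [h2] using this
  refine ⟨η, h2, ?_, h5⟩
  have h6 := hct.eventually h5.eventually_nhds
  have h7 := hct.eventually (hpy.continuousAt.eventually_ne hv')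
  filter_upwards [h4, h6, h7] with x hx4 hx6 hx7
  refine ⟨?_, hx4, hx7⟩
  obtain ⟨ξ, g1, g2, g3, g4, g5⟩ := key _ hx4 hx7
  refine g3.congr_of_eventuallyEq ?_
  have hct' : Tendsto (fun x => (x, ξ x)) (𝓝 x) (𝓝 (x, η x)) := by
    have : ContinuousAt (fun x => (x, ξ x)) x := continuousAt_id.prodMk g1
    unfold ContinuousAt at this
    simpa only [show ξ x = η x from g2] using this
  filter_upwards [hct'.eventually hx6, g4] with x' k1 k2
  exact k1.1 k2

/-- `T` has derivative `1` along the field `Xf`, within `Z`, at `z`. -/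
def Prim (Z : Set (ℂ × ℂ)) (Xf : ℂ × ℂ → ℂ × ℂ) (T : ℂ × ℂ → ℂ) (z : ℂ × ℂ) : Prop :=
  ∃ L : ℂ × ℂ →L[ℂ] ℂ, HasFDerivWithinAt T L Z z ∧ L (Xf z) = 1

/-- a flow chart at `z` -/
def Chart (Z : Set (ℂ × ℂ)) (Xf : ℂ × ℂ → ℂ × ℂ) (z : ℂ × ℂ) : Prop :=
  ∃ (γ : ℂ → ℂ × ℂ) (T0 : ℂ × ℂ → ℂ) (s0 : ℂ), γ s0 = z ∧ T0 z = s0 ∧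
    (∀ᶠ s in 𝓝 s0, γ s ∈ Z ∧ HasDerivAt γ (Xf (γ s)) s ∧ T0 (γ s) = s) ∧
    (∀ᶠ z' in 𝓝[Z] z, γ (T0 z') = z') ∧ ∀ᶠ z' in 𝓝[Z] z, Prim Z Xf T0 z'

lemma chart_of_graph (Z : Set (ℂ × ℂ)) (Xf : ℂ × ℂ → ℂ × ℂ) (hX : Differentiable ℂ Xf)
    (v : ℂ × ℂ) (hv : v ∈ Z) (η : ℂ → ℂ) (h0 : η v.1 = v.2)
    (h1 : ∀ᶠ x in 𝓝 v.1, HasDerivAt η ((Xf (x, η x)).2 / (Xf (x, η x)).1) x ∧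
      (x, η x) ∈ Z ∧ (Xf (x, η x)).1 ≠ 0)
    (h2 : ∀ᶠ w in 𝓝 v, w ∈ Z → η w.1 = w.2) : Chart Z Xf v := by
  obtain ⟨ε, hε, hb⟩ := Metric.eventually_nhds_iff_ball.1 h1
  have hdf : DifferentiableOn ℂ (fun x => ((Xf (x, η x)).1)⁻¹) (Metric.ball v.1 ε) := by
    intro x hx
    have := hb x hx
    refine DifferentiableAt.differentiableWithinAt ?_
    refine DifferentiableAt.inv ?_ this.2.2
    exact ((hX _).comp x (differentiableAt_id.prodMk this.1.differentiableAt)).fst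
  obtain ⟨F, hF⟩ := hdf.isExactOn_ball
  have hvb : v.1 ∈ Metric.ball v.1 ε := Metric.mem_ball_self hε
  have hFan : ContDiffAt ℂ 1 F v.1 := by
    have : DifferentiableOn ℂ F (Metric.ball v.1 ε) := fun x hx =>
      (hF x hx).differentiableAt.differentiableWithinAt
    exact (this.analyticAt (Metric.isOpen_ball.mem_nhds hvb)).contDiffAt
  have hFs : HasStrictDerivAt F ((Xf (v.1, η v.1)).1)⁻¹ v.1 := by
    have := hFan.hasStrictDerivAt' (hF v.1 hvb) one_ne_zero
    exact this
  have hne : ((Xf (v.1, η v.1)).1)⁻¹ ≠ 0 := inv_ne_zero (hb _ hvb).2.2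
  set G := hFs.localInverse F _ v.1 hne
  have hG1 : ∀ᶠ x in 𝓝 v.1, G (F x) = x := hFs.eventually_left_inverse hne
  have hG2 : ∀ᶠ s in 𝓝 (F v.1), F (G s) = s := hFs.eventually_right_inverse hne
  have hGv : G (F v.1) = v.1 := hG1.self_of_nhds
  have hGd := hFs.to_localInverse hne
  have hGc : Tendsto G (𝓝 (F v.1)) (𝓝 v.1) := by
    have := hGd.hasDerivAt.continuousAt
    unfold ContinuousAt at this
    rwa [show hFs.localInverse F _ v.1 hne = G from rfl, hGv] at this
  have hGball : ∀ᶠ s in 𝓝 (F v.1), G s ∈ Metric.ball v.1 ε :=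
    hGc.eventually (Metric.isOpen_ball.mem_nhds hvb)
  have hG3 : ∀ᶠ s in 𝓝 (F v.1), ContinuousAt G s := by
    have hc : ∀ᶠ s in 𝓝 (F v.1), G (F (G s)) = G s := by
      filter_upwards [hG2] with s hs
      rw [hs]
    -- use the contDiff of the inverse
    have := (HasStrictFDerivAt.toOpenPartialHomeomorph F (hFs.hasStrictFDerivAt_equiv hne)).continuousOn_symm
    filter_upwards [(HasStrictFDerivAt.toOpenPartialHomeomorph F (hFs.hasStrictFDerivAt_equiv hne)).open_target.mem_nhds
      (hFs.hasStrictFDerivAt_equiv hne).image_mem_toOpenPartialHomeomorph_target] with s hs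
    exact this.continuousAt ((HasStrictFDerivAt.toOpenPartialHomeomorph F (hFs.hasStrictFDerivAt_equiv hne)).open_target.mem_nhds hs)
  have hfst : Tendsto (fun z : ℂ × ℂ => z.1) (𝓝[Z] v) (𝓝 v.1) :=
    (continuous_fst.tendsto v).mono_left nhdsWithin_le_nhds
  refine ⟨fun s => (G s, η (G s)), fun z => F z.1, F v.1, ?_, rfl, ?_, ?_, ?_⟩
  · ext
    · exact hGv
    · simp only [hGv, h0]
  · filter_upwards [hG2.eventually_nhds, hGball, hG3] with s hs1 hs2 hs3
    have hb' := hb _ hs2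
    have hd1 : HasDerivAt G ((Xf (G s, η (G s))).1) s := by
      have := HasDerivAt.of_local_left_inverse hs3 (hF _ hs2) (inv_ne_zero hb'.2.2) hs1
      simpa using this
    refine ⟨hb'.2.1, ?_, hs1.self_of_nhds⟩
    have hd2 := hb'.1.comp s hd1
    have := hd1.prodMk hd2
    refine this.congr_deriv ?_
    ext
    · rfl
    · simp only; rw [div_mul_cancel₀ _ hb'.2.2]
  · filter_upwards [hfst.eventually hG1, h2.filter_mono nhdsWithin_le_nhds, self_mem_nhdsWithin] with z k1 k2 k3
    ext
    · exact k1
    · simp only [k1]; exact k2 k3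
  · filter_upwards [hfst.eventually (Metric.isOpen_ball.mem_nhds hvb),
      h2.filter_mono nhdsWithin_le_nhds, self_mem_nhdsWithin] with z k1 k2 k3
    have k4 : (z.1, η z.1) = z := by rw [k2 k3]
    refine ⟨((Xf (z.1, η z.1)).1)⁻¹ • ContinuousLinearMap.fst ℂ ℂ ℂ, ?_, ?_⟩
    · have h := (hF _ k1).comp_hasFDerivAt z (hasFDerivAt_fst (𝕜 := ℂ) (E := ℂ) (F := ℂ) (p := z))
      exact h.hasFDerivWithinAt
    · have := (hb _ k1).2.2
      rw [k4] at this ⊢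
      simp [this]

lemma chart_swap (Z : Set (ℂ × ℂ)) (Xf : ℂ × ℂ → ℂ × ℂ) (v : ℂ × ℂ)
    (h : Chart (Prod.swap ⁻¹' Z) (fun w => (Xf w.swap).swap) v.swap) : Chart Z Xf v := by
  obtain ⟨γ, T0, s0, h1, h2, h3, h4, h5⟩ := h
  set sw : (ℂ × ℂ) ≃L[ℂ] (ℂ × ℂ) := ContinuousLinearEquiv.prodComm ℂ ℂ ℂ
  have hsw : ∀ z, sw z = z.swap := fun z => rfl
  have ht : Tendsto (Prod.swap : ℂ × ℂ → ℂ × ℂ) (𝓝[Z] v) (𝓝[Prod.swap ⁻¹' Z] v.swap) := by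
    refine tendsto_nhdsWithin_iff.2 ⟨(continuous_swap.tendsto v).mono_left nhdsWithin_le_nhds, ?_⟩
    filter_upwards [self_mem_nhdsWithin] with z hz
    simpa using hz
  refine ⟨fun s => (γ s).swap, fun z => T0 z.swap, s0, by simp [h1], h2, ?_, ?_, ?_⟩
  · filter_upwards [h3] with s hs
    refine ⟨hs.1, ?_, by simpa using hs.2.2⟩
    have := sw.toContinuousLinearMap.hasFDerivAt.comp_hasDerivAt s hs.2.1
    simpa [hsw] using! this
  · filter_upwards [ht.eventually h4] with z hz
    rw [hz, Prod.swap_swap]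
  · filter_upwards [ht.eventually h5] with z hz
    obtain ⟨L, hL, hL'⟩ := hz
    refine ⟨L.comp sw.toContinuousLinearMap, ?_, ?_⟩
    · exact HasFDerivWithinAt.comp z (t := Prod.swap ⁻¹' Z) hL
        sw.toContinuousLinearMap.hasFDerivAt.hasFDerivWithinAt (fun z hz => by simpa [hsw] using hz)
    · simpa [hsw] using hL'
end AMS

end

section
namespace AMS
set_option linter.unusedSectionVars false
set_option linter.unusedVariables false
open Topology Filter

section
variable {Z : Set (ℂ × ℂ)} {Xf : ℂ × ℂ → ℂ × ℂ}

lemma Prim.congr {T T' : ℂ × ℂ → ℂ} {z : ℂ × ℂ} {c : ℂ} (hz : z ∈ Z)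
    (h : ∀ᶠ z' in 𝓝[Z] z, T z' = T' z' + c) (hT : Prim Z Xf T' z) : Prim Z Xf T z := by
  obtain ⟨L, h1, h2⟩ := hT
  refine ⟨L, ?_, h2⟩
  have := h1.add_const c
  exact this.congr_of_eventuallyEq h (h.self_of_nhdsWithin hz)

lemma Prim.comp_curve {T : ℂ × ℂ → ℂ} {γ : ℂ → ℂ × ℂ} {s : ℂ} {c : ℂ}
    (hγ : HasDerivAt γ (c • Xf (γ s)) s) (hZ : ∀ᶠ s' in 𝓝 s, γ s' ∈ Z) (hT : Prim Z Xf T (γ s)) :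
    HasDerivAt (fun s => T (γ s)) c s := by
  obtain ⟨L, h1, h2⟩ := hT
  obtain ⟨ε, hε, hb⟩ := Metric.eventually_nhds_iff_ball.1 hZ
  have := h1.comp_hasDerivWithinAt s (s := Metric.ball s ε) hγ.hasDerivWithinAt (fun x hx => hb x hx)
  have h3 := this.hasDerivAt (Metric.isOpen_ball.mem_nhds (Metric.mem_ball_self hε))
  refine h3.congr_deriv ?_
  rw [map_smul, h2]; simp

lemma Prim.comp_curve_one {T : ℂ × ℂ → ℂ} {γ : ℂ → ℂ × ℂ} {s : ℂ}
    (hγ : HasDerivAt γ (Xf (γ s)) s) (hZ : ∀ᶠ s' in 𝓝 s, γ s' ∈ Z) (hT : Prim Z Xf T (γ s)) :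
    HasDerivAt (fun s => T (γ s)) 1 s :=
  Prim.comp_curve (Xf := Xf) (by simpa using hγ) hZ hT

/-- in the chart, `T (γ s) = s + c` -/
lemma Prim.chart_const {T : ℂ × ℂ → ℂ} {γ : ℂ → ℂ × ℂ} {s0 : ℂ}
    (h1 : ∀ᶠ s in 𝓝 s0, γ s ∈ Z ∧ HasDerivAt γ (Xf (γ s)) s)
    (hT : ∀ᶠ s in 𝓝 s0, Prim Z Xf T (γ s)) :
    ∃ c, ∀ᶠ s in 𝓝 s0, T (γ s) = s + c := by
  obtain ⟨ε, hε, hb⟩ := Metric.eventually_nhds_iff_ball.1 (h1.and hT)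
  have hd : ∀ s ∈ Metric.ball s0 ε, HasDerivAt (fun s => T (γ s) - s) 0 s := by
    intro s hs
    have := Prim.comp_curve_one (hb s hs).1.2 (Filter.mem_of_superset (Metric.isOpen_ball.mem_nhds hs)
      fun s' hs' => (hb s' hs').1.1) (hb s hs).2
    refine (this.sub (hasDerivAt_id s)).congr_deriv (by simp)
  obtain ⟨a, ha⟩ := Metric.isOpen_ball.exists_is_const_of_deriv_eq_zero
    (convex_ball s0 ε).isPreconnected
    (fun w hw => (hd w hw).differentiableAt.differentiableWithinAt) (fun w hw => (hd w hw).deriv)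
  refine ⟨a, Filter.mem_of_superset (Metric.ball_mem_nhds s0 hε) fun s hs => ?_⟩
  have := ha s hs
  show T (γ s) = s + a
  rw [← this]; ring

lemma Prim.uniq {T T' : ℂ × ℂ → ℂ} {z : ℂ × ℂ} (hz : z ∈ Z) (hc : Chart Z Xf z)
    (hT : ∀ᶠ z' in 𝓝[Z] z, Prim Z Xf T z') (hT' : ∀ᶠ z' in 𝓝[Z] z, Prim Z Xf T' z') :
    ∃ c, ∀ᶠ z' in 𝓝[Z] z, T z' = T' z' + c := by
  obtain ⟨γ, T0, s0, h1, h2, h3, h4, h5⟩ := hc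
  have hγ : Tendsto γ (𝓝 s0) (𝓝[Z] z) := by
    refine tendsto_nhdsWithin_iff.2 ⟨?_, h3.mono fun s hs => hs.1⟩
    have := h3.self_of_nhds.2.1.continuousAt.tendsto
    rwa [h1] at this
  obtain ⟨c, hc⟩ := Prim.chart_const (h3.mono fun s hs => ⟨hs.1, hs.2.1⟩) (hγ.eventually hT)
  obtain ⟨c', hc'⟩ := Prim.chart_const (h3.mono fun s hs => ⟨hs.1, hs.2.1⟩) (hγ.eventually hT')
  have hT0 : Tendsto T0 (𝓝[Z] z) (𝓝 s0) := by
    obtain ⟨L, hL, _⟩ := h5.self_of_nhdsWithin hz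
    have := hL.continuousWithinAt.tendsto
    rwa [h2] at this
  refine ⟨c - c', ?_⟩
  filter_upwards [hT0.eventually hc, hT0.eventually hc', h4] with z' k1 k2 k3
  rw [k3] at k1 k2
  rw [k1, k2]; ring

lemma global_T (hch : ∀ z ∈ Z, Chart Z Xf z) (h : Z ≃ₜ ℂ) :
    ∃ T : ℂ × ℂ → ℂ, ∀ z ∈ Z, Prim Z Xf T z := by
  classical
  set k : ℂ → ℂ × ℂ := fun w => (h.symm w : ℂ × ℂ)
  have hkZ : ∀ w, k w ∈ Z := fun w => (h.symm w).2
  have hmap : ∀ w, map k (𝓝 w) = 𝓝[Z] (k w) := by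
    intro w
    rw [nhdsWithin_eq_map_subtype_coe (hkZ w)]
    show map (Subtype.val ∘ h.symm) (𝓝 w) = map Subtype.val (𝓝 (h.symm w))
    rw [← Filter.map_map, h.symm.map_nhds_eq]
  have hev : ∀ w (P : ℂ × ℂ → Prop), (∀ᶠ w' in 𝓝 w, P (k w')) ↔ ∀ᶠ z in 𝓝[Z] (k w), P z := by
    intro w P
    rw [← hmap, Filter.eventually_map]
  set ex : (ℂ → ℂ) → ℂ × ℂ → ℂ := fun f z => if hz : z ∈ Z then f (h ⟨z, hz⟩) else 0
  have hex : ∀ f w, ex f (k w) = f w := by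
    intro f w
    simp only [ex, hkZ w, dite_true]
    congr 1
    exact h.apply_symm_apply w
  have hsurj : ∀ z ∈ Z, ∃ w, k w = z := fun z hz => ⟨h ⟨z, hz⟩, by simp [k]⟩
  suffices H : ∃ f, ∀ w, Prim Z Xf (ex f) (k w) by
    obtain ⟨f, hf⟩ := H
    refine ⟨ex f, fun z hz => ?_⟩
    obtain ⟨w, rfl⟩ := hsurj z hz
    exact hf w
  refine glue (Pr := fun f w => Prim Z Xf (ex f) (k w)) ?_ ?_ ?_
  · intro f g w c hfg hg
    refine hg.congr (c := c) (hkZ w) ?_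
    rw [← hev]
    simpa [hex] using hfg
  · intro w
    obtain ⟨γ, T0, s0, h1, h2, h3, h4, h5⟩ := hch _ (hkZ w)
    refine ⟨fun w => T0 (k w), ?_⟩
    rw [hev w (fun z => Prim Z Xf _ z)]
    filter_upwards [h5, self_mem_nhdsWithin] with z hz1 hz2
    refine hz1.congr (c := 0) hz2 ?_
    filter_upwards [self_mem_nhdsWithin] with z' hz'
    obtain ⟨w', rfl⟩ := hsurj z' hz'
    have := hex (fun w => T0 (k w)) w'
    rw [add_zero]
    exact this
  · intro f g w hfg
    rw [hev w (fun z => Prim Z Xf (ex f) z ∧ Prim Z Xf (ex g) z)] at hfg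
    obtain ⟨c, hc⟩ := Prim.uniq (hkZ w) (hch _ (hkZ w)) (hfg.mono fun _ h => h.1) (hfg.mono fun _ h => h.2)
    refine ⟨c, ?_⟩
    rw [← hev] at hc
    simpa [hex] using hc

end
end AMS

end

section
namespace AMS
set_option linter.unusedSectionVars false
set_option linter.unusedVariables false
open Topology Filter Polynomial

/-- polynomially bounded -/
def PB {α : Type*} (n f : α → ℝ) : Prop := ∃ C : ℝ, ∃ k : ℕ, 0 ≤ C ∧ ∀ a, f a ≤ C * (1 + n a) ^ k

section PB
variable {α : Type*} {n f g : α → ℝ} (hn : ∀ a, 0 ≤ n a)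

lemma PB.mono (h : PB n f) (hg : ∀ a, g a ≤ f a) : PB n g := by
  obtain ⟨C, k, hC, h⟩ := h
  exact ⟨C, k, hC, fun a => (hg a).trans (h a)⟩

lemma PB.const (c : ℝ) : PB n (fun _ => c) :=
  ⟨|c|, 0, abs_nonneg _, fun a => by simpa using le_abs_self c⟩

include hn

lemma PB.self : PB n n := ⟨1, 1, zero_le_one, fun a => by linarith [hn a]⟩

lemma PB.add (hf : PB n f) (hg : PB n g) : PB n (fun a => f a + g a) := by
  obtain ⟨C, k, hC, hf⟩ := hf
  obtain ⟨D, l, hD, hg⟩ := hg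
  refine ⟨C + D, k + l, by positivity, fun a => ?_⟩
  have h1 : (1 : ℝ) ≤ 1 + n a := by linarith [hn a]
  have h2 : (1 + n a) ^ k ≤ (1 + n a) ^ (k + l) := pow_le_pow_right₀ h1 (by omega)
  have h3 : (1 + n a) ^ l ≤ (1 + n a) ^ (k + l) := pow_le_pow_right₀ h1 (by omega)
  calc f a + g a ≤ C * (1 + n a) ^ k + D * (1 + n a) ^ l := add_le_add (hf a) (hg a)
    _ ≤ C * (1 + n a) ^ (k+l) + D * (1 + n a) ^ (k+l) := by gcongr
    _ = _ := by ring

lemma PB.mul (hf : PB n f) (hg : PB n g) (hg0 : ∀ a, 0 ≤ g a) : PB n (fun a => f a * g a) := by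
  obtain ⟨C, k, hC, hf⟩ := hf
  obtain ⟨D, l, hD, hg⟩ := hg
  refine ⟨C * D, k + l, by positivity, fun a => ?_⟩
  have h0 := hn a
  calc f a * g a ≤ (C * (1 + n a) ^ k) * (D * (1 + n a) ^ l) :=
        mul_le_mul (hf a) (hg a) (hg0 a) (by positivity)
    _ = _ := by ring

lemma PB.pow (hf : PB n f) (hf0 : ∀ a, 0 ≤ f a) (m : ℕ) : PB n (fun a => f a ^ m) := by
  induction m with
  | zero => simpa using PB.const (n := n) 1
  | succ m ih => simpa only [pow_succ] using PB.mul hn ih hf hf0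

lemma PB.sum {ι : Type*} (s : Finset ι) (F : ι → α → ℝ) (h : ∀ i ∈ s, PB n (F i)) :
    PB n (fun a => ∑ i ∈ s, F i a) := by
  classical
  induction s using Finset.induction_on with
  | empty => simpa using PB.const (n := n) 0
  | insert i s hi ih =>
    simp only [Finset.sum_insert hi]
    exact PB.add hn (h i (by simp)) (ih fun j hj => h j (by simp [hj]))

lemma PB.trans (hf0 : ∀ a, 0 ≤ f a) (hf : PB n f) (hg : PB f g) : PB n g := by
  obtain ⟨C, k, hC, hg⟩ := hg
  refine PB.mono ?_ hg
  refine PB.mul hn (PB.const C) (PB.pow hn (PB.add hn (PB.const 1) hf) (fun a => ?_) k) (fun a => ?_)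
  · linarith [hf0 a]
  · have := hf0 a; positivity

lemma PB.eval {x : α → ℂ} (hx : PB n (fun a => ‖x a‖)) (q : ℂ[X]) :
    PB n (fun a => ‖q.eval (x a)‖) := by
  refine PB.mono (f := fun a => ∑ i ∈ Finset.range (q.natDegree + 1), ‖q.coeff i‖ * ‖x a‖ ^ i) ?_ ?_
  · exact PB.sum hn _ _ fun i _ => PB.mul hn (PB.const _) (PB.pow hn hx (fun a => norm_nonneg _) i)
      (fun a => by positivity)
  · intro a
    rw [eval_eq_sum_range]
    refine (norm_sum_le _ _).trans (le_of_eq ?_)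
    simp

lemma PB.evalEval {x y : α → ℂ} (hx : PB n (fun a => ‖x a‖)) (hy : PB n (fun a => ‖y a‖)) (q : ℂ[X][X]) :
    PB n (fun a => ‖(q.map (evalRingHom (x a))).eval (y a)‖) := by
  refine PB.mono (f := fun a => ∑ i ∈ Finset.range (q.natDegree + 1),
    ‖(q.coeff i).eval (x a)‖ * ‖y a‖ ^ i) ?_ ?_
  · exact PB.sum hn _ _ fun i _ => PB.mul hn (PB.eval hn hx _) (PB.pow hn hy (fun a => norm_nonneg _) i)
      (fun a => by positivity)
  · intro a
    rw [eval_eq_sum_range' (n := q.natDegree + 1)]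
    · refine (norm_sum_le _ _).trans (le_of_eq ?_)
      simp
    · exact Nat.lt_succ_of_le natDegree_map_le
end PB

/-- roots of monic polynomials are bounded by coefficients -/
lemma monic_root_bound (f : ℂ[X]) (N : ℕ) (hN : f.natDegree = N) (hf : f.Monic) (y : ℂ) (hy : f.eval y = 0) :
    ‖y‖ ≤ 1 + ∑ i ∈ Finset.range N, ‖f.coeff i‖ := by
  by_contra! h
  have hs : 0 ≤ ∑ i ∈ Finset.range N, ‖f.coeff i‖ := Finset.sum_nonneg fun _ _ => norm_nonneg _
  have h1 : 1 ≤ ‖y‖ := by linarith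
  rw [eval_eq_sum_range, hN, Finset.sum_range_succ, ← hN, hf.coeff_natDegree, one_mul, hN] at hy
  have h2 : ‖y‖ ^ N ≤ ∑ i ∈ Finset.range N, ‖f.coeff i‖ * ‖y‖ ^ i := by
    rw [← norm_pow, eq_neg_of_add_eq_zero_right hy, norm_neg]
    refine (norm_sum_le _ _).trans (le_of_eq (by simp))
  rcases N with _ | N
  · simp at h2
    linarith
  have h3 : ∑ i ∈ Finset.range (N+1), ‖f.coeff i‖ * ‖y‖ ^ i ≤ (∑ i ∈ Finset.range (N+1), ‖f.coeff i‖) * ‖y‖ ^ N := by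
    rw [Finset.sum_mul]
    refine Finset.sum_le_sum fun i hi => ?_
    rw [Finset.mem_range] at hi
    gcongr
    omega
  have h4 : 0 < ‖y‖ ^ N := by positivity
  have h5 := h2.trans h3
  rw [pow_succ'] at h5
  have := le_of_mul_le_mul_right h5 h4
  linarith

lemma entire_poly (f : ℂ → ℂ) (hf : Differentiable ℂ f) (hb : PB (fun x : ℂ => ‖x‖) (fun x => ‖f x‖)) :
    ∃ q : ℂ[X], ∀ x, f x = q.eval x := by
  obtain ⟨C, k, hC, hb⟩ := hb
  have hz : ∀ n, k < n → iteratedDeriv n f 0 = 0 := by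
    intro n hn
    have h1 : ∀ R : ℝ, 1 ≤ R → ‖iteratedDeriv n f 0‖ ≤ (n.factorial * C * 2 ^ k) / R := by
      intro R hR
      have hR0 : 0 < R := by linarith
      have := Complex.norm_iteratedDeriv_le_of_forall_mem_sphere_norm_le (c := 0) (C := C * (1 + R)^k) n hR0
        hf.diffContOnCl (fun z hz => by
          have h : ‖f z‖ ≤ C * (1 + ‖z‖) ^ k := hb z
          rw [mem_sphere_zero_iff_norm] at hz
          rwa [hz] at h)
      refine this.trans ?_
      rw [div_le_div_iff₀ (by positivity) hR0]
      have e1 : (1 + R) ^ k ≤ (2 * R) ^ k := by gcongr; linarith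
      have e2 : R ^ (k+1) ≤ R ^ n := pow_le_pow_right₀ hR hn
      calc (n.factorial : ℝ) * (C * (1 + R) ^ k) * R ≤ n.factorial * (C * (2 * R) ^ k) * R := by gcongr
        _ = n.factorial * C * 2 ^ k * R ^ (k+1) := by rw [mul_pow]; ring
        _ ≤ _ := by gcongr
    have h2 : Tendsto (fun R : ℝ => ((n.factorial : ℝ) * C * 2 ^ k) / R) atTop (𝓝 0) :=
      tendsto_const_nhds.div_atTop tendsto_id
    have h3 := ge_of_tendsto h2 ((eventually_ge_atTop 1).mono h1)
    exact norm_le_zero_iff.1 h3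
  refine ⟨∑ n ∈ Finset.range (k+1), Polynomial.C ((n.factorial : ℂ)⁻¹ * iteratedDeriv n f 0) * Polynomial.X ^ n, fun x => ?_⟩
  have h1 := Complex.hasSum_taylorSeries_of_entire hf 0 x
  have h2 : HasSum (fun n : ℕ ↦ (n.factorial : ℂ)⁻¹ • (x - 0) ^ n • iteratedDeriv n f 0) _ :=
    hasSum_sum_of_ne_finset_zero
    (s := Finset.range (k+1)) (fun b hb => by
      rw [Finset.mem_range] at hb
      simp [hz b (by omega)])
  rw [h1.unique h2]
  simp only [eval_finsetSum, eval_mul, eval_C, eval_pow, eval_X, smul_eq_mul, sub_zero]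
  exact Finset.sum_congr rfl fun i _ => by ring

lemma bezout (P : ℂ[X][X]) (hP : P.Monic) (hirr : Irreducible P) :
    ∃ (a b : ℂ[X][X]) (d : ℂ[X]), d ≠ 0 ∧ a * P + b * derivative P = C d := by
  have hN : P.natDegree ≠ 0 := by
    intro h
    have := hP.natDegree_eq_zero.1 h
    exact hirr.not_isUnit (this ▸ isUnit_one)
  obtain ⟨p, q, -, -, h⟩ := exists_mul_add_mul_eq_C_resultant P (derivative P) le_rfl le_rfl (Or.inl hN)
  refine ⟨p, q, _, ?_, by rw [← h]; ring⟩
  intro h0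
  have hinj := IsFractionRing.injective ℂ[X] (FractionRing ℂ[X])
  have hi := (hP.irreducible_iff_irreducible_map_fraction_map (K := FractionRing ℂ[X])).1 hirr
  have hs : IsCoprime _ _ := hi.separable
  have h1 : resultant (P.map (algebraMap ℂ[X] (FractionRing ℂ[X]))) (derivative (P.map (algebraMap ℂ[X] (FractionRing ℂ[X])))) = 0 := by
    rw [derivative_map, natDegree_map_eq_of_injective hinj, natDegree_map_eq_of_injective hinj,
      resultant_map_map, h0, map_zero]
  exact (resultant_eq_zero_iff.1 h1).2 hs

end AMS

end

section
namespace AMS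
set_option linter.unusedSectionVars false
set_option linter.unusedVariables false
open Topology Filter Polynomial

lemma charts (pf px py : ℂ × ℂ → ℂ)
    (hd : ∀ v, HasStrictFDerivAt pf (px v • ContinuousLinearMap.fst ℂ ℂ ℂ +
      py v • ContinuousLinearMap.snd ℂ ℂ ℂ) v) (hpx : Differentiable ℂ px) (hpy : Differentiable ℂ py)
    (hsm : ∀ v, pf v = 0 → px v ≠ 0 ∨ py v ≠ 0) :
    ∀ z ∈ {v | pf v = 0}, Chart {v | pf v = 0} (fun v => (py v, -px v)) z := by
  intro z hz
  rcases hsm z hz with h | h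
  · apply chart_swap
    obtain ⟨η, h0, h1, h2⟩ := implicit_graph (fun w => pf w.swap) (fun w => py w.swap) (fun w => px w.swap)
      (by
        intro v
        have := (hd v.swap).comp v (ContinuousLinearEquiv.prodComm ℂ ℂ ℂ).toContinuousLinearMap.hasStrictFDerivAt
        refine this.congr_fderiv ?_
        ext <;> simp) (hpx.continuous.comp continuous_swap) z.swap (by simpa using hz) (by simpa using h)
    refine chart_of_graph _ _ ?_ _ (by simpa using hz) η h0 ?_ (h2.mono fun w hw => hw.1)
    · have hs : Differentiable ℂ (Prod.swap : ℂ × ℂ → ℂ × ℂ) := differentiable_snd.prodMk differentiable_fst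
      exact ((hpx.comp hs).neg).prodMk (hpy.comp hs)
    · filter_upwards [h1] with x hx
      refine ⟨hx.1.congr_deriv ?_, hx.2.1, ?_⟩
      · simp [neg_div, div_neg]
      · simpa using hx.2.2
  · obtain ⟨η, h0, h1, h2⟩ := implicit_graph pf px py hd hpy.continuous z hz h
    exact chart_of_graph _ _ (hpy.prodMk hpx.neg) z hz η h0 h1 (h2.mono fun w hw => hw.1)

noncomputable def fib (P : ℂ[X][X]) (x : ℂ) : ℂ[X] := P.map (evalRingHom x)
noncomputable def pfn (P : ℂ[X][X]) (v : ℂ × ℂ) : ℂ := (fib P v.1).eval v.2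

structure Dat where
  P : ℂ[X][X]
  hP : P.Monic
  hirr : Irreducible P
  px : ℂ × ℂ → ℂ
  hpx : Differentiable ℂ px
  hpy : Differentiable ℂ (pfn (derivative P))
  hd : ∀ v, HasStrictFDerivAt (pfn P) (px v • ContinuousLinearMap.fst ℂ ℂ ℂ +
      pfn (derivative P) v • ContinuousLinearMap.snd ℂ ℂ ℂ) v
  hsm : ∀ v, pfn P v = 0 → px v ≠ 0 ∨ pfn (derivative P) v ≠ 0
  T : ℂ × ℂ → ℂ
  hT : ∀ z ∈ {v | pfn P v = 0}, Prim {v | pfn P v = 0} (fun v => (pfn (derivative P) v, -px v)) T z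

namespace Dat
variable (D : Dat)

noncomputable abbrev py : ℂ × ℂ → ℂ := pfn (derivative D.P)
abbrev Z : Set (ℂ × ℂ) := {v | pfn D.P v = 0}
noncomputable abbrev Xf : ℂ × ℂ → ℂ × ℂ := fun v => (D.py v, -D.px v)
noncomputable abbrev N : ℕ := D.P.natDegree

lemma fib_monic (x : ℂ) : (fib D.P x).Monic := D.hP.map _
lemma fib_deg (x : ℂ) : (fib D.P x).natDegree = D.N := D.hP.natDegree_map _

lemma mem_roots (x y : ℂ) : y ∈ (fib D.P x).roots ↔ (x, y) ∈ D.Z := by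
  rw [Polynomial.mem_roots (D.fib_monic x).ne_zero]; rfl

lemma card_roots (x : ℂ) : (fib D.P x).roots.card = D.N := by
  rw [← D.fib_deg x]
  exact (splits_iff_card_roots.1 (IsAlgClosed.splits _))

lemma continuousOn_T : ContinuousOn D.T D.Z := fun z hz => by
  obtain ⟨L, h, _⟩ := D.hT z hz
  exact h.continuousWithinAt

lemma continuous_pf : Continuous (pfn D.P) :=
  continuous_iff_continuousAt.2 fun v => (D.hd v).hasFDerivAt.continuousAt

lemma isClosed_Z : IsClosed D.Z := isClosed_eq D.continuous_pf continuous_const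

lemma PB_y : PB (fun z : D.Z => ‖z.1.1‖) (fun z => ‖z.1.2‖) := by
  have hn : ∀ z : D.Z, 0 ≤ ‖z.1.1‖ := fun z => norm_nonneg _
  refine PB.mono (f := fun z : D.Z => 1 + ∑ i ∈ Finset.range D.N, ‖(D.P.coeff i).eval z.1.1‖) ?_ ?_
  · exact PB.add hn (PB.const 1) (PB.sum hn _ _ fun i _ => PB.eval hn (PB.self hn) _)
  · intro z
    have := monic_root_bound _ D.N (D.fib_deg z.1.1) (D.fib_monic _) z.1.2 z.2
    simpa [fib] using this

lemma isCompact_Z (r : ℝ) : IsCompact (D.Z ∩ {z | ‖z.1‖ ≤ r}) := by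
  refine Metric.isCompact_of_isClosed_isBounded (D.isClosed_Z.inter
    (isClosed_le (continuous_fst.norm) continuous_const)) ?_
  obtain ⟨C, k, hC, h⟩ := D.PB_y
  refine (Metric.isBounded_closedBall (x := (0 : ℂ × ℂ)) (r := max r (C * (1 + r) ^ k))).subset ?_
  rintro z ⟨hz, hr⟩
  rw [mem_closedBall_zero_iff, Prod.norm_def]
  refine max_le_max hr ((h ⟨z, hz⟩).trans ?_)
  simp only [Set.mem_ofPred_eq] at hr
  have := norm_nonneg z.1
  gcongr

lemma T_bdd (r : ℝ) : ∃ M : ℝ, 0 ≤ M ∧ ∀ z ∈ D.Z, ‖z.1‖ ≤ r → ‖D.T z‖ ≤ M := by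
  obtain ⟨M, hM⟩ := (D.isCompact_Z r).exists_bound_of_continuousOn (D.continuousOn_T.mono Set.inter_subset_left)
  exact ⟨max M 0, le_max_right _ _, fun z h1 h2 => (hM z ⟨h1, h2⟩).trans (le_max_left _ _)⟩

lemma sections (x0 : ℂ) (hg : ∀ y, (x0, y) ∈ D.Z → D.py (x0, y) ≠ 0) :
    ∃ (S : Finset ℂ) (η : ℂ → ℂ → ℂ), ∀ᶠ x in 𝓝 x0, (fib D.P x).roots = S.val.map (fun s => η s x) ∧
      ∀ s ∈ S, (x, η s x) ∈ D.Z ∧ D.py (x, η s x) ≠ 0 ∧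
        HasDerivAt (fun x => D.T (x, η s x)) (D.py (x, η s x))⁻¹ x := by
  classical
  set S := (fib D.P x0).roots.toFinset
  have hnd : (fib D.P x0).roots.Nodup := by
    rw [Multiset.nodup_iff_count_le_one]
    intro y
    by_cases hy : y ∈ (fib D.P x0).roots
    · rw [count_roots]
      have h1 := hg y ((D.mem_roots _ _).1 hy)
      refine le_of_not_gt fun hlt => ?_
      rw [one_lt_rootMultiplicity_iff_isRoot (D.fib_monic _).ne_zero] at hlt
      apply h1
      have := hlt.2
      rw [IsRoot, fib, derivative_map] at this
      exact this
    · rw [Multiset.count_eq_zero_of_notMem hy]; omega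
  have hScard : S.card = D.N := by
    rw [Multiset.toFinset_card_of_nodup hnd, D.card_roots]
  have hmem : ∀ s ∈ S, (x0, s) ∈ D.Z := fun s hs => (D.mem_roots _ _).1 (Multiset.mem_toFinset.1 hs)
  have hη : ∀ s, ∃ η : ℂ → ℂ, s ∈ S → η x0 = s ∧ (∀ᶠ x in 𝓝 x0, HasDerivAt η (-D.px (x, η x) / D.py (x, η x)) x ∧
      (x, η x) ∈ D.Z ∧ D.py (x, η x) ≠ 0) := by
    intro s
    by_cases hs : s ∈ S
    · obtain ⟨η, h1, h2, h3⟩ := implicit_graph (pfn D.P) D.px D.py D.hd D.hpy.continuous (x0, s) (hmem s hs) (hg s (hmem s hs))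
      exact ⟨η, fun _ => ⟨h1, h2⟩⟩
    · exact ⟨0, fun h => absurd h hs⟩
  choose η hη using hη
  refine ⟨S, η, ?_⟩
  have hall : ∀ᶠ x in 𝓝 x0, ∀ s ∈ S, HasDerivAt (η s) (-D.px (x, η s x) / D.py (x, η s x)) x ∧
      (x, η s x) ∈ D.Z ∧ D.py (x, η s x) ≠ 0 :=
    (Filter.eventually_all_finset S).2 fun s hs => (hη s hs).2
  have hdist : ∀ᶠ x in 𝓝 x0, ∀ s ∈ S, ∀ t ∈ S, s ≠ t → η s x ≠ η t x := by
    rw [Filter.eventually_all_finset]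
    intro s hs
    rw [Filter.eventually_all_finset]
    intro t ht
    by_cases hst : s = t
    · simp [hst]
    · have c1 := (hη s hs).2.self_of_nhds.1.continuousAt
      have c2 := (hη t ht).2.self_of_nhds.1.continuousAt
      have : η s x0 ≠ η t x0 := by rw [(hη s hs).1, (hη t ht).1]; exact hst
      filter_upwards [(ContinuousAt.ne_iff_eventually_ne c1 c2).1 this] with x hx _ using hx
  filter_upwards [hall.eventually_nhds, hdist] with x h1 h2
  have h1x := h1.self_of_nhds
  refine ⟨?_, fun s hs => ⟨(h1x s hs).2.1, (h1x s hs).2.2, ?_⟩⟩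
  · symm
    refine Multiset.eq_of_le_of_card_le ((Multiset.le_iff_subset ?_).2 ?_) ?_
    · refine (Multiset.nodup_map_iff_inj_on S.nodup).2 ?_
      intro a ha b hb hab
      by_contra hne
      exact h2 a ha b hb hne hab
    · intro y hy
      obtain ⟨s, hs, rfl⟩ := Multiset.mem_map.1 hy
      exact (D.mem_roots _ _).2 (h1x s hs).2.1
    · rw [D.card_roots, Multiset.card_map, Finset.card_val, hScard]
  · have k1 : HasDerivAt (fun x => (x, η s x)) ((D.py (x, η s x))⁻¹ • D.Xf (x, η s x)) x := by
      refine ((hasDerivAt_id x).prodMk (h1x s hs).1).congr_deriv ?_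
      have := (h1x s hs).2.2
      ext
      · simp [this]
      · simp [div_eq_inv_mul]
    exact Prim.comp_curve (Z := D.Z) (Xf := D.Xf) (γ := fun x => (x, η s x)) k1 (h1.mono fun x' hx' => (hx' s hs).2.1)
      (D.hT _ (h1x s hs).2.1)
end Dat
end AMS

end

section
namespace AMS
set_option linter.unusedSectionVars false
set_option linter.unusedVariables false
open Topology Filter Polynomial

lemma poly_lower (d : ℂ[X]) (hd : d ≠ 0) : ∃ R δ : ℝ, 1 ≤ R ∧ 0 < δ ∧ ∀ x : ℂ, R ≤ ‖x‖ → δ ≤ ‖d.eval x‖ := by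
  by_cases h : 0 < d.degree
  · have h1 : Tendsto (fun x : ℂ => ‖d.eval x‖) (comap (fun x : ℂ => ‖x‖) atTop) atTop :=
      d.tendsto_norm_atTop h tendsto_comap
    have h2 := h1.eventually (eventually_ge_atTop 1)
    rw [Filter.eventually_comap, Filter.eventually_atTop] at h2
    obtain ⟨R, hR⟩ := h2
    exact ⟨max R 1, 1, le_max_right _ _, one_pos, fun x hx => hR ‖x‖ ((le_max_left _ _).trans hx) x rfl⟩
  · rw [eq_C_of_degree_le_zero (not_lt.1 h)] at hd ⊢
    refine ⟨1, ‖d.coeff 0‖, le_rfl, ?_, fun x _ => by simp⟩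
    rw [norm_pos_iff]
    intro h0
    simp [h0] at hd

namespace Dat
variable (D : Dat)

lemma disc : ∃ (b : ℂ[X][X]) (d : ℂ[X]), d ≠ 0 ∧ ∀ z ∈ D.Z, pfn b z * D.py z = d.eval z.1 := by
  obtain ⟨a, b, d, hd, h⟩ := bezout D.P D.hP D.hirr
  refine ⟨b, d, hd, fun z hz => ?_⟩
  have := congrArg (fun Q : ℂ[X][X] => (Q.map (evalRingHom z.1)).eval z.2) h
  simp only [Polynomial.map_add, Polynomial.map_mul, eval_add, eval_mul, map_C, eval_C, coe_evalRingHom] at this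
  rw [show eval z.2 (Polynomial.map (evalRingHom z.1) D.P) = 0 from hz, mul_zero, zero_add] at this
  exact this

lemma inv_bound : ∃ (R C : ℝ) (k : ℕ), 1 ≤ R ∧ 0 ≤ C ∧ ∀ z ∈ D.Z, R ≤ ‖z.1‖ → D.py z ≠ 0 ∧
    ‖(D.py z)⁻¹‖ ≤ C * (1 + ‖z.1‖) ^ k := by
  obtain ⟨b, d, hd, h⟩ := D.disc
  obtain ⟨R, δ, hR, hδ, hlow⟩ := poly_lower d hd
  have hn : ∀ z : D.Z, 0 ≤ ‖z.1.1‖ := fun z => norm_nonneg _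
  obtain ⟨C, k, hC, hb⟩ := PB.evalEval hn (PB.self hn) D.PB_y b
  refine ⟨R, C / δ, k, hR, by positivity, fun z hz hzR => ?_⟩
  have h1 := h z hz
  have h2 := hlow _ hzR
  have h3 : d.eval z.1 ≠ 0 := by
    intro h0; rw [h0, norm_zero] at h2; linarith
  have h4 : D.py z ≠ 0 := by
    intro h0; rw [h0, mul_zero] at h1; exact h3 h1.symm
  refine ⟨h4, ?_⟩
  have h5 : (D.py z)⁻¹ = pfn b z / d.eval z.1 := by
    rw [← h1]
    have : pfn b z ≠ 0 := by
      intro h0; rw [h0, zero_mul] at h1; exact h3 h1.symm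
    field_simp
  rw [h5, norm_div, div_mul_eq_mul_div]
  gcongr
  exact hb ⟨z, hz⟩

noncomputable def Psi (x : ℂ) : ℝ := Real.sqrt (1 + ((fib D.P x).roots.map (fun y => ‖D.T (x, y)‖ ^ 2)).sum)

lemma sum_nonneg' (x : ℂ) : 0 ≤ ((fib D.P x).roots.map (fun y => ‖D.T (x, y)‖ ^ 2)).sum :=
  Multiset.sum_nonneg fun a ha => by
    obtain ⟨y, _, rfl⟩ := Multiset.mem_map.1 ha
    positivity

lemma T_le_Psi (z : ℂ × ℂ) (hz : z ∈ D.Z) : ‖D.T z‖ ≤ D.Psi z.1 := by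
  have hy : z.2 ∈ (fib D.P z.1).roots := (D.mem_roots _ _).2 hz
  apply Real.le_sqrt_of_sq_le
  have := Multiset.single_le_sum (s := (fib D.P z.1).roots.map (fun y => ‖D.T (z.1, y)‖ ^ 2))
    (fun a ha => by
      obtain ⟨y, _, rfl⟩ := Multiset.mem_map.1 ha
      positivity) (‖D.T (z.1, z.2)‖ ^ 2) (Multiset.mem_map_of_mem _ hy)
  simp only [Prod.mk.eta] at this
  linarith

lemma Psi_le (x : ℂ) (M : ℝ) (hM0 : 0 ≤ M) (hM : ∀ y, (x, y) ∈ D.Z → ‖D.T (x, y)‖ ≤ M) :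
    D.Psi x ≤ 1 + D.N * M ^ 2 := by
  have h1 : ((fib D.P x).roots.map (fun y => ‖D.T (x, y)‖ ^ 2)).sum ≤ D.N * M ^ 2 := by
    have := Multiset.sum_le_card_nsmul ((fib D.P x).roots.map (fun y => ‖D.T (x, y)‖ ^ 2)) (M ^ 2) (fun a ha => by
      obtain ⟨y, hy, rfl⟩ := Multiset.mem_map.1 ha
      have := hM y ((D.mem_roots _ _).1 hy)
      gcongr)
    rwa [Multiset.card_map, D.card_roots, nsmul_eq_mul] at this
  refine Real.sqrt_le_iff.2 ⟨by positivity, ?_⟩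
  nlinarith [show 0 ≤ (D.N : ℝ) * M ^ 2 by positivity]

lemma Psi_deriv (R C : ℝ) (k : ℕ) (hC : 0 ≤ C) (h : ∀ z ∈ D.Z, R ≤ ‖z.1‖ → D.py z ≠ 0 ∧
    ‖(D.py z)⁻¹‖ ≤ C * (1 + ‖z.1‖) ^ k) (θ : ℂ) (hθ : ‖θ‖ = 1) (t : ℝ) (ht0 : 0 ≤ t) (ht : R ≤ t) :
    ∃ e : ℝ, HasDerivAt (fun t : ℝ => D.Psi (t * θ)) e t ∧ ‖e‖ ≤ D.N * (C * (1 + t) ^ k) := by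
  have hnt : ‖(t : ℂ) * θ‖ = t := by rw [norm_mul, hθ, mul_one, Complex.norm_real, Real.norm_of_nonneg ht0]
  obtain ⟨S, η, hS⟩ := D.sections (t * θ) (fun y hy => (h _ hy (by simpa only [hnt] using ht)).1)
  have hcont : Tendsto (fun t : ℝ => (t : ℂ) * θ) (𝓝 t) (𝓝 (t * θ)) :=
    (Complex.continuous_ofReal.mul continuous_const).tendsto t
  set u : ℂ → ℝ → ℂ := fun s t => D.T (t * θ, η s (t * θ)) with hu
  have hS0 := hS.self_of_nhds
  have heq : ∀ᶠ t' : ℝ in 𝓝 t, D.Psi (t' * θ) = Real.sqrt (1 + ∑ s ∈ S, ‖u s t'‖ ^ 2) := by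
    filter_upwards [hcont.eventually hS] with t' ht'
    rw [Psi, ht'.1, Multiset.map_map]
    rfl
  have hcard : S.card = D.N := by
    rw [← D.card_roots (t * θ), hS0.1, Multiset.card_map]; rfl
  have hud : ∀ s ∈ S, HasDerivAt (u s) ((D.py (t * θ, η s (t * θ)))⁻¹ * θ) t := by
    intro s hs
    have h1 := (hS0.2 s hs).2.2
    have h2 : HasDerivAt (fun z : ℂ => z * θ) θ (t : ℂ) := by simpa using (hasDerivAt_id (t : ℂ)).mul_const θ
    have h3 := HasDerivAt.comp (t : ℂ) h1 h2
    exact h3.comp_ofReal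
  have hsum : HasDerivAt (fun t' => 1 + ∑ s ∈ S, ‖u s t'‖ ^ 2)
      (∑ s ∈ S, 2 * inner ℝ (u s t) ((D.py (t * θ, η s (t * θ)))⁻¹ * θ)) t := by
    refine HasDerivAt.const_add 1 ?_
    exact HasDerivAt.fun_sum fun s hs => (hud s hs).norm_sq
  have hpos : 0 < 1 + ∑ s ∈ S, ‖u s t‖ ^ 2 := by positivity
  have hsq := hsum.sqrt hpos.ne'
  refine ⟨_, hsq.congr_of_eventuallyEq heq, ?_⟩
  set Q := Real.sqrt (1 + ∑ s ∈ S, ‖u s t‖ ^ 2) with hQ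
  have hQpos : 0 < Q := Real.sqrt_pos.2 hpos
  have hle : ∀ s ∈ S, ‖u s t‖ ≤ Q := by
    intro s hs
    apply Real.le_sqrt_of_sq_le
    have := Finset.single_le_sum (f := fun s => ‖u s t‖ ^ 2) (fun i _ => by positivity) hs
    linarith
  rw [norm_div, Real.norm_of_nonneg (by positivity : 0 ≤ 2 * Q), div_le_iff₀ (by positivity)]
  calc ‖∑ s ∈ S, 2 * inner ℝ (u s t) ((D.py (t * θ, η s (t * θ)))⁻¹ * θ)‖
      ≤ ∑ s ∈ S, 2 * (Q * (C * (1 + t) ^ k)) := by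
        refine norm_sum_le_of_le _ fun s hs => ?_
        rw [norm_mul, Real.norm_of_nonneg (by norm_num : (0:ℝ) ≤ 2)]
        gcongr
        refine (norm_inner_le_norm _ _).trans ?_
        have h2 := (h _ (hS0.2 s hs).1 (by simpa only [hnt] using ht)).2
        simp only [hnt] at h2
        rw [norm_mul, hθ, mul_one]
        exact mul_le_mul (hle s hs) h2 (norm_nonneg _) hQpos.le
    _ = _ := by rw [Finset.sum_const, hcard, nsmul_eq_mul]; ring

lemma PB_T : PB (fun z : D.Z => ‖z.1.1‖) (fun z => ‖D.T z‖) := by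
  obtain ⟨R, C, k, hR, hC, h⟩ := D.inv_bound
  obtain ⟨M, hM0, hM⟩ := D.T_bdd R
  have hn : ∀ z : D.Z, 0 ≤ ‖z.1.1‖ := fun z => norm_nonneg _
  refine PB.mono (f := fun z : D.Z => (M + (1 + D.N * M ^ 2)) + D.N * (C * (1 + ‖z.1.1‖) ^ k) * ‖z.1.1‖) ?_ ?_
  · refine PB.add hn (PB.const _) (PB.mul hn (PB.mul hn (PB.const _) ⟨C, k, hC, fun _ => le_rfl⟩
      (fun a => ?_)) (PB.self hn) hn)
    positivity
  · rintro ⟨z, hz⟩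
    simp only
    by_cases hzR : ‖z.1‖ ≤ R
    · have := hM z hz hzR
      have h2 : 0 ≤ D.N * (C * (1 + ‖z.1‖) ^ k) * ‖z.1‖ := by positivity
      have h3 : 0 ≤ D.N * M ^ 2 := by positivity
      linarith
    · push Not at hzR
      set r := ‖z.1‖
      have hr0 : 0 < r := by linarith
      set θ : ℂ := z.1 / r
      have hrc : (r : ℂ) ≠ 0 := by exact_mod_cast hr0.ne'
      have hθ : ‖θ‖ = 1 := by
        rw [norm_div, Complex.norm_real, Real.norm_of_nonneg hr0.le]; exact div_self hr0.ne'
      have hzθ : z.1 = r * θ := by rw [mul_div_cancel₀ _ hrc]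
      choose! e he1 he2 using fun t (ht : R ≤ t) => D.Psi_deriv R C k hC h θ hθ t (by linarith) ht
      have hmv := (convex_Icc R r).norm_image_sub_le_of_norm_hasDerivWithin_le
        (f := fun t : ℝ => D.Psi (t * θ)) (f' := e) (C := D.N * (C * (1 + r) ^ k))
        (fun t ht => (he1 t ht.1).hasDerivWithinAt)
        (fun t ht => (he2 t ht.1).trans (by
          have : 0 ≤ 1 + t := by linarith [ht.1]
          have := ht.2
          gcongr)) ⟨le_rfl, hzR.le⟩ ⟨hzR.le, le_rfl⟩
      have hPR : D.Psi (R * θ) ≤ 1 + D.N * M ^ 2 := by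
        refine D.Psi_le _ M hM0 fun y hy => hM _ hy ?_
        simp only
        rw [norm_mul, hθ, mul_one, Complex.norm_real, Real.norm_of_nonneg (by linarith)]
      have h1 := D.T_le_Psi z hz
      rw [hzθ] at h1
      rw [Real.norm_eq_abs, Real.norm_of_nonneg (by linarith : 0 ≤ r - R)] at hmv
      have h2 := (le_abs_self _).trans hmv
      have h3 : D.N * (C * (1 + r) ^ k) * (r - R) ≤ D.N * (C * (1 + r) ^ k) * r := by
        gcongr; linarith
      linarith
end Dat
end AMS

end

section
namespace AMS
set_option linter.unusedSectionVars false
set_option linter.unusedVariables false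
open Topology Filter Polynomial

lemma coeff_prod_bound (M : ℝ) (hM : 0 ≤ M) (s : Multiset ℂ) (hs : ∀ u ∈ s, ‖u‖ ≤ M) :
    ∀ i, ‖((s.map (fun u => X - C u)).prod).coeff i‖ ≤ (1 + M) ^ s.card := by
  induction s using Multiset.induction_on with
  | empty =>
    intro i
    simp only [Multiset.map_zero, Multiset.prod_zero, Multiset.card_zero, pow_zero, coeff_one]
    split_ifs <;> simp
  | cons u s ih =>
    intro i
    have ih' := ih fun v hv => hs v (Multiset.mem_cons_of_mem hv)
    have hu := hs u (Multiset.mem_cons_self _ _)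
    set Q := (s.map (fun u => X - C u)).prod
    rw [Multiset.map_cons, Multiset.prod_cons, Multiset.card_cons, sub_mul, coeff_sub, coeff_C_mul]
    have h1 : ‖(X * Q).coeff i‖ ≤ (1 + M) ^ s.card := by
      rcases i with _ | i
      · simp; positivity
      · rw [coeff_X_mul]; exact ih' i
    calc ‖(X * Q).coeff i - u * Q.coeff i‖ ≤ ‖(X * Q).coeff i‖ + ‖u * Q.coeff i‖ := norm_sub_le _ _
      _ ≤ (1 + M) ^ s.card + M * (1 + M) ^ s.card := by
        rw [norm_mul]
        exact add_le_add h1 (mul_le_mul hu (ih' i) (norm_nonneg _) hM)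
      _ = _ := by ring

lemma diff_coeff_mul {A B : ℂ → ℂ[X]} {x : ℂ} (hA : ∀ i, DifferentiableAt ℂ (fun x => (A x).coeff i) x)
    (hB : ∀ i, DifferentiableAt ℂ (fun x => (B x).coeff i) x) (i : ℕ) :
    DifferentiableAt ℂ (fun x => (A x * B x).coeff i) x := by
  simp only [coeff_mul]
  exact DifferentiableAt.fun_sum fun p _ => (hA p.1).mul (hB p.2)

lemma diff_coeff_prod (S : Finset ℂ) (u : ℂ → ℂ → ℂ) (x : ℂ) (hu : ∀ s ∈ S, DifferentiableAt ℂ (u s) x) :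
    ∀ i, DifferentiableAt ℂ (fun x => (∏ s ∈ S, (X - C (u s x))).coeff i) x := by
  classical
  induction S using Finset.induction_on with
  | empty => intro i; simp
  | insert a S ha ih =>
    simp only [Finset.prod_insert ha]
    refine diff_coeff_mul ?_ (ih fun s hs => hu s (by simp [hs]))
    intro i
    simp only [coeff_sub, coeff_X, coeff_C]
    split_ifs
    all_goals first
      | exact (differentiableAt_const _).sub (hu a (by simp))
      | exact (differentiableAt_const _).sub (differentiableAt_const _)

namespace Dat
variable (D : Dat)

noncomputable def Pol (x : ℂ) : ℂ[X] := ((fib D.P x).roots.map (fun y => X - C (D.T (x, y)))).prod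

lemma Pol_eq (x : ℂ) : D.Pol x = (((fib D.P x).roots.map (fun y => D.T (x, y))).map (fun u => X - C u)).prod := by
  rw [Multiset.map_map]; rfl

lemma Pol_monic (x : ℂ) : (D.Pol x).Monic := by
  rw [Pol_eq]; exact monic_multiset_prod_of_monic _ _ fun a _ => monic_X_sub_C a

lemma Pol_deg (x : ℂ) : (D.Pol x).natDegree = D.N := by
  rw [Pol_eq, natDegree_multiset_prod_X_sub_C_eq_card, Multiset.card_map, D.card_roots]

lemma Pol_root (z : ℂ × ℂ) (hz : z ∈ D.Z) : (D.Pol z.1).eval (D.T z) = 0 := by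
  rw [Pol, eval_multiset_prod, Multiset.map_map]
  apply Multiset.prod_eq_zero
  refine Multiset.mem_map.2 ⟨z.2, (D.mem_roots _ _).2 hz, by simp⟩

lemma Pol_coeff_bound (x : ℂ) (M : ℝ) (hM0 : 0 ≤ M) (hM : ∀ y, (x, y) ∈ D.Z → ‖D.T (x, y)‖ ≤ M) (i : ℕ) :
    ‖(D.Pol x).coeff i‖ ≤ (1 + M) ^ D.N := by
  rw [Pol_eq]
  have := coeff_prod_bound M hM0 ((fib D.P x).roots.map (fun y => D.T (x, y))) (fun u hu => by
    obtain ⟨y, hy, rfl⟩ := Multiset.mem_map.1 hu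
    exact hM y ((D.mem_roots _ _).1 hy)) i
  rwa [Multiset.card_map, D.card_roots] at this

lemma relation : ∃ G : ℂ[X][X], G ≠ 0 ∧ ∀ z ∈ D.Z, pfn G (z.1, D.T z) = 0 := by
  obtain ⟨b, d, hd, hdisc⟩ := D.disc
  have hgood : ∀ x, d.eval x ≠ 0 → ∀ y, (x, y) ∈ D.Z → D.py (x, y) ≠ 0 := by
    intro x hx y hy h0
    have := hdisc _ hy
    rw [h0, mul_zero] at this
    exact hx this.symm
  have hdiff : ∀ i, Differentiable ℂ (fun x => d.eval x ^ 2 * (D.Pol x).coeff i) := by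
    intro i x0
    by_cases hx0 : d.eval x0 = 0
    · obtain ⟨M, hM0, hM⟩ := D.T_bdd (‖x0‖ + 1)
      have hb : ∀ᶠ x in 𝓝 x0, ‖(D.Pol x).coeff i‖ ≤ (1 + M) ^ D.N := by
        filter_upwards [Metric.ball_mem_nhds x0 one_pos] with x hx
        refine D.Pol_coeff_bound x M hM0 (fun y hy => hM _ hy ?_) i
        rw [mem_ball_iff_norm] at hx
        have := norm_add_le (x - x0) x0
        simp at this ⊢
        linarith
      have hO1 : (fun x => (D.Pol x).coeff i) =O[𝓝 x0] (fun _ => (1 : ℝ)) :=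
        Asymptotics.IsBigO.of_bound _ (hb.mono fun x hx => by simpa using hx)
      have hO2 : (fun x => d.eval x) =O[𝓝 x0] (fun x => x - x0) := by
        have := (d.differentiable x0).isBigO_sub
        simpa [hx0] using this
      have hO3 : (fun x => d.eval x) =o[𝓝 x0] (fun _ => (1:ℝ)) := by
        rw [Asymptotics.isLittleO_one_iff]
        have := d.continuous.tendsto x0
        rwa [hx0] at this
      have hO4 : (fun x => d.eval x ^ 2 * (D.Pol x).coeff i) =o[𝓝 x0] (fun x => x - x0) := by
        have h1 := (hO3.mul_isBigO hO1).mul_isBigO hO2.norm_right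
        simp only [one_mul] at h1
        have h2 := h1.norm_right.of_norm_right
        refine (h1.congr_left (fun x => ?_)).of_norm_right
        ring
      have : HasDerivAt (fun x => d.eval x ^ 2 * (D.Pol x).coeff i) 0 x0 := by
        rw [hasDerivAt_iff_isLittleO]
        simpa [hx0] using hO4
      exact this.differentiableAt
    · obtain ⟨S, η, hS⟩ := D.sections x0 (hgood x0 hx0)
      refine ((d.differentiable x0).pow 2).mul ?_
      have heq : (fun x => (D.Pol x).coeff i) =ᶠ[𝓝 x0]
          (fun x => (∏ s ∈ S, (X - C ((fun s x => D.T (x, η s x)) s x))).coeff i) := by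
        filter_upwards [hS] with x hx
        rw [Pol, hx.1, Multiset.map_map]
        rfl
      refine DifferentiableAt.congr_of_eventuallyEq ?_ heq
      exact diff_coeff_prod S (fun s x => D.T (x, η s x)) x0 (fun s hs => (hS.self_of_nhds.2 s hs).2.2.differentiableAt) i
  have hpb : ∀ i, PB (fun x : ℂ => ‖x‖) (fun x => ‖d.eval x ^ 2 * (D.Pol x).coeff i‖) := by
    intro i
    have hn : ∀ x : ℂ, 0 ≤ ‖x‖ := fun x => norm_nonneg _
    obtain ⟨A, k, hA, hk⟩ := D.PB_T
    simp only [norm_mul, norm_pow]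
    refine PB.mul hn (PB.pow hn (PB.eval hn (PB.self hn) d) (fun x => norm_nonneg _) 2)
      (PB.mono (f := fun x => (1 + A * (1 + ‖x‖) ^ k) ^ D.N) ?_ ?_) (fun x => norm_nonneg _)
    · refine PB.pow hn (PB.add hn (PB.const 1) ⟨A, k, hA, fun _ => le_rfl⟩) (fun x => by positivity) _
    · intro x
      exact D.Pol_coeff_bound x _ (by positivity) (fun y hy => hk ⟨_, hy⟩) i
  choose q hq using fun i => entire_poly _ (hdiff i) (hpb i)
  refine ⟨∑ i ∈ Finset.range (D.N + 1), C (q i) * X ^ i, ?_, fun z hz => ?_⟩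
  · intro h0
    have h1 := congrArg (fun Q : ℂ[X][X] => Q.coeff D.N) h0
    simp only [finsetSum_coeff, coeff_C_mul_X_pow, coeff_zero] at h1
    rw [Finset.sum_ite_eq] at h1
    simp only [Finset.mem_range, Nat.lt_succ_self, if_true] at h1
    apply hd
    have h2 : ∀ x, d.eval x ^ 2 = 0 := by
      intro x
      have := hq D.N x
      rw [h1, ← D.Pol_deg x, (D.Pol_monic x).coeff_natDegree] at this
      simpa using this
    refine Polynomial.funext fun x => ?_
    simpa using h2 x
  · have h1 := D.Pol_root z hz
    rw [eval_eq_sum_range, D.Pol_deg] at h1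
    simp only [pfn, fib, Polynomial.map_sum, eval_finsetSum, Polynomial.map_mul, map_C, Polynomial.map_pow, map_X,
      eval_mul, eval_C, eval_pow, eval_X, coe_evalRingHom, ← hq]
    simp only [mul_assoc, ← Finset.mul_sum]
    rw [h1, mul_zero]
end Dat
end AMS

end

section
namespace AMS
set_option linter.unusedSectionVars false
set_option linter.unusedVariables false
open Topology Filter Polynomial

lemma connected_end (ρ : ℝ) : IsPreconnected {w : ℂ | ρ < ‖w‖} := by
  rcases lt_or_ge ρ 0 with h | h
  · have : {w : ℂ | ρ < ‖w‖} = Set.univ := by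
      ext w; simp [h.trans_le (norm_nonneg w)]
    rw [this]; exact isPreconnected_univ
  · have h1 : IsPreconnected (Set.Ioi ρ ×ˢ (Metric.sphere (0:ℂ) 1)) :=
      isPreconnected_Ioi.prod (isPreconnected_sphere (by rw [Complex.rank_real_complex]; norm_num) _ _)
    have h2 := h1.image (fun q : ℝ × ℂ => (q.1 : ℂ) * q.2) (by fun_prop)
    convert h2 using 1
    ext w
    simp only [Set.mem_ofPred_eq, Set.mem_image, Set.mem_prod, Set.mem_Ioi, mem_sphere_zero_iff_norm, Prod.exists]
    constructor
    · intro hw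
      have : (‖w‖ : ℂ) ≠ 0 := by
        have := h.trans_lt hw
        exact_mod_cast this.ne'
      refine ⟨‖w‖, w / ‖w‖, ⟨hw, ?_⟩, by field_simp⟩
      have := h.trans_lt hw
      rw [norm_div, Complex.norm_real, norm_norm, div_self this.ne']
    · rintro ⟨a, b, ⟨h3, h4⟩, rfl⟩
      rw [norm_mul, h4, Complex.norm_real, mul_one]
      exact h3.trans_le (le_abs_self a)

lemma topo_section (f : ℂ → ℂ) (hf : IsLocalHomeomorph f) (A : Set ℂ) (hA : A.Finite)
    (hK : ∀ K : Set ℂ, IsCompact K → Disjoint K A → IsCompact (f ⁻¹' K)) :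
    ∃ σ : ℂ → ℂ, Continuous σ ∧ ∀ s, f (σ s) = s := by
  have hfc := hf.continuous
  have hcon : IsConnected Aᶜ :=
    hA.countable.isConnected_compl_of_one_lt_rank (by rw [Complex.rank_real_complex]; norm_num)
  -- Aᶜ ⊆ range
  have hsub : Aᶜ ⊆ Set.range f := by
    refine hcon.isPreconnected.subset_of_closure_inter_subset hf.isOpenMap.isOpen_range ?_ ?_
    · by_contra hemp
      rw [Set.not_nonempty_iff_eq_empty] at hemp
      have hr : (Set.range f) ⊆ A := by
        intro v hv
        by_contra hvA
        have : v ∈ Aᶜ ∩ Set.range f := ⟨hvA, hv⟩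
        rw [hemp] at this; exact this
      have h1 : (Set.range f).Finite := hA.subset hr
      have h2 : IsOpen (Set.range f) := hf.isOpenMap.isOpen_range
      have := (infinite_of_mem_nhds (f 0) (h2.mem_nhds ⟨0, rfl⟩))
      exact this h1
    · rintro v ⟨hv, hvA⟩
      obtain ⟨ε, hε, hb⟩ := Metric.nhds_basis_closedBall.mem_iff.1 (hA.isClosed.isOpen_compl.mem_nhds hvA)
      have hcomp := hK _ (isCompact_closedBall v ε) (Set.disjoint_left.2 fun w hw => hb hw)
      have h3 : IsClosed (f '' (f ⁻¹' Metric.closedBall v ε)) := (hcomp.image hfc).isClosed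
      rw [Set.image_preimage_eq_inter_range] at h3
      have : v ∈ closure (Metric.closedBall v ε ∩ Set.range f) := by
        rw [mem_closure_iff_nhds] at hv ⊢
        intro t ht
        obtain ⟨w, hw⟩ := hv _ (Filter.inter_mem ht (Metric.closedBall_mem_nhds v hε))
        exact ⟨w, hw.1.1, hw.1.2, hw.2⟩
      rw [h3.closure_eq] at this
      exact this.2
  obtain ⟨M, hM⟩ := hA.isBounded.exists_norm_le
  have hend : Tendsto f (cocompact ℂ) (cocompact ℂ) := by
    rw [← Metric.cobounded_eq_cocompact, Filter.hasBasis_cobounded_norm.tendsto_iff Filter.hasBasis_cobounded_norm]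
    intro R0 _
    set R := max R0 (max M 0 + 1) with hR
    have hRM : M < R := lt_of_lt_of_le (by linarith [le_max_left M 0]) (le_max_right _ _)
    have hR0 : 0 < R := lt_of_lt_of_le (by linarith [le_max_right M 0]) (le_max_right _ _)
    have hc := hK (Metric.sphere 0 R) (isCompact_sphere _ _) (Set.disjoint_left.2 fun w hw hwA => by
      have := hM w hwA
      rw [mem_sphere_zero_iff_norm] at hw
      linarith)
    obtain ⟨ρ, hρ⟩ := hc.isBounded.exists_norm_le
    have hpre := (connected_end ρ).image (fun w => ‖f w‖) hfc.norm.continuousOn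
    have hne : ∀ w, ρ < ‖w‖ → ‖f w‖ ≠ R := fun w hw h => by
      have := hρ w (by simpa using h)
      linarith
    have hbig : ∃ w, ρ < ‖w‖ ∧ R < ‖f w‖ := by
      obtain ⟨B, hB⟩ := ((isCompact_closedBall (0:ℂ) ρ).image hfc).isBounded.exists_norm_le
      have hv : ((max R B + 1 : ℝ) : ℂ) ∈ Aᶜ := fun hvA => by
        have := hM _ hvA
        rw [Complex.norm_real] at this
        have := (le_abs_self _).trans this
        linarith [le_max_left R B]
      obtain ⟨w, hw⟩ := hsub hv
      have hn : max R B + 1 ≤ ‖f w‖ := by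
        rw [hw, Complex.norm_real]; exact le_abs_self _
      refine ⟨w, ?_, by linarith [le_max_left R B]⟩
      by_contra hle
      have := hB (f w) ⟨w, by simpa using hle, rfl⟩
      linarith [le_max_right R B]
    obtain ⟨w0, hw0, hw0'⟩ := hbig
    refine ⟨ρ + 1, trivial, fun w hw => ?_⟩
    have hw' : ρ < ‖w‖ := by
      have : ρ + 1 ≤ ‖w‖ := hw
      linarith
    show R0 ≤ ‖f w‖
    by_contra hlt
    push Not at hlt
    have hlt' : ‖f w‖ ≤ R := hlt.le.trans (le_max_left _ _)
    obtain ⟨u, hu, hu'⟩ := hpre.Icc_subset ⟨w, hw', rfl⟩ ⟨w0, hw0, rfl⟩ ⟨hlt', hw0'.le⟩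
    exact hne u hu hu'
  have hprop : IsProperMap f := isProperMap_iff_tendsto_cocompact.2 ⟨hfc, hend⟩
  have hfin : ∀ x ∈ (Set.univ : Set ℂ), (f ⁻¹' {x}).Finite := by
    intro x _
    have hc : IsCompact (f ⁻¹' {x}) := hprop.isCompact_preimage isCompact_singleton
    refine hc.finite ?_
    rw [isDiscrete_iff_discreteTopology, discreteTopology_subtype_iff']
    intro w hw
    obtain ⟨e, he, rfl⟩ := hf w
    refine ⟨e.source, e.open_source, ?_⟩
    ext u
    constructor
    · rintro ⟨h1, h2⟩
      exact e.injOn h1 he ((show e u = x from h2).trans (show e w = x from hw).symm)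
    · rintro rfl; exact ⟨he, hw⟩
  have hcov : IsCoveringMap f := by
    rw [isCoveringMap_iff_isCoveringMapOn_univ]
    exact hprop.isClosedMap.isCoveringMapOn_of_isLocalHomeomorphOn hfin (fun x _ => hf x)
  have : ∃ z, z ∈ Aᶜ := hcon.nonempty
  obtain ⟨a0, ha0⟩ := this
  obtain ⟨e0, he0⟩ := hsub ha0
  obtain ⟨σ, ⟨_, hσ⟩, _⟩ := hcov.existsUnique_continuousMap_lifts (ContinuousMap.id ℂ) a0 e0 (by simpa using he0)
  exact ⟨σ, σ.continuous, fun s => congrFun hσ s⟩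

namespace Dat
variable (D : Dat)

lemma local_inv (z : ℂ × ℂ) (hz : z ∈ D.Z) : ∃ γ : ℂ → ℂ × ℂ, γ (D.T z) = z ∧
    (∀ᶠ t in 𝓝 (D.T z), γ t ∈ D.Z ∧ HasDerivAt γ (D.Xf (γ t)) t ∧ D.T (γ t) = t) ∧
    ∀ᶠ z' in 𝓝[D.Z] z, γ (D.T z') = z' := by
  obtain ⟨γ, T0, s0, h1, h2, h3, h4, h5⟩ := charts _ D.px D.py D.hd D.hpx D.hpy D.hsm z hz
  obtain ⟨c, hc⟩ := Prim.chart_const (T := D.T) (h3.mono fun s hs => ⟨hs.1, hs.2.1⟩)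
    (h3.mono fun s hs => D.hT _ hs.1)
  have hTz : D.T z = s0 + c := by
    have := hc.self_of_nhds
    rwa [h1] at this
  have hs0 : D.T z - c = s0 := by rw [hTz]; ring
  refine ⟨fun t => γ (t - c), by simp only [hs0, h1], ?_, ?_⟩
  · have ht : Tendsto (fun t => t - c) (𝓝 (D.T z)) (𝓝 s0) := by
      have : Continuous fun t : ℂ => t - c := by fun_prop
      simpa [hs0] using this.tendsto (D.T z)
    filter_upwards [ht.eventually (h3.and hc)] with t hts
    refine ⟨hts.1.1, ?_, by rw [hts.2]; ring⟩
    exact hts.1.2.1.comp_sub_const t c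
  · obtain ⟨L, hL, _⟩ := h5.self_of_nhdsWithin hz
    have hcT : Tendsto T0 (𝓝[D.Z] z) (𝓝 s0) := by
      have := hL.continuousWithinAt.tendsto
      rwa [h2] at this
    filter_upwards [h4, hcT.eventually hc] with z' h6 h7
    rw [h6] at h7
    have : D.T z' - c = T0 z' := by rw [h7]; ring
    show γ (D.T z' - c) = z'
    rw [this, h6]

lemma isLocalHomeo (h : D.Z ≃ₜ ℂ) : IsLocalHomeomorph (fun w => D.T (h.symm w : ℂ × ℂ)) := by
  set f : ℂ → ℂ := fun w => D.T (h.symm w : ℂ × ℂ) with hf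
  have hk : Continuous (fun w => (h.symm w : ℂ × ℂ)) := continuous_subtype_val.comp h.symm.continuous
  have hfc : Continuous f := D.continuousOn_T.comp_continuous hk (fun w => (h.symm w).2)
  have hopen : IsOpenMap f := by
    rw [isOpenMap_iff_nhds_le]
    intro w
    obtain ⟨γ, h1, h2, h3⟩ := D.local_inv _ (h.symm w).2
    intro U hU
    rw [Filter.mem_map] at hU
    -- g t = h (γ t)
    have hγ : Tendsto γ (𝓝 (f w)) (𝓝[D.Z] (h.symm w : ℂ × ℂ)) := by
      refine tendsto_nhdsWithin_iff.2 ⟨?_, h2.mono fun s hs => hs.1⟩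
      have := h2.self_of_nhds.2.1.continuousAt.tendsto
      rwa [h1] at this
    have hm : ∀ᶠ z in 𝓝[D.Z] (h.symm w : ℂ × ℂ), ∀ hz : z ∈ D.Z, f (h ⟨z, hz⟩) ∈ U := by
      rw [nhdsWithin_eq_map_subtype_coe (h.symm w).2, Filter.eventually_map]
      have : Tendsto h (𝓝 (h.symm w)) (𝓝 w) := by simpa using h.continuous.tendsto (h.symm w)
      exact (this.eventually hU).mono fun z hz _ => hz
    filter_upwards [hγ.eventually hm, h2] with t h4 h5
    have := h4 h5.1
    simp only [hf, Homeomorph.symm_apply_apply, h5.2.2] at this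
    exact this
  rw [isLocalHomeomorph_iff_isOpenEmbedding_restrict]
  intro w
  obtain ⟨γ, h1, h2, h3⟩ := D.local_inv _ (h.symm w).2
  have hkt : Tendsto (fun w => (h.symm w : ℂ × ℂ)) (𝓝 w) (𝓝[D.Z] (h.symm w : ℂ × ℂ)) :=
    tendsto_nhdsWithin_iff.2 ⟨hk.tendsto w, Eventually.of_forall fun w => (h.symm w).2⟩
  obtain ⟨U, hU, hUo, hwU⟩ := eventually_nhds_iff.1 (hkt.eventually h3)
  refine ⟨U, hUo.mem_nhds hwU, ?_⟩
  refine IsOpenEmbedding.of_continuous_injective_isOpenMap (hfc.comp continuous_subtype_val) ?_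
    (hopen.comp hUo.isOpenMap_subtype_val)
  rintro ⟨a, ha⟩ ⟨b, hb⟩ hab
  have e1 := hU a ha
  have e2 := hU b hb
  have hab' : D.T (h.symm a : ℂ × ℂ) = D.T (h.symm b : ℂ × ℂ) := hab
  rw [hab', e2] at e1
  exact Subtype.ext (h.symm.injective (Subtype.ext e1.symm))

lemma x_bound : ∃ (a : ℂ[X]) (M : ℕ) (c : ℕ → ℂ[X]), a ≠ 0 ∧ ∀ z ∈ D.Z, a.eval (D.T z) ≠ 0 →
    ‖z.1‖ ≤ 1 + ∑ i ∈ Finset.range M, ‖(c i).eval (D.T z)‖ / ‖a.eval (D.T z)‖ := by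
  obtain ⟨G, hG, hz⟩ := D.relation
  set H := Bivariate.swap (R := ℂ) G
  have hH : H ≠ 0 := by simpa [H] using hG
  refine ⟨H.leadingCoeff, H.natDegree, H.coeff, leadingCoeff_ne_zero.2 hH, fun z hzZ ha => ?_⟩
  have h0 : (fib H (D.T z)).eval z.1 = 0 := by
    have := hz z hzZ
    unfold fib
    rw [map_evalRingHom_eval]
    unfold pfn fib at this
    rw [map_evalRingHom_eval] at this
    rw [← this]
    have h9 := Bivariate.aevalAeval_swap (D.T z) z.1 G
    rw [coe_aevalAeval_eq_evalEval, coe_aevalAeval_eq_evalEval] at h9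
    exact h9
  have hdeg : (fib H (D.T z)).natDegree = H.natDegree := natDegree_map_of_leadingCoeff_ne_zero _ ha
  have hlc : (fib H (D.T z)).leadingCoeff = H.leadingCoeff.eval (D.T z) := by
    rw [leadingCoeff, hdeg]; simp [fib]
  set α := H.leadingCoeff.eval (D.T z)
  have := monic_root_bound (C α⁻¹ * fib H (D.T z)) H.natDegree (by rw [natDegree_C_mul (inv_ne_zero ha), hdeg])
    (by rw [Monic, leadingCoeff_mul, leadingCoeff_C, hlc, inv_mul_cancel₀ ha]) z.1 (by simp [h0])
  refine this.trans (le_of_eq ?_)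
  congr 1
  refine Finset.sum_congr rfl fun i _ => ?_
  simp [fib, div_eq_inv_mul]

lemma exists_section (h : D.Z ≃ₜ ℂ) : ∃ S : ℂ → ℂ × ℂ, (∀ s, S s ∈ D.Z) ∧ (∀ s, D.T (S s) = s) ∧
    ∀ s, HasDerivAt S (D.Xf (S s)) s := by
  obtain ⟨a, M, c, ha, hb⟩ := D.x_bound
  have hk : Continuous (fun w => (h.symm w : ℂ × ℂ)) := continuous_subtype_val.comp h.symm.continuous
  have hlh := D.isLocalHomeo h
  obtain ⟨σ, hσ, hσ'⟩ := topo_section _ hlh {s | a.eval s = 0} (by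
      refine (a.roots.toFinset.finite_toSet).subset fun s hs => ?_
      simpa [ha] using hs) (by
      intro K hK hKA
      have hKa : ∀ t ∈ K, a.eval t ≠ 0 := fun t ht h0 => Set.disjoint_left.1 hKA ht h0
      have hcont : ContinuousOn (fun t : ℂ => 1 + ∑ i ∈ Finset.range M, ‖(c i).eval t‖ / ‖a.eval t‖) K := by
        refine continuousOn_const.add (continuousOn_finsetSum _ fun i _ => ?_)
        exact (c i).continuous.norm.continuousOn.div a.continuous.norm.continuousOn
          fun t ht => norm_ne_zero_iff.2 (hKa t ht)
      obtain ⟨B, hB⟩ := hK.exists_bound_of_continuousOn hcont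
      have hcZ := D.isCompact_Z B
      have hc2 : IsCompact (h '' ((Subtype.val : D.Z → ℂ × ℂ) ⁻¹' {z | ‖z.1‖ ≤ B})) := by
        refine IsCompact.image ?_ h.continuous
        rw [Subtype.isCompact_iff, Subtype.image_preimage_coe]
        exact hcZ
      refine hc2.of_isClosed_subset (hK.isClosed.preimage hlh.continuous) ?_
      intro w hw
      refine ⟨h.symm w, ?_, by simp⟩
      exact (hb _ (h.symm w).2 (hKa _ hw)).trans ((le_abs_self _).trans (hB _ hw)))
  refine ⟨fun s => h.symm (σ s), fun s => (h.symm (σ s)).2, hσ', fun s => ?_⟩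
  obtain ⟨γ, h1, h2, h3⟩ := D.local_inv _ (h.symm (σ s)).2
  have hTs : D.T (h.symm (σ s) : ℂ × ℂ) = s := hσ' s
  rw [hTs] at h1 h2
  have hkt : Tendsto (fun s => (h.symm (σ s) : ℂ × ℂ)) (𝓝 s) (𝓝[D.Z] (h.symm (σ s) : ℂ × ℂ)) :=
    tendsto_nhdsWithin_iff.2 ⟨(hk.comp hσ).tendsto s, Eventually.of_forall fun w => (h.symm _).2⟩
  have he : (fun s => (h.symm (σ s) : ℂ × ℂ)) =ᶠ[𝓝 s] γ := by
    filter_upwards [hkt.eventually h3] with s' hs'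
    have : D.T (h.symm (σ s') : ℂ × ℂ) = s' := hσ' s'
    rw [this] at hs'
    exact hs'.symm
  have := h2.self_of_nhds.2.1
  rw [h1] at this
  exact this.congr_of_eventuallyEq he
end Dat
end AMS

end

section
namespace AMS
set_option linter.unusedSectionVars false
set_option linter.unusedVariables false
open Topology Filter Polynomial

namespace Dat
variable (D : Dat)
lemma exists_poly (h : D.Z ≃ₜ ℂ) : ∃ x y : ℂ[X], (∀ s, (x.eval s, y.eval s) ∈ D.Z) ∧
    (∀ s, (derivative x).eval s = D.py (x.eval s, y.eval s)) ∧
    (∀ s, (derivative y).eval s = -D.px (x.eval s, y.eval s)) := by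
  obtain ⟨S, hZ, hT, hd⟩ := D.exists_section h
  have hx : ∀ s, HasDerivAt (fun s => (S s).1) (D.py (S s)) s := fun s => (hd s).fst
  have hy : ∀ s, HasDerivAt (fun s => (S s).2) (-D.px (S s)) s := fun s => (hd s).snd
  have hxd : Differentiable ℂ (fun s => (S s).1) := fun s => (hx s).differentiableAt
  have hyd : Differentiable ℂ (fun s => (S s).2) := fun s => (hy s).differentiableAt
  have hn : ∀ s : ℂ, 0 ≤ ‖s‖ := fun s => norm_nonneg _
  have hbx : PB (fun s : ℂ => ‖s‖) (fun s => ‖(S s).1‖) := by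
    obtain ⟨a, M, c, ha, hb⟩ := D.x_bound
    obtain ⟨R, δ, hR, hδ, hl⟩ := poly_lower a ha
    obtain ⟨B, hB⟩ := (isCompact_closedBall (0:ℂ) R).exists_bound_of_continuousOn hxd.continuous.continuousOn
    refine PB.mono (f := fun s => (1 + max B 0) + ∑ i ∈ Finset.range M, ‖(c i).eval s‖ * δ⁻¹) ?_ ?_
    · exact PB.add hn (PB.const _) (PB.sum hn _ _ fun i _ =>
        PB.mul hn (PB.eval hn (PB.self hn) _) (PB.const _) (fun _ => (inv_pos.2 hδ).le))
    · intro s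
      have hnn : 0 ≤ ∑ i ∈ Finset.range M, ‖(c i).eval s‖ * δ⁻¹ :=
        Finset.sum_nonneg fun i _ => by positivity
      rcases le_total R ‖s‖ with h1 | h1
      · have h2 := hl s h1
        have h3 := hb (S s) (hZ s)
        rw [hT] at h3
        refine (h3 (norm_pos_iff.1 (hδ.trans_le h2))).trans ?_
        have : ∑ i ∈ Finset.range M, ‖(c i).eval s‖ / ‖a.eval s‖ ≤ ∑ i ∈ Finset.range M, ‖(c i).eval s‖ * δ⁻¹ := by
          refine Finset.sum_le_sum fun i _ => ?_
          rw [← div_eq_mul_inv]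
          gcongr
        linarith [le_max_right B 0]
      · have := hB s (by simpa using h1)
        linarith [le_max_left B 0]
  have hby : PB (fun s : ℂ => ‖s‖) (fun s => ‖(S s).2‖) := by
    obtain ⟨C, k, hC, h⟩ := D.PB_y
    exact PB.trans hn (fun s => norm_nonneg _) hbx ⟨C, k, hC, fun s => h ⟨S s, hZ s⟩⟩
  obtain ⟨x, hx'⟩ := entire_poly _ hxd hbx
  obtain ⟨y, hy'⟩ := entire_poly _ hyd hby
  have hS : ∀ s, S s = (x.eval s, y.eval s) := fun s => Prod.ext (hx' s) (hy' s)
  refine ⟨x, y, fun s => hS s ▸ hZ s, fun s => ?_, fun s => ?_⟩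
  · have h1 := hx s
    rw [hS s] at h1
    exact ((x.hasDerivAt s).unique (h1.congr_of_eventuallyEq (Eventually.of_forall fun s => (hx' s).symm)))
  · have h1 := hy s
    rw [hS s] at h1
    exact ((y.hasDerivAt s).unique (h1.congr_of_eventuallyEq (Eventually.of_forall fun s => (hy' s).symm)))
end Dat

abbrev MP := MvPolynomial (Fin 2) ℂ

lemma pfn_eq (q : MP) (v : ℂ × ℂ) :
    pfn ((Bivariate.equivMvPolynomial ℂ).symm q) v = MvPolynomial.eval ![v.1, v.2] q := by
  induction q using MvPolynomial.induction_on with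
  | C a => simp [pfn, fib]
  | add p q hp hq =>
    rw [map_add, map_add, ← hp, ← hq]; simp [pfn, fib]
  | mul_X p i hp =>
    rw [map_mul, map_mul, ← hp]
    fin_cases i <;> simp [pfn, fib]

lemma hasStrict (q : MP) (v : ℂ × ℂ) : HasStrictFDerivAt (fun v : ℂ × ℂ => MvPolynomial.eval ![v.1, v.2] q)
    (MvPolynomial.eval ![v.1, v.2] (MvPolynomial.pderiv 0 q) • ContinuousLinearMap.fst ℂ ℂ ℂ +
      MvPolynomial.eval ![v.1, v.2] (MvPolynomial.pderiv 1 q) • ContinuousLinearMap.snd ℂ ℂ ℂ) v := by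
  induction q using MvPolynomial.induction_on with
  | C a =>
    simp only [MvPolynomial.eval_C]
    refine (hasStrictFDerivAt_const a v).congr_fderiv ?_
    ext <;> simp
  | add p q hp hq =>
    simp only [map_add]
    refine (hp.add hq).congr_fderiv ?_
    ext <;> simp
  | mul_X p i hp =>
    simp only [map_mul, MvPolynomial.eval_X]
    fin_cases i
    · refine (hp.mul (hasStrictFDerivAt_fst (p := v))).congr_fderiv ?_
      ext <;> simp [MvPolynomial.pderiv_X]
    · refine (hp.mul (hasStrictFDerivAt_snd (p := v))).congr_fderiv ?_
      ext <;> simp [MvPolynomial.pderiv_X]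

lemma eval_aeval (x y : ℂ[X]) (q : MP) (s : ℂ) :
    (MvPolynomial.aeval ![x, y] q : ℂ[X]).eval s = MvPolynomial.eval ![x.eval s, y.eval s] q := by
  induction q using MvPolynomial.induction_on with
  | C a => simp
  | add p q hp hq => simp [hp, hq]
  | mul_X p i hp => fin_cases i <;> simp [hp]

lemma aeval_mem (x y : ℂ[X]) (q : MP) : MvPolynomial.aeval ![x, y] q ∈ Algebra.adjoin ℂ {x, y} := by
  induction q using MvPolynomial.induction_on with
  | C a => simpa using Subalgebra.algebraMap_mem (Algebra.adjoin ℂ {x, y}) a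
  | add p q hp hq => rw [map_add]; exact add_mem hp hq
  | mul_X p i hp =>
    rw [map_mul]
    refine mul_mem hp ?_
    fin_cases i
    · simpa using Algebra.subset_adjoin (by simp)
    · simpa using Algebra.subset_adjoin (by simp)

lemma X_mem_of_deriv (A : Subalgebra ℂ ℂ[X]) (hA : ∀ u ∈ A, derivative u ∈ A) :
    ∀ n : ℕ, ∀ u ∈ A, u.natDegree = n + 1 → X ∈ A := by
  intro n
  induction n with
  | zero =>
    intro u hu hn
    obtain ⟨a, ha, b, rfl⟩ := natDegree_eq_one.1 hn
    have : (X : ℂ[X]) = a⁻¹ • ((C a * X + C b) - algebraMap ℂ ℂ[X] b) := by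
      rw [smul_eq_C_mul]
      simp [← mul_assoc, ← C_mul, ha]
    rw [this]
    exact A.smul_mem (sub_mem hu (A.algebraMap_mem b)) _
  | succ n ih =>
    intro u hu hn
    exact ih _ (hA u hu) (by rw [natDegree_derivative, hn]; rfl)

lemma monic_case (p : MP) (hirr : Irreducible p) (hm : ((Bivariate.equivMvPolynomial ℂ).symm p).Monic)
    (hs : ∀ v : ℂ × ℂ, MvPolynomial.eval ![v.1, v.2] p = 0 →
      MvPolynomial.eval ![v.1, v.2] (MvPolynomial.pderiv 0 p) ≠ 0 ∨
      MvPolynomial.eval ![v.1, v.2] (MvPolynomial.pderiv 1 p) ≠ 0)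
    (h : {v : ℂ × ℂ | MvPolynomial.eval ![v.1, v.2] p = 0} ≃ₜ ℂ) :
    ∃ x y : ℂ[X], X ∈ Algebra.adjoin ℂ {x, y} ∧ MvPolynomial.aeval ![x, y] p = 0 := by
  set P := (Bivariate.equivMvPolynomial ℂ).symm p with hP
  have h0 : pfn P = fun v : ℂ × ℂ => MvPolynomial.eval ![v.1, v.2] p := by
    funext v; exact pfn_eq p v
  have h1 : pfn (derivative P) = fun v : ℂ × ℂ => MvPolynomial.eval ![v.1, v.2] (MvPolynomial.pderiv 1 p) := by
    funext v
    rw [← pfn_eq]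
    congr 1
    rw [AlgEquiv.eq_symm_apply, ← Bivariate.pderiv_one_equivMvPolynomial, hP, AlgEquiv.apply_symm_apply]
  have hdiff : ∀ q : MP, Differentiable ℂ (fun v : ℂ × ℂ => MvPolynomial.eval ![v.1, v.2] q) :=
    fun q v => (hasStrict q v).hasFDerivAt.differentiableAt
  have hd : ∀ v, HasStrictFDerivAt (pfn P) (MvPolynomial.eval ![v.1, v.2] (MvPolynomial.pderiv 0 p) •
      ContinuousLinearMap.fst ℂ ℂ ℂ + pfn (derivative P) v • ContinuousLinearMap.snd ℂ ℂ ℂ) v := by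
    intro v; rw [h0, h1]; exact hasStrict p v
  have hsm : ∀ v, pfn P v = 0 → MvPolynomial.eval ![v.1, v.2] (MvPolynomial.pderiv 0 p) ≠ 0 ∨ pfn (derivative P) v ≠ 0 := by
    intro v; rw [h0, h1]; exact hs v
  have hpy : Differentiable ℂ (pfn (derivative P)) := h1 ▸ hdiff _
  have hZe : {v : ℂ × ℂ | pfn P v = 0} = {v : ℂ × ℂ | MvPolynomial.eval ![v.1, v.2] p = 0} := by rw [h0]
  have h' : {v : ℂ × ℂ | pfn P v = 0} ≃ₜ ℂ := (Homeomorph.setCongr hZe).trans h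
  obtain ⟨T, hT⟩ := global_T (charts (pfn P) _ _ hd (hdiff _) hpy hsm) h'
  let D : Dat := ⟨P, hm, (MulEquiv.irreducible_iff (Bivariate.equivMvPolynomial ℂ).symm).2 hirr, _, hdiff _, hpy, hd, hsm, T, hT⟩
  obtain ⟨x, y, hz, hx, hy⟩ := D.exists_poly h'
  have hx2 : derivative x = MvPolynomial.aeval ![x, y] (MvPolynomial.pderiv 1 p) := by
    refine Polynomial.funext fun s => ?_
    rw [hx, eval_aeval]
    exact congrFun h1 _
  have hy2 : derivative y = MvPolynomial.aeval ![x, y] (-MvPolynomial.pderiv 0 p) := by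
    refine Polynomial.funext fun s => ?_
    rw [hy, eval_aeval, map_neg]
  have hA : ∀ u ∈ Algebra.adjoin ℂ {x, y}, derivative u ∈ Algebra.adjoin ℂ {x, y} := by
    intro u hu
    induction hu using Algebra.adjoin_induction with
    | mem u hu =>
      rcases hu with rfl | rfl
      · rw [hx2]; exact aeval_mem _ _ _
      · rw [hy2]; exact aeval_mem _ _ _
    | algebraMap r => simp [zero_mem]
    | add u v _ _ h1 h2 => rw [derivative_add]; exact add_mem h1 h2
    | mul u v hu hv h1 h2 => rw [derivative_mul]; exact add_mem (mul_mem h1 hv) (mul_mem hu h2)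
  refine ⟨x, y, ?_, ?_⟩
  · have : ∃ u ∈ ({x, y} : Set ℂ[X]), u.natDegree ≠ 0 := by
      by_contra hcon
      push Not at hcon
      have e1 := derivative_eq_zero.2 (hcon x (by simp))
      have e2 := derivative_eq_zero.2 (hcon y (by simp))
      rcases D.hsm _ (hz 0) with h3 | h3
      · apply h3
        have := hy 0
        rw [e2] at this
        simpa using this.symm
      · apply h3
        have := hx 0
        rw [e1] at this
        simpa using this.symm
    obtain ⟨u, hu, hun⟩ := this
    obtain ⟨n, hn⟩ := Nat.exists_eq_succ_of_ne_zero hun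
    exact X_mem_of_deriv _ hA n u (Algebra.subset_adjoin hu) hn
  · refine Polynomial.funext fun s => ?_
    rw [eval_aeval, eval_zero]
    have : pfn P (x.eval s, y.eval s) = 0 := hz s
    rwa [h0] at this
end AMS

end

namespace AMS
set_option linter.unusedSectionVars false
set_option linter.unusedVariables false
open Topology Filter Polynomial

lemma term_lead (r i : ℕ) (hr : 0 < r) (f : ℂ[X]) (hf : f ≠ 0) :
    ((f.map C).comp (X ^ r + C X) * X ^ i : ℂ[X][X]).leadingCoeff = C f.leadingCoeff ∧
    ((f.map C).comp (X ^ r + C X) * X ^ i : ℂ[X][X]).natDegree = f.natDegree * r + i := by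
  have hg : (X ^ r + C X : ℂ[X][X]).Monic := monic_X_pow_add_C _ hr.ne'
  have hgd : (X ^ r + C X : ℂ[X][X]).natDegree = r := natDegree_X_pow_add_C
  have h1 : ((f.map C).comp (X ^ r + C X) : ℂ[X][X]).leadingCoeff = C f.leadingCoeff := by
    rw [leadingCoeff_comp (by omega), hg.leadingCoeff, one_pow, mul_one,
      leadingCoeff_map_of_injective C_injective]
  refine ⟨by rw [leadingCoeff_mul_X_pow, h1], ?_⟩
  rw [natDegree_mul_X_pow, natDegree_comp, hgd, natDegree_map_eq_of_injective C_injective]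
  intro h0
  rw [h0, leadingCoeff_zero] at h1
  exact hf (by simpa using h1.symm)

lemma sum_lead (r : ℕ) (hr : 0 < r) (F : ℕ → ℂ[X]) (s : Finset ℕ) (hs : ∀ i ∈ s, i < r) :
    (∑ i ∈ s, ((F i).map C).comp (X ^ r + C X) * X ^ i : ℂ[X][X]) = 0 ∧ (∀ i ∈ s, F i = 0) ∨
    ∃ c : ℂ, c ≠ 0 ∧ (∑ i ∈ s, ((F i).map C).comp (X ^ r + C X) * X ^ i : ℂ[X][X]).leadingCoeff = C c ∧
      (∑ i ∈ s, ((F i).map C).comp (X ^ r + C X) * X ^ i : ℂ[X][X]).natDegree % r ∈ s := by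
  classical
  induction s using Finset.induction_on with
  | empty => left; simp
  | insert i s his ih =>
    have ih := ih fun j hj => hs j (Finset.mem_insert_of_mem hj)
    rw [Finset.sum_insert his]
    set g : ℂ[X][X] := ∑ i ∈ s, ((F i).map C).comp (X ^ r + C X) * X ^ i
    by_cases hF : F i = 0
    · rw [hF]
      simp only [Polynomial.map_zero, zero_comp, zero_mul, zero_add]
      rcases ih with ⟨h1, h2⟩ | ⟨c, h1, h2, h3⟩
      · left
        refine ⟨h1, fun j hj => ?_⟩
        rcases Finset.mem_insert.1 hj with rfl | hj
        · exact hF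
        · exact h2 j hj
      · exact Or.inr ⟨c, h1, h2, Finset.mem_insert_of_mem h3⟩
    · right
      obtain ⟨h4, h5⟩ := term_lead r i hr (F i) hF
      set f : ℂ[X][X] := ((F i).map C).comp (X ^ r + C X) * X ^ i
      have h6 : f.natDegree % r = i := by
        rw [h5, Nat.mul_comm, Nat.mul_add_mod, Nat.mod_eq_of_lt (hs i (Finset.mem_insert_self _ _))]
      have hlc : (F i).leadingCoeff ≠ 0 := leadingCoeff_ne_zero.2 hF
      rcases ih with ⟨h1, h2⟩ | ⟨c, h1, h2, h3⟩
      · rw [h1, add_zero]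
        exact ⟨_, hlc, h4, by rw [h6]; exact Finset.mem_insert_self _ _⟩
      · have hne : f.natDegree ≠ g.natDegree := fun h => his (by rw [← h6, h]; exact h3)
        rcases lt_or_gt_of_ne hne with h | h
        · refine ⟨c, h1, ?_, ?_⟩
          · rw [leadingCoeff_add_of_degree_lt (degree_lt_degree h), h2]
          · rw [natDegree_add_eq_right_of_natDegree_lt h]; exact Finset.mem_insert_of_mem h3
        · refine ⟨_, hlc, ?_, ?_⟩
          · rw [leadingCoeff_add_of_degree_lt' (degree_lt_degree h), h4]
          · rw [natDegree_add_eq_left_of_natDegree_lt h, h6]; exact Finset.mem_insert_self _ _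

noncomputable def th (r : ℕ) : MP →ₐ[ℂ] MP :=
  MvPolynomial.aeval ![MvPolynomial.X 0 + MvPolynomial.X 1 ^ r, MvPolynomial.X 1]

noncomputable def thE (r : ℕ) : MP ≃ₐ[ℂ] MP :=
  AlgEquiv.ofAlgHom (th r)
    (MvPolynomial.aeval ![MvPolynomial.X 0 - MvPolynomial.X 1 ^ r, MvPolynomial.X 1])
    (by ext i; fin_cases i <;> simp [th]) (by ext i; fin_cases i <;> simp [th])

lemma th_symm (r : ℕ) (P : ℂ[X][X]) :
    (Bivariate.equivMvPolynomial ℂ).symm (th r (Bivariate.equivMvPolynomial ℂ P)) =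
      ∑ i ∈ Finset.range (P.natDegree + 1), ((P.coeff i).map C).comp (X ^ r + C X) * X ^ i := by
  have hC : ∀ f : ℂ[X], (Bivariate.equivMvPolynomial ℂ).symm (th r (Bivariate.equivMvPolynomial ℂ (C f))) =
      (f.map C).comp (X ^ r + C X) := by
    intro f
    induction f using Polynomial.induction_on' with
    | add p q hp hq => simp only [map_add, hp, hq, Polynomial.map_add, add_comp]
    | monomial n a =>
      rw [← C_mul_X_pow_eq_monomial]
      simp [th, add_comm]
  conv_lhs => rw [P.as_sum_range_C_mul_X_pow]
  simp only [map_sum, map_mul, map_pow, hC]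
  simp [th]

lemma th_X0 (r : ℕ) : th r (MvPolynomial.X 0) = MvPolynomial.X 0 + MvPolynomial.X 1 ^ r := by simp [th]
lemma th_X1 (r : ℕ) : th r (MvPolynomial.X 1) = MvPolynomial.X 1 := by simp [th]

lemma pderiv_th0 (r : ℕ) (q : MP) : MvPolynomial.pderiv 0 (th r q) = th r (MvPolynomial.pderiv 0 q) := by
  induction q using MvPolynomial.induction_on with
  | C a => simp [th]
  | add p q hp hq => simp [hp, hq]
  | mul_X p i hp =>
    simp only [map_mul, Derivation.leibniz, hp, map_add, smul_eq_mul]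
    fin_cases i <;> simp [th_X0, th_X1, MvPolynomial.pderiv_X]

lemma pderiv_th1 (r : ℕ) (q : MP) : MvPolynomial.pderiv 1 (th r q) =
    th r (MvPolynomial.pderiv 0 q) * ((r : MP) * MvPolynomial.X 1 ^ (r - 1)) + th r (MvPolynomial.pderiv 1 q) := by
  induction q using MvPolynomial.induction_on with
  | C a => simp [th]
  | add p q hp hq => simp [hp, hq]; ring
  | mul_X p i hp =>
    simp only [map_mul, Derivation.leibniz, hp, map_add, smul_eq_mul]
    fin_cases i <;> simp [th_X0, th_X1, MvPolynomial.pderiv_X, Derivation.leibniz_pow] <;> ring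

lemma eval_th (r : ℕ) (q : MP) (u v : ℂ) :
    MvPolynomial.eval ![u, v] (th r q) = MvPolynomial.eval ![u + v ^ r, v] q := by
  induction q using MvPolynomial.induction_on with
  | C a => simp [th]
  | add p q hp hq => simp [hp, hq]
  | mul_X p i hp =>
    rw [map_mul, map_mul, map_mul, hp]
    fin_cases i <;> simp [th]

lemma aeval_th (r : ℕ) (q : MP) (x y : ℂ[X]) :
    MvPolynomial.aeval ![x, y] (th r q) = MvPolynomial.aeval ![x + y ^ r, y] q := by
  induction q using MvPolynomial.induction_on with
  | C a => simp [th]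
  | add p q hp hq => simp [hp, hq]
  | mul_X p i hp =>
    rw [map_mul, map_mul, map_mul, hp]
    fin_cases i <;> simp [th]

noncomputable def shear (r : ℕ) : ℂ × ℂ ≃ₜ ℂ × ℂ where
  toFun v := (v.1 + v.2 ^ r, v.2)
  invFun v := (v.1 - v.2 ^ r, v.2)
  left_inv v := by simp
  right_inv v := by simp
  continuous_toFun := by fun_prop
  continuous_invFun := by fun_prop

lemma general_case (p : MP) (hirr : Irreducible p)
    (hs : ∀ v : ℂ × ℂ, MvPolynomial.eval ![v.1, v.2] p = 0 →
      MvPolynomial.eval ![v.1, v.2] (MvPolynomial.pderiv 0 p) ≠ 0 ∨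
      MvPolynomial.eval ![v.1, v.2] (MvPolynomial.pderiv 1 p) ≠ 0)
    (h : {v : ℂ × ℂ | MvPolynomial.eval ![v.1, v.2] p = 0} ≃ₜ ℂ) :
    ∃ x y : ℂ[X], X ∈ Algebra.adjoin ℂ {x, y} ∧ MvPolynomial.aeval ![x, y] p = 0 := by
  set P := (Bivariate.equivMvPolynomial ℂ).symm p with hP
  have hP0 : P ≠ 0 := by simpa [hP] using hirr.ne_zero
  set r := P.natDegree + 1
  have hth := th_symm r P
  rw [hP, AlgEquiv.apply_symm_apply, ← hP] at hth
  obtain ⟨c, hc, hlc⟩ : ∃ c : ℂ, c ≠ 0 ∧ ((Bivariate.equivMvPolynomial ℂ).symm (th r p)).leadingCoeff = C c := by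
    rw [hth]
    rcases sum_lead r (Nat.succ_pos _) P.coeff (Finset.range (P.natDegree + 1)) (fun i hi => Finset.mem_range.1 hi) with
      ⟨_, h2⟩ | ⟨c, h1, h2, _⟩
    · exact absurd (h2 P.natDegree (by simp)) (by simpa using hP0)
    · exact ⟨c, h1, h2⟩
  have hev : ∀ v : ℂ × ℂ, MvPolynomial.eval ![v.1, v.2] (MvPolynomial.C c⁻¹ * th r p) = 0 ↔
      MvPolynomial.eval ![v.1 + v.2 ^ r, v.2] p = 0 := by
    intro v
    rw [map_mul, eval_th]; simp [hc]
  have hu : IsUnit (MvPolynomial.C c⁻¹ : MP) := (isUnit_iff_ne_zero.2 (inv_ne_zero hc)).map MvPolynomial.C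
  obtain ⟨x, y, hX, hxy⟩ := monic_case (MvPolynomial.C c⁻¹ * th r p) (by
      rw [irreducible_isUnit_mul hu]
      exact (MulEquiv.irreducible_iff (thE r)).2 hirr) (by
      rw [map_mul, Bivariate.equivMvPolynomial_symm_C, Monic, leadingCoeff_mul, hlc, leadingCoeff_C, ← C_mul,
        inv_mul_cancel₀ hc, C_1]) (by
      intro v hv
      have h1 := hs (v.1 + v.2 ^ r, v.2) ((hev v).1 hv)
      by_contra hcon
      push Not at hcon
      obtain ⟨h2, h3⟩ := hcon
      rw [MvPolynomial.pderiv_C_mul, pderiv_th0] at h2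
      rw [MvPolynomial.pderiv_C_mul, pderiv_th1] at h3
      simp only [MvPolynomial.eval_C, map_mul, map_add, eval_th, mul_eq_zero, inv_eq_zero, hc, false_or] at h2 h3
      rw [h2, zero_mul, zero_add] at h3
      rcases h1 with h1 | h1
      · exact h1 h2
      · exact h1 h3) (by
      refine Homeomorph.trans ?_ h
      exact (shear r).subtype fun v => hev v)
  refine ⟨x + y ^ r, y, ?_, ?_⟩
  · refine (Algebra.adjoin_le ?_) hX
    have hy : y ∈ Algebra.adjoin ℂ {x + y ^ r, y} := Algebra.subset_adjoin (by simp)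
    have hx : x + y ^ r ∈ Algebra.adjoin ℂ {x + y ^ r, y} := Algebra.subset_adjoin (by simp)
    rintro u (rfl | rfl)
    · have := sub_mem hx (pow_mem hy r)
      rwa [add_sub_cancel_right] at this
    · exact hy
  · rw [map_mul, aeval_th, MvPolynomial.aeval_C] at hxy
    rcases mul_eq_zero.1 hxy with h1 | h1
    · simp [hc] at h1
    · exact h1
end AMS

open MvPolynomial

theorem abhyankar_moh_suzuki_geometric
    (p : MvPolynomial (Fin 2) ℂ) (hirr : Irreducible p)
    (Z : Set (ℂ × ℂ)) (hZ : Z = {v : ℂ × ℂ | eval ![v.1, v.2] p = 0})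
    (hne : Z.Nonempty)
    (hsmooth : ∀ v ∈ Z, eval ![v.1, v.2] (pderiv 0 p) ≠ 0 ∨
      eval ![v.1, v.2] (pderiv 1 p) ≠ 0)
    (htop : Nonempty (Z ≃ₜ ℂ)) :
    ∃ φ : MvPolynomial (Fin 2) ℂ ≃ₐ[ℂ] MvPolynomial (Fin 2) ℂ,
      φ p = X 0 := by
  subst hZ
  obtain ⟨h⟩ := htop
  obtain ⟨x, y, hX, hxy⟩ := AMS.general_case p hirr hsmooth h
  exact AMS.alg_part x y hX p hirr hxy
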